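/- Let n ≥ 3 and let F = (α+β)²/α be a (non-Riemannian) square metric on a connected open set U ⊆ ℝⁿ with 0 < b² < 1. Then F is of constant flag curvature (i.e., of scalar flag curvature with K constant) if and only if there exist smooth functions τ(x), λ(x) on U satisfying conditions (E1)–(E3) together with λ = −(5+4b²)τ². In this case the constant flag curvature is K = 0 (and η = 3τ²). -/

import Mathlib

open scoped BigOperators

noncomputable section

abbrev Vec (n : ℕ) := Fin n → ℝ

/-- Partial derivative of a function on `ℝⁿ` in the `k`-th coordinate direction. -/
def pd {n : ℕ} (f : Vec n → ℝ) (k : Fin n) (x : Vec n) : ℝ :=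
  fderiv ℝ f x (Pi.single k 1)

/-- Partial derivative in the base (`x`) variable of a function of `(x, y)`. -/
def pdx {n : ℕ} (f : Vec n → Vec n → ℝ) (k : Fin n) (x y : Vec n) : ℝ :=
  fderiv ℝ (fun x' => f x' y) x (Pi.single k 1)

/-- Partial derivative in the fiber (`y`) variable of a function of `(x, y)`. -/
def pdy {n : ℕ} (f : Vec n → Vec n → ℝ) (k : Fin n) (x y : Vec n) : ℝ :=
  fderiv ℝ (fun y' => f x y') y (Pi.single k 1)

/-- The fundamental tensor `g_{ij} = ½ ∂²(F²)/∂yⁱ∂yʲ` of a Finsler metric `F`. -/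
def fundTensor {n : ℕ} (F : Vec n → Vec n → ℝ) (x y : Vec n) : Matrix (Fin n) (Fin n) ℝ :=
  Matrix.of fun i j => (1/2) * pdy (fun x y => pdy (fun x y => (F x y)^2) j x y) i x y

/-- The geodesic coefficients `Gⁱ = ¼ g^{il}(yᵏ ∂²(F²)/∂xᵏ∂yˡ − ∂(F²)/∂xˡ)`. -/
def geoCoeff {n : ℕ} (F : Vec n → Vec n → ℝ) (i : Fin n) (x y : Vec n) : ℝ :=
  (1/4) * ∑ l, (fundTensor F x y)⁻¹ i l *
    ((∑ k, y k * pdx (fun x y => pdy (fun x y => (F x y)^2) l x y) k x y)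
      - pdx (fun x y => (F x y)^2) l x y)

/-- Riemann curvature `Rⁱ_k` associated to a spray `G`. -/
def curvOfSpray {n : ℕ} (G : Fin n → Vec n → Vec n → ℝ) (i k : Fin n) (x y : Vec n) : ℝ :=
  2 * pdx (G i) k x y
  - ∑ j, y j * pdx (fun x y => pdy (G i) k x y) j x y
  + 2 * ∑ j, G j x y * pdy (fun x y => pdy (G i) k x y) j x y
  - ∑ j, pdy (G i) j x y * pdy (G j) k x y

/-- Christoffel symbols `Γᵏ_{ij}` of a Riemannian metric field. -/
def christoffel {n : ℕ} (g : Vec n → Matrix (Fin n) (Fin n) ℝ) (k i j : Fin n) (x : Vec n) : ℝ :=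
  (1/2) * ∑ l, (g x)⁻¹ k l *
    (pd (fun x => g x l i) j x + pd (fun x => g x l j) i x - pd (fun x => g x i j) l x)

/-- The geodesic spray `Gⁱ_α = ½ Γⁱ_{jk} yʲ yᵏ` of a Riemannian metric. -/
def sprayOf {n : ℕ} (g : Vec n → Matrix (Fin n) (Fin n) ℝ) (i : Fin n) (x y : Vec n) : ℝ :=
  (1/2) * ∑ j, ∑ k, christoffel g i j k x * y j * y k

/-- Covariant derivative `b_{i|j}` of a 1-form w.r.t. a Riemannian metric. -/
def covDeriv {n : ℕ} (g : Vec n → Matrix (Fin n) (Fin n) ℝ) (b : Vec n → Vec n)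
    (i j : Fin n) (x : Vec n) : ℝ :=
  pd (fun x => b x i) j x - ∑ k, b x k * christoffel g k i j x

/-- `b² = a^{ij} b_i b_j`. -/
def bsq {n : ℕ} (a : Vec n → Matrix (Fin n) (Fin n) ℝ) (b : Vec n → Vec n) (x : Vec n) : ℝ :=
  ∑ i, ∑ j, (a x)⁻¹ i j * b x i * b x j

/-- `α(x,y) = √(a_{ij}(x) yⁱ yʲ)`. -/
def alphaOf {n : ℕ} (a : Vec n → Matrix (Fin n) (Fin n) ℝ) (x y : Vec n) : ℝ :=
  Real.sqrt (∑ i, ∑ j, a x i j * y i * y j)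

/-- `β(x,y) = b_i(x) yⁱ`. -/
def betaOf {n : ℕ} (b : Vec n → Vec n) (x y : Vec n) : ℝ := ∑ i, b x i * y i

/-- The square metric `F = (α+β)²/α`. -/
def sqMetric {n : ℕ} (a : Vec n → Matrix (Fin n) (Fin n) ℝ) (b : Vec n → Vec n)
    (x y : Vec n) : ℝ :=
  (alphaOf a x y + betaOf b x y)^2 / alphaOf a x y

/-- `F` is of scalar flag curvature on `U`. -/
def IsScalarFlag {n : ℕ} (U : Set (Vec n)) (F : Vec n → Vec n → ℝ) : Prop :=
  ∃ K : Vec n → Vec n → ℝ, ∀ x ∈ U, ∀ y : Vec n, y ≠ 0 → ∀ i k : Fin n,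
    curvOfSpray (geoCoeff F) i k x y =
      K x y * ((F x y)^2 * (if i = k then (1:ℝ) else 0)
        - y i * ∑ j, fundTensor F x y k j * y j)

/-- Conditions (E1)–(E3). -/
def E123 {n : ℕ} (U : Set (Vec n)) (a : Vec n → Matrix (Fin n) (Fin n) ℝ)
    (b : Vec n → Vec n) (τ lam : Vec n → ℝ) : Prop :=
  (∀ x ∈ U, ∀ i j : Fin n, covDeriv a b i j x =
      τ x * ((1 + 2 * bsq a b x) * a x i j - 3 * b x i * b x j)) ∧
  (∀ x ∈ U, ∀ y : Vec n, ∀ i k : Fin n,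
      curvOfSpray (sprayOf a) i k x y =
        lam x * ((alphaOf a x y)^2 * (if i = k then (1:ℝ) else 0)
            - y i * (∑ j, a x k j * y j))
        + 2 * (lam x + 4 * (2 + bsq a b x) * (τ x)^2) *
          ((betaOf b x y)^2 * (if i = k then (1:ℝ) else 0)
            + (alphaOf a x y)^2 * (∑ j, (a x)⁻¹ i j * b x j) * b x k
            - betaOf b x y * (∑ j, (a x)⁻¹ i j * b x j) * (∑ j, a x k j * y j)
            - betaOf b x y * b x k * y i)) ∧
  (∀ x ∈ U, ∀ i : Fin n, pd τ i x =
      (-(7 + 4 * bsq a b x) * (τ x)^2 - lam x) * b x i)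

/-- `F` is of constant flag curvature `K` on `U`. -/
def IsConstFlag {n : ℕ} (U : Set (Vec n)) (F : Vec n → Vec n → ℝ) (K : ℝ) : Prop :=
  ∀ x ∈ U, ∀ y : Vec n, y ≠ 0 → ∀ i k : Fin n,
    curvOfSpray (geoCoeff F) i k x y =
      K * ((F x y)^2 * (if i = k then (1:ℝ) else 0)
        - y i * ∑ j, fundTensor F x y k j * y j)

section SmoothAlgebra

/-- Extension by zero of a function on `W`. -/
def zeroExtend {E : Type*} (W : Set E) (f : W → ℝ) : E → ℝ := Function.extend Subtype.val f 0

theorem zeroExtend_apply {E : Type*} {W : Set E} (f : W → ℝ) {p : E} (hp : p ∈ W) :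
    zeroExtend W f p = f ⟨p, hp⟩ :=
  Subtype.val_injective.extend_apply f 0 ⟨p, hp⟩

variable {E : Type*} [NormedAddCommGroup E] [NormedSpace ℝ E]

/-- The algebra of smooth real functions on a subset `W` of a normed space. -/
def smoothAlgebra (W : Set E) : Subalgebra ℝ (W → ℝ) where
  carrier := {f | ContDiffOn ℝ (⊤ : ℕ∞) (zeroExtend W f) W}
  mul_mem' {f g} hf hg := (ContDiffOn.mul hf hg).congr fun p hp => by
    simp [zeroExtend_apply _ hp]
  add_mem' {f g} hf hg := (ContDiffOn.add hf hg).congr fun p hp => by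
    simp [zeroExtend_apply _ hp]
  algebraMap_mem' r := (contDiffOn_const (c := r)).congr fun p hp => by
    simp [zeroExtend_apply _ hp]

namespace smoothAlgebra

variable {W : Set E}

/-- The restriction to `W` of a function that is smooth on `W`. -/
def mk (f : E → ℝ) (hf : ContDiffOn ℝ (⊤ : ℕ∞) f W) : smoothAlgebra W :=
  ⟨fun p => f p, hf.congr fun p hp => by simp [zeroExtend_apply _ hp]⟩

/-- Evaluation at a point of `W`. -/
def eval (p : W) : smoothAlgebra W →ₐ[ℝ] ℝ :=
  (Pi.evalAlgHom ℝ (fun _ : W => ℝ) p).comp (smoothAlgebra W).val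

theorem eval_apply (p : W) (f : smoothAlgebra W) : eval p f = f.1 p := rfl

@[simp] theorem eval_mk (f : E → ℝ) (hf : ContDiffOn ℝ (⊤ : ℕ∞) f W) (p : W) :
    eval p (mk f hf) = f p := rfl

theorem ext_eval {f g : smoothAlgebra W} (h : ∀ p, eval p f = eval p g) : f = g :=
  Subtype.ext (funext h)

theorem fderiv_zeroExtend (hW : IsOpen W) (f : smoothAlgebra W) (v : E) :
    ContDiffOn ℝ (⊤ : ℕ∞) (fun p => fderiv ℝ (zeroExtend W f.1) p v) W :=
  (f.2.fderiv_of_isOpen hW (by simp)).clm_apply contDiffOn_const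

theorem differentiableAt (hW : IsOpen W) (f : smoothAlgebra W) (p : W) :
    DifferentiableAt ℝ (zeroExtend W f.1) p :=
  (ContDiffOn.contDiffAt f.2 (hW.mem_nhds p.2)).differentiableAt (by simp)

theorem zeroExtend_eventuallyEq (hW : IsOpen W) {f : smoothAlgebra W} {g : E → ℝ}
    (h : ∀ p : W, eval p f = g p) (p : W) : zeroExtend W f.1 =ᶠ[nhds (p : E)] g := by
  filter_upwards [hW.mem_nhds p.2] with q hq
  rw [zeroExtend_apply _ hq]
  exact h ⟨q, hq⟩

/-- The directional derivative along a constant vector, as a derivation. -/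
def dirDeriv (hW : IsOpen W) (v : E) : Derivation ℝ (smoothAlgebra W) (smoothAlgebra W) :=
  Derivation.mk'
    { toFun := fun f => mk _ (fderiv_zeroExtend hW f v)
      map_add' := fun f g => ext_eval fun p => by
        rw [map_add, eval_mk, eval_mk, eval_mk, (zeroExtend_eventuallyEq hW
          (g := zeroExtend W f.1 + zeroExtend W g.1)
          (fun p => by simp [eval_apply, zeroExtend_apply _ p.2]) p).fderiv_eq,
          fderiv_add (differentiableAt hW f p) (differentiableAt hW g p)]
        rfl
      map_smul' := fun r f => ext_eval fun p => by
        rw [map_smul, eval_mk, eval_mk, (zeroExtend_eventuallyEq hW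
          (g := r • zeroExtend W f.1)
          (fun p => by simp [eval_apply, zeroExtend_apply _ p.2]) p).fderiv_eq,
          fderiv_const_smul (differentiableAt hW f p)]
        rfl }
    fun f g => ext_eval fun p => by
      have h : eval p f = zeroExtend W f.1 p := (zeroExtend_apply _ p.2).symm
      have h' : eval p g = zeroExtend W g.1 p := (zeroExtend_apply _ p.2).symm
      simp only [LinearMap.coe_mk, AddHom.coe_mk, smul_eq_mul, map_add, map_mul, eval_mk]
      rw [(zeroExtend_eventuallyEq hW
          (g := zeroExtend W f.1 * zeroExtend W g.1)
          (fun p => by simp [eval_apply, zeroExtend_apply _ p.2]) p).fderiv_eq,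
          fderiv_mul (differentiableAt hW f p) (differentiableAt hW g p), h, h']
      simp

theorem eval_dirDeriv_zeroExtend (hW : IsOpen W) (v : E) (f : smoothAlgebra W) (p : W) :
    eval p (dirDeriv hW v f) = fderiv ℝ (zeroExtend W f.1) p v := rfl

theorem eval_dirDeriv (hW : IsOpen W) (v : E) {f : smoothAlgebra W} {g : E → ℝ}
    (h : ∀ p : W, eval p f = g p) (p : W) :
    eval p (dirDeriv hW v f) = fderiv ℝ g p v := by
  rw [eval_dirDeriv_zeroExtend, (zeroExtend_eventuallyEq hW h p).fderiv_eq]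

theorem dirDeriv_comm (hW : IsOpen W) (v w : E) (f : smoothAlgebra W) :
    dirDeriv hW v (dirDeriv hW w f) = dirDeriv hW w (dirDeriv hW v f) := by
  refine ext_eval fun p => ?_
  have hf : ContDiffAt ℝ (⊤ : ℕ∞) (zeroExtend W f.1) p :=
    ContDiffOn.contDiffAt f.2 (hW.mem_nhds p.2)
  have hd : DifferentiableAt ℝ (fderiv ℝ (zeroExtend W f.1)) p :=
    (hf.fderiv_right (m := 1) (by norm_cast)).differentiableAt (by simp)
  have key : ∀ u z : E, eval p (dirDeriv hW u (dirDeriv hW z f)) =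
      fderiv ℝ (fderiv ℝ (zeroExtend W f.1)) p u z := fun u z => by
    rw [eval_dirDeriv hW u (g := fun q => fderiv ℝ (zeroExtend W f.1) q z) (fun q => rfl),
      fderiv_clm_apply hd (by fun_prop)]
    simp
  rw [key, key]
  exact (hf.isSymmSndFDerivAt (by simp; norm_cast)).eq v w

end smoothAlgebra

end SmoothAlgebra

/-- Abstract data for the calculus of a Riemannian metric `a` and a one-form `b` on the slit
tangent bundle: an algebra with commuting families of base derivations `dx` and fibre derivations
`dy`, the fibre coordinates `y`, the norm `al` with inverse `ali`, the Christoffel symbols `Ga` and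
the covariant derivative `c` of `b`. -/
structure MetricCalc (n : ℕ) (A : Type*) [CommRing A] [Algebra ℝ A] where
  dx : Fin n → Derivation ℝ A A
  dy : Fin n → Derivation ℝ A A
  y : Fin n → A
  a : Fin n → Fin n → A
  ainv : Fin n → Fin n → A
  Ga : Fin n → Fin n → Fin n → A
  b : Fin n → A
  c : Fin n → Fin n → A
  al : A
  ali : A
  separated : ∀ f g : A, (∀ φ : A →ₐ[ℝ] ℝ, φ f = φ g) → f = g
  dx_dy : ∀ j k f, dx j (dy k f) = dy k (dx j f)
  dy_dy : ∀ j k f, dy j (dy k f) = dy k (dy j f)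
  dy_y : ∀ k i, dy k (y i) = if i = k then 1 else 0
  dx_y : ∀ k i, dx k (y i) = 0
  dy_a : ∀ k i j, dy k (a i j) = 0
  dy_ainv : ∀ k i j, dy k (ainv i j) = 0
  dy_Ga : ∀ k l i j, dy k (Ga l i j) = 0
  dy_b : ∀ k i, dy k (b i) = 0
  dy_c : ∀ k i j, dy k (c i j) = 0
  a_symm : ∀ i j, a i j = a j i
  ainv_symm : ∀ i j, ainv i j = ainv j i
  Ga_symm : ∀ l i j, Ga l i j = Ga l j i
  dx_a : ∀ k i j, dx k (a i j) = ∑ l, (a l j * Ga l i k + a i l * Ga l j k)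
  dx_b : ∀ k i, dx k (b i) = c i k + ∑ l, b l * Ga l i k
  ainv_a : ∀ i k, ∑ j, ainv i j * a j k = if i = k then 1 else 0
  al_sq : al * al = ∑ i, ∑ j, a i j * y i * y j
  al_ali : al * ali = 1

namespace MetricCalc

variable {n : ℕ} {A : Type*} [CommRing A] [Algebra ℝ A] (M : MetricCalc n A)

/-- The curvature of a spray. -/
def curv (G : Fin n → A) (i k : Fin n) : A :=
  2 * M.dx k (G i) - ∑ j, M.y j * M.dx j (M.dy k (G i))
    + 2 * ∑ j, G j * M.dy j (M.dy k (G i)) - ∑ j, M.dy j (G i) * M.dy k (G j)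

/-- The fibre coordinates with lowered index. -/
def yl (k : Fin n) : A := ∑ j, M.a k j * M.y j

/-- The nonlinear connection of the metric. -/
def conn (j k : Fin n) : A := ∑ l, M.Ga j k l * M.y l

/-- The geodesic spray of the metric. -/
def spray (i : Fin n) : A := algebraMap ℝ A (1 / 2) * ∑ j, M.conn i j * M.y j

/-- The one-form as a function on the tangent bundle. -/
def be : A := ∑ i, M.b i * M.y i

/-- The vector field dual to the one-form. -/
def bu (i : Fin n) : A := ∑ j, M.ainv i j * M.b j

/-- The squared norm of the one-form. -/
def bb : A := ∑ i, M.b i * M.bu i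

/-- The contraction `b_{0|l}`. -/
def c0 (l : Fin n) : A := ∑ i, M.c i l * M.y i

/-- The contraction `b_{0|0}`. -/
def c00 : A := ∑ l, M.c0 l * M.y l

/-- The contraction `b_{l|0} - b_{0|l}`. -/
def sk (l : Fin n) : A := ∑ i, (M.c l i - M.c i l) * M.y i

/-- The contraction `b_{l|0} - b_{0|l}` with raised index. -/
def sku (i : Fin n) : A := ∑ j, M.ainv i j * M.sk j

/-- The contraction of `b_{l|0} - b_{0|l}` with the vector field dual to `b`. -/
def sk0 : A := ∑ i, M.bu i * M.sk i

theorem two_spray (i : Fin n) : 2 * M.spray i = ∑ j, M.conn i j * M.y j := by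
  have h : (2 : A) * algebraMap ℝ A (1 / 2) = 1 := by
    rw [← map_ofNat (algebraMap ℝ A) 2, ← map_mul]; norm_num
  rw [spray, ← mul_assoc, h, one_mul]

theorem half_mul_two : algebraMap ℝ A (1 / 2) * 2 = 1 := by
  rw [← map_ofNat (algebraMap ℝ A) 2, ← map_mul]; norm_num

theorem a_ainv (i k : Fin n) : ∑ j, M.a i j * M.ainv j k = if i = k then 1 else 0 := by
  rw [Finset.sum_congr rfl fun j _ => by
    rw [M.a_symm i j, M.ainv_symm j k, mul_comm], M.ainv_a k i]
  simp [eq_comm]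

theorem a_raise (w : Fin n → A) (i : Fin n) :
    ∑ j, M.a i j * ∑ k, M.ainv j k * w k = w i := by
  simp only [Finset.mul_sum, ← mul_assoc]
  rw [Finset.sum_comm]
  simp [← Finset.sum_mul, a_ainv]

theorem raise_a (w : Fin n → A) (i : Fin n) :
    ∑ j, M.ainv i j * ∑ k, M.a j k * w k = w i := by
  simp only [Finset.mul_sum, ← mul_assoc]
  rw [Finset.sum_comm]
  simp [← Finset.sum_mul, ainv_a]

theorem a_bu (i : Fin n) : ∑ j, M.a i j * M.bu j = M.b i := M.a_raise M.b i

theorem a_sku (i : Fin n) : ∑ j, M.a i j * M.sku j = M.sk i := M.a_raise M.sk i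

theorem yl_pair (w : Fin n → A) : ∑ i, M.yl i * w i = ∑ i, (∑ j, M.a i j * w j) * M.y i := by
  simp only [yl, Finset.sum_mul]
  rw [Finset.sum_comm]
  refine Finset.sum_congr rfl fun i _ => Finset.sum_congr rfl fun j _ => ?_
  rw [M.a_symm]; ring

theorem yl_y : ∑ i, M.yl i * M.y i = M.al * M.al := by
  rw [M.al_sq]
  simp only [yl, Finset.sum_mul]
  refine Finset.sum_congr rfl fun i _ => Finset.sum_congr rfl fun j _ => ?_
  ring

theorem yl_bu : ∑ i, M.yl i * M.bu i = M.be := by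
  rw [yl_pair]; simp only [a_bu, be]

theorem a_y (i : Fin n) : ∑ j, M.a i j * M.y j = M.yl i := rfl

theorem b_y : ∑ i, M.b i * M.y i = M.be := rfl

theorem b_bu : ∑ i, M.b i * M.bu i = M.bb := rfl

theorem sk_y : ∑ i, M.sk i * M.y i = 0 := by
  have h : ∑ i, M.sk i * M.y i = ∑ l, ∑ i, M.c l i * M.y i * M.y l
      - ∑ l, ∑ i, M.c i l * M.y i * M.y l := by
    simp only [sk, Finset.sum_mul, ← Finset.sum_sub_distrib]
    refine Finset.sum_congr rfl fun i _ => Finset.sum_congr rfl fun j _ => ?_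
    ring
  rw [h, sub_eq_zero, Finset.sum_comm]
  refine Finset.sum_congr rfl fun i _ => Finset.sum_congr rfl fun j _ => ?_
  ring

theorem yl_sku : ∑ i, M.yl i * M.sku i = 0 := by
  rw [yl_pair]; simp only [a_sku, sk_y]

theorem b_sku : ∑ i, M.b i * M.sku i = M.sk0 := by
  simp only [sku, sk0, bu, Finset.mul_sum, Finset.sum_mul]
  rw [Finset.sum_comm]
  refine Finset.sum_congr rfl fun i _ => Finset.sum_congr rfl fun j _ => ?_
  rw [M.ainv_symm]; ring

/-! ### Derivatives -/

theorem dy_half (k : Fin n) : M.dy k (algebraMap ℝ A (1 / 2)) = 0 := Derivation.map_algebraMap _ _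

theorem dy_two (k : Fin n) : M.dy k 2 = 0 := by
  simpa using (M.dy k).map_natCast 2

theorem dy_linear (w : Fin n → A) (hw : ∀ k i, M.dy k (w i) = 0) (k : Fin n) :
    M.dy k (∑ i, w i * M.y i) = w k := by
  simp [Derivation.leibniz, hw, M.dy_y]

theorem dy_yl (j k : Fin n) : M.dy j (M.yl k) = M.a k j :=
  M.dy_linear _ (fun _ _ => M.dy_a _ _ _) j

theorem dy_conn (l j k : Fin n) : M.dy l (M.conn j k) = M.Ga j k l :=
  M.dy_linear _ (fun _ _ => M.dy_Ga _ _ _ _) l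

theorem dy_be (k : Fin n) : M.dy k M.be = M.b k :=
  M.dy_linear _ (fun _ _ => M.dy_b _ _) k

theorem dy_c0 (k l : Fin n) : M.dy k (M.c0 l) = M.c l k + (M.c k l - M.c l k) := by
  rw [c0, M.dy_linear _ (fun _ _ => M.dy_c _ _ _)]; ring

theorem dy_bu (k i : Fin n) : M.dy k (M.bu i) = 0 := by
  simp [bu, Derivation.leibniz, M.dy_b, M.dy_ainv]

theorem dy_bb (k : Fin n) : M.dy k M.bb = 0 := by
  simp [bb, Derivation.leibniz, M.dy_b, M.dy_bu]

theorem conn_symm_y (i k : Fin n) : ∑ j, M.Ga i j k * M.y j = M.conn i k :=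
  Finset.sum_congr rfl fun j _ => by rw [M.Ga_symm]

theorem dy_spray (k i : Fin n) : M.dy k (M.spray i) = M.conn i k := by
  have h : M.dy k (∑ j, M.conn i j * M.y j) = 2 * M.conn i k := by
    simp only [map_sum, Derivation.leibniz, smul_eq_mul, M.dy_conn, M.dy_y, Finset.sum_add_distrib]
    rw [two_mul]
    congr 1
    · simp
    · rw [← M.conn_symm_y]
      exact Finset.sum_congr rfl fun j _ => mul_comm _ _
  rw [spray, Derivation.leibniz, h, dy_half, smul_eq_mul, smul_zero, add_zero, ← mul_assoc,
    half_mul_two, one_mul]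

theorem al_cancel {f g : A} (h : M.al * f = M.al * g) : f = g := by
  have h' := congrArg (M.ali * ·) h
  simp only [← mul_assoc, mul_comm M.ali M.al, M.al_ali, one_mul] at h'
  exact h'

theorem two_cancel {f g : A} (h : 2 * f = 2 * g) : f = g := by
  have h' := congrArg (algebraMap ℝ A (1 / 2) * ·) h
  simpa only [← mul_assoc, half_mul_two, one_mul] using h'

theorem dy_al (k : Fin n) : M.dy k M.al = M.ali * M.yl k := by
  have h := congrArg (M.dy k) M.al_sq
  have h2 : M.dy k (∑ i, ∑ j, M.a i j * M.y i * M.y j) = 2 * M.yl k := by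
    have : ∑ i, ∑ j, M.a i j * M.y i * M.y j = ∑ i, M.yl i * M.y i := by
      rw [yl_y, al_sq]
    rw [this]
    simp only [map_sum, Derivation.leibniz, smul_eq_mul, M.dy_yl, M.dy_y, Finset.sum_add_distrib]
    rw [two_mul]
    congr 1
    · simp
    · simp only [yl]
      exact Finset.sum_congr rfl fun j _ => by rw [M.a_symm]; ring
  rw [h2, Derivation.leibniz, smul_eq_mul] at h
  apply two_cancel
  apply M.al_cancel
  linear_combination h - 2 * M.yl k * M.al_ali

theorem dy_ali (k : Fin n) : M.dy k M.ali = - M.ali ^ 3 * M.yl k := by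
  have h := congrArg (M.dy k) M.al_ali
  rw [Derivation.leibniz, smul_eq_mul, smul_eq_mul, dy_al, Derivation.map_one_eq_zero] at h
  apply M.al_cancel
  linear_combination h + M.ali ^ 2 * M.yl k * M.al_ali

theorem dx_al (k : Fin n) : M.dx k M.al = ∑ j, M.conn j k * M.dy j M.al := by
  have h := congrArg (M.dx k) M.al_sq
  have h2 : M.dx k (∑ i, ∑ j, M.a i j * M.y i * M.y j) = 2 * ∑ j, M.conn j k * M.yl j := by
    simp only [map_sum, Derivation.leibniz, smul_eq_mul, M.dx_y, M.dx_a, mul_zero, zero_add,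
      Finset.sum_add_distrib, Finset.mul_sum, mul_add]
    have e1 : ∑ j, M.conn j k * M.yl j =
        ∑ x, ∑ x', ∑ i, M.y x' * (M.y x * (M.a i x' * M.Ga i x k)) := by
      have : ∀ j, M.conn j k * M.yl j =
          ∑ x, ∑ x', M.y x' * (M.y x * (M.a j x' * M.Ga j x k)) := fun j => by
        rw [conn, yl, Finset.sum_mul_sum]
        refine Finset.sum_congr rfl fun i _ => Finset.sum_congr rfl fun l _ => ?_
        rw [M.Ga_symm]; ring
      simp only [this]
      rw [Finset.sum_comm]
      exact Finset.sum_congr rfl fun i _ => Finset.sum_comm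
    rw [← Finset.mul_sum, e1, two_mul]
    congr 1
    rw [Finset.sum_comm]
    refine Finset.sum_congr rfl fun i _ => Finset.sum_congr rfl fun l _ =>
      Finset.sum_congr rfl fun m _ => ?_
    rw [M.a_symm l m]; ring
  rw [h2, Derivation.leibniz, smul_eq_mul] at h
  apply two_cancel
  apply M.al_cancel
  simp only [dy_al]
  have e : ∑ j, M.conn j k * (M.ali * M.yl j) = M.ali * ∑ j, M.conn j k * M.yl j := by
    rw [Finset.mul_sum]; exact Finset.sum_congr rfl fun j _ => by ring
  rw [e]
  linear_combination h - (2 * ∑ j, M.conn j k * M.yl j) * M.al_ali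

theorem dx_ali (k : Fin n) : M.dx k M.ali = ∑ j, M.conn j k * M.dy j M.ali := by
  have h := congrArg (M.dx k) M.al_ali
  rw [Derivation.leibniz, smul_eq_mul, smul_eq_mul, dx_al, Derivation.map_one_eq_zero] at h
  apply M.al_cancel
  have e : M.al * ∑ j, M.conn j k * M.dy j M.ali = - (M.ali * ∑ j, M.conn j k * M.dy j M.al) := by
    rw [Finset.mul_sum, Finset.mul_sum, ← Finset.sum_neg_distrib]
    refine Finset.sum_congr rfl fun j _ => ?_
    rw [dy_ali, dy_al]
    linear_combination (- M.conn j k * M.ali ^ 2 * M.yl j) * M.al_ali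
  rw [e]
  linear_combination h

theorem dx_be (k : Fin n) : M.dx k M.be = ∑ j, M.conn j k * M.dy j M.be + M.c0 k := by
  simp only [dy_be]
  simp only [be, map_sum, Derivation.leibniz, smul_eq_mul, M.dx_y, M.dx_b, mul_zero, zero_add,
    mul_add, Finset.sum_add_distrib, Finset.mul_sum]
  rw [add_comm, c0]
  congr 1
  · rw [Finset.sum_comm]
    refine Finset.sum_congr rfl fun j _ => ?_
    rw [conn, Finset.sum_mul]
    exact Finset.sum_congr rfl fun i _ => by rw [M.Ga_symm]; ring
  · exact Finset.sum_congr rfl fun j _ => by ring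

end MetricCalc

namespace MetricCalc

variable {n : ℕ} {A : Type*} [CommRing A] [Algebra ℝ A] (M : MetricCalc n A)

/-- The horizontal derivation `δ_k = ∂_k - N^j_k ∂̇_j`. -/
def hor (k : Fin n) : Derivation ℝ A A := M.dx k - ∑ j, M.conn j k • M.dy j

theorem hor_apply (k : Fin n) (f : A) :
    M.hor k f = M.dx k f - ∑ j, M.conn j k * M.dy j f := by
  have h : (⇑(∑ j, M.conn j k • M.dy j) : A → A) = ∑ j, ⇑(M.conn j k • M.dy j) :=
    map_sum (Derivation.coeFnAddMonoidHom (R := ℝ) (A := A) (M := A)) _ _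
  simp [hor, h]

theorem hor_al (k : Fin n) : M.hor k M.al = 0 := by rw [hor_apply, dx_al, sub_self]

theorem hor_ali (k : Fin n) : M.hor k M.ali = 0 := by rw [hor_apply, dx_ali, sub_self]

theorem hor_be (k : Fin n) : M.hor k M.be = M.c0 k := by rw [hor_apply, dx_be]; ring

/-- The square of the square metric `(α + β)² / α`. -/
def energy : A := (M.al + M.be) ^ 4 * M.ali ^ 2

/-- The derivative of the energy with respect to `β`. -/
def energyBe : A := 4 * (M.al + M.be) ^ 3 * M.ali ^ 2

theorem hor_energy (k : Fin n) : M.hor k M.energy = M.energyBe * M.c0 k := by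
  simp only [energy, energyBe, Derivation.leibniz, Derivation.leibniz_pow, map_add, hor_al,
    hor_ali, hor_be, smul_eq_mul, nsmul_eq_mul]
  push_cast
  ring

theorem dx_energy (k : Fin n) : M.dx k M.energy =
    ∑ j, M.conn j k * M.dy j M.energy + M.energyBe * M.c0 k := by
  rw [← hor_energy, hor_apply]; ring

theorem euler_lagrange (l : Fin n) :
    ∑ k, M.y k * M.dx k (M.dy l M.energy) - M.dx l M.energy =
      2 * ∑ j, M.dy l (M.dy j M.energy) * M.spray j
        + M.dy l M.energyBe * M.c00 + M.energyBe * M.sk l := by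
  have h : ∀ k, M.y k * M.dx k (M.dy l M.energy) =
      ∑ j, M.Ga j k l * M.y k * M.dy j M.energy
        + ∑ j, M.dy l (M.dy j M.energy) * (M.conn j k * M.y k)
        + M.dy l M.energyBe * (M.c0 k * M.y k) + M.energyBe * (M.c l k * M.y k) := fun k => by
    rw [M.dx_dy, dx_energy]
    simp only [map_add, map_sum, Derivation.leibniz, smul_eq_mul, M.dy_conn, M.dy_c0,
      Finset.sum_add_distrib, mul_add, Finset.mul_sum]
    have e1 : ∑ i, M.y k * (M.conn i k * M.dy l (M.dy i M.energy)) =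
        ∑ j, M.dy l (M.dy j M.energy) * (M.conn j k * M.y k) :=
      Finset.sum_congr rfl fun j _ => by ring
    have e2 : ∑ i, M.y k * (M.dy i M.energy * M.Ga i k l) =
        ∑ j, M.Ga j k l * M.y k * M.dy j M.energy :=
      Finset.sum_congr rfl fun j _ => by ring
    rw [e1, e2]; ring
  rw [Finset.sum_congr rfl fun k _ => h k, dx_energy]
  simp only [Finset.sum_add_distrib, ← Finset.mul_sum]
  have e1 : ∑ k, ∑ j, M.Ga j k l * M.y k * M.dy j M.energy =
      ∑ j, M.conn j l * M.dy j M.energy := by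
    rw [Finset.sum_comm]
    refine Finset.sum_congr rfl fun j _ => ?_
    rw [← conn_symm_y, Finset.sum_mul]
  have e2 : ∑ k, ∑ j, M.dy l (M.dy j M.energy) * (M.conn j k * M.y k) =
      2 * ∑ j, M.dy l (M.dy j M.energy) * M.spray j := by
    rw [Finset.sum_comm, Finset.mul_sum]
    refine Finset.sum_congr rfl fun j _ => ?_
    rw [← Finset.mul_sum, ← two_spray]; ring
  have e3 : M.sk l = ∑ k, M.c l k * M.y k - M.c0 l := by
    simp only [sk, c0, sub_mul, Finset.sum_sub_distrib]
  rw [e1, e2, e3, c00]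
  ring

theorem dy_energy (j : Fin n) : M.dy j M.energy =
    (4 * (M.al + M.be) ^ 3 * M.ali ^ 3 - 2 * (M.al + M.be) ^ 4 * M.ali ^ 4) * M.yl j
      + M.energyBe * M.b j := by
  simp only [energy, energyBe, Derivation.leibniz, Derivation.leibniz_pow, map_add, dy_al,
    dy_ali, dy_be, smul_eq_mul, nsmul_eq_mul]
  push_cast
  ring

theorem dy_energyBe (l : Fin n) : M.dy l M.energyBe =
    (12 * (M.al + M.be) ^ 2 * M.ali ^ 3 - 8 * (M.al + M.be) ^ 3 * M.ali ^ 4) * M.yl l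
      + 12 * (M.al + M.be) ^ 2 * M.ali ^ 2 * M.b l := by
  have h4 : M.dy l 4 = 0 := by simpa using (M.dy l).map_natCast 4
  simp only [energyBe, Derivation.leibniz, Derivation.leibniz_pow, map_add, dy_al,
    dy_ali, dy_be, smul_eq_mul, nsmul_eq_mul, h4]
  push_cast
  ring

theorem dy_dy_energy (l j : Fin n) : M.dy l (M.dy j M.energy) =
    (4 * (M.al + M.be) ^ 3 * M.ali ^ 3 - 2 * (M.al + M.be) ^ 4 * M.ali ^ 4) * M.a j l
      + ((12 * (M.al + M.be) ^ 2 * M.ali ^ 4 - 20 * (M.al + M.be) ^ 3 * M.ali ^ 5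
            + 8 * (M.al + M.be) ^ 4 * M.ali ^ 6) * M.yl l
          + (12 * (M.al + M.be) ^ 2 * M.ali ^ 3 - 8 * (M.al + M.be) ^ 3 * M.ali ^ 4) * M.b l)
        * M.yl j
      + ((12 * (M.al + M.be) ^ 2 * M.ali ^ 3 - 8 * (M.al + M.be) ^ 3 * M.ali ^ 4) * M.yl l
          + 12 * (M.al + M.be) ^ 2 * M.ali ^ 2 * M.b l) * M.b j := by
  have h4 : M.dy l 4 = 0 := by simpa using (M.dy l).map_natCast 4
  rw [dy_energy]
  simp only [Derivation.leibniz, Derivation.leibniz_pow, map_add, map_sub, dy_al, dy_energyBe,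
    dy_ali, dy_be, smul_eq_mul, nsmul_eq_mul, h4, dy_two, dy_yl, M.dy_b]
  push_cast
  ring

theorem dy_dy_energy_contract (l : Fin n) (w : Fin n → A) :
    ∑ j, M.dy l (M.dy j M.energy) * w j =
    (4 * (M.al + M.be) ^ 3 * M.ali ^ 3 - 2 * (M.al + M.be) ^ 4 * M.ali ^ 4) * ∑ j, M.a l j * w j
      + ((12 * (M.al + M.be) ^ 2 * M.ali ^ 4 - 20 * (M.al + M.be) ^ 3 * M.ali ^ 5
            + 8 * (M.al + M.be) ^ 4 * M.ali ^ 6) * M.yl l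
          + (12 * (M.al + M.be) ^ 2 * M.ali ^ 3 - 8 * (M.al + M.be) ^ 3 * M.ali ^ 4) * M.b l)
        * ∑ j, M.yl j * w j
      + ((12 * (M.al + M.be) ^ 2 * M.ali ^ 3 - 8 * (M.al + M.be) ^ 3 * M.ali ^ 4) * M.yl l
          + 12 * (M.al + M.be) ^ 2 * M.ali ^ 2 * M.b l) * ∑ j, M.b j * w j := by
  simp only [Finset.mul_sum, ← Finset.sum_add_distrib]
  refine Finset.sum_congr rfl fun j _ => ?_
  rw [dy_dy_energy, M.a_symm j l]
  ring

/-- Euler's relation for the energy. -/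
theorem dy_dy_energy_y (l : Fin n) :
    ∑ j, M.dy l (M.dy j M.energy) * M.y j = M.dy l M.energy := by
  rw [dy_dy_energy_contract, yl_y, dy_energy, energyBe, b_y, a_y]
  refine M.separated _ _ fun φ => ?_
  have h := congrArg φ M.al_ali
  simp only [map_mul, map_one] at h
  have h0 : φ M.al ≠ 0 := left_ne_zero_of_mul_eq_one h
  have h1 : φ M.ali = (φ M.al)⁻¹ := eq_inv_of_mul_eq_one_right h
  simp only [map_mul, map_add, map_sub, map_pow, map_ofNat, h1]
  field_simp
  ring

theorem dy_energy_y : ∑ j, M.dy j M.energy * M.y j = 2 * M.energy := by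
  simp only [dy_energy, add_mul, Finset.sum_add_distrib, mul_assoc, ← Finset.mul_sum, yl_y]
  rw [energyBe, energy, b_y]
  refine M.separated _ _ fun φ => ?_
  have h := congrArg φ M.al_ali
  simp only [map_mul, map_one] at h
  have h0 : φ M.al ≠ 0 := left_ne_zero_of_mul_eq_one h
  have h1 : φ M.ali = (φ M.al)⁻¹ := eq_inv_of_mul_eq_one_right h
  simp only [map_mul, map_add, map_sub, map_pow, map_ofNat, h1]
  field_simp
  ring

/-- The denominator `α - β`. -/
def den₁ : A := M.al - M.be

/-- The denominator `(1 + 2b²)α² - 3β²`. -/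
def den₂ : A := (1 + 2 * M.bb) * (M.al * M.al) - 3 * (M.be * M.be)

/-- The difference between the sprays of the square metric and of `α`; `e` and `d` stand for the
inverses of the two denominators. -/
def sprayDiff (e d : A) (i : Fin n) : A :=
  M.al ^ 2 * e * M.sku i + (M.c00 - 2 * M.al ^ 2 * M.sk0 * e) * d *
    ((M.al - 2 * M.be) * M.y i + M.al ^ 2 * M.bu i)

theorem pair_sprayDiff (w : Fin n → A) (e d : A) :
    ∑ i, w i * M.sprayDiff e d i = M.al ^ 2 * e * ∑ i, w i * M.sku i +
      (M.c00 - 2 * M.al ^ 2 * M.sk0 * e) * d *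
        ((M.al - 2 * M.be) * ∑ i, w i * M.y i + M.al ^ 2 * ∑ i, w i * M.bu i) := by
  simp only [Finset.mul_sum, ← Finset.sum_add_distrib]
  refine Finset.sum_congr rfl fun j _ => ?_
  rw [sprayDiff]; ring

theorem euler_lagrange_sprayDiff {e d : A} (he : M.den₁ * e = 1) (hd : M.den₂ * d = 1)
    (l : Fin n) :
    2 * ∑ j, M.dy l (M.dy j M.energy) * M.sprayDiff e d j =
      M.dy l M.energyBe * M.c00 + M.energyBe * M.sk l := by
  rw [dy_dy_energy_contract]
  simp only [pair_sprayDiff, yl_y, yl_bu, yl_sku, b_sku, a_sku, a_bu, dy_energyBe, b_y, b_bu, a_y]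
  simp only [energyBe]
  refine M.separated _ _ fun φ => ?_
  have h := congrArg φ M.al_ali
  replace he := congrArg φ he
  replace hd := congrArg φ hd
  simp only [den₁, den₂, map_mul, map_one, map_sub, map_add, map_ofNat] at h he hd
  have h0 : φ M.al ≠ 0 := left_ne_zero_of_mul_eq_one h
  have h1 : φ M.ali = (φ M.al)⁻¹ := eq_inv_of_mul_eq_one_right h
  have he0 := left_ne_zero_of_mul_eq_one he
  have he1 := eq_inv_of_mul_eq_one_right he
  have hd0 := right_ne_zero_of_mul_eq_one hd
  simp only [map_mul, map_add, map_sub, map_pow, map_ofNat, map_zero, h1, he1]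
  generalize φ M.al = α at *
  generalize φ M.be = β at *
  generalize φ M.bb = B at *
  generalize φ M.c00 = r at *
  generalize φ M.sk0 = s at *
  generalize φ (M.yl l) = Y at *
  generalize φ (M.b l) = b at *
  generalize φ (M.sk l) = z at *
  generalize φ d = δ at *
  have hB : B = (δ⁻¹ + 3 * β ^ 2 - α ^ 2) / (2 * α ^ 2) := by
    field_simp
    linear_combination hd
  subst hB
  field_simp
  ring

theorem euler_lagrange_spray {e d : A} (he : M.den₁ * e = 1) (hd : M.den₂ * d = 1) (l : Fin n) :
    ∑ k, M.y k * M.dx k (M.dy l M.energy) - M.dx l M.energy =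
      2 * ∑ j, M.dy l (M.dy j M.energy) * (M.spray j + M.sprayDiff e d j) := by
  simp only [mul_add, Finset.sum_add_distrib, euler_lagrange_sprayDiff M he hd, euler_lagrange]
  ring

end MetricCalc

namespace MetricCalc

variable {n : ℕ} {A : Type*} [CommRing A] [Algebra ℝ A] (M : MetricCalc n A)

theorem deriv_inv (D : Derivation ℝ A A) {E e : A} (h : E * e = 1) : D e = - e ^ 2 * D E := by
  have h1 := congrArg D h
  rw [Derivation.leibniz, smul_eq_mul, smul_eq_mul, Derivation.map_one_eq_zero] at h1
  linear_combination e * h1 - D e * h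

/-- A subalgebra containing the basic functions and stable under all derivations. -/
structure IsAdapted (R : Subalgebra ℝ A) : Prop where
  dx : ∀ k f, f ∈ R → M.dx k f ∈ R
  dy : ∀ k f, f ∈ R → M.dy k f ∈ R
  y : ∀ k, M.y k ∈ R
  al : M.al ∈ R
  ali : M.ali ∈ R
  ainv : ∀ i j, M.ainv i j ∈ R
  Ga : ∀ l i j, M.Ga l i j ∈ R
  b : ∀ i, M.b i ∈ R
  c : ∀ i j, M.c i j ∈ R

/-- The coefficient of the third power of the inverse `e` of `E` in the curvature of the spray
`P + H e`. -/
def polar (E : A) (P H : Fin n → A) (i k : Fin n) : A :=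
  ∑ j, (-(2 * M.y j * H i * M.dy k E * M.dx j E) + 4 * P j * H i * M.dy k E * M.dy j E
    - 2 * H j * (M.dy k (H i) * M.dy j E + M.dy j (H i) * M.dy k E + H i * M.dy j (M.dy k E))
    + M.dy j (H i) * H j * M.dy k E + H i * M.dy j E * M.dy k (H j))

theorem curv_pole {E e : A} (h : E * e = 1) (P H : Fin n → A) (i k : Fin n) :
    M.curv (fun i => P i + H i * e) i k =
      3 * (∑ j, H j * M.dy j E) * H i * M.dy k E * e ^ 4 + M.polar E P H i k * e ^ 3
      + (- 2 * H i * M.dx k E + ∑ j,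
          (M.y j * (M.dy k (H i) * M.dx j E + M.dx j (H i) * M.dy k E + H i * M.dx j (M.dy k E))
          - 2 * P j * (M.dy k (H i) * M.dy j E + M.dy j (H i) * M.dy k E
            + H i * M.dy j (M.dy k E))
          + 2 * H j * M.dy j (M.dy k (H i))
          - (M.dy j (H i) * M.dy k (H j) - M.dy j (P i) * H j * M.dy k E
            - H i * M.dy j E * M.dy k (P j)))) * e ^ 2
      + (2 * M.dx k (H i) + ∑ j, (- M.y j * M.dx j (M.dy k (H i))
          + 2 * P j * M.dy j (M.dy k (H i)) + 2 * H j * M.dy j (M.dy k (P i))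
          - (M.dy j (P i) * M.dy k (H j) + M.dy j (H i) * M.dy k (P j)))) * e
      + M.curv P i k := by
  have hy : ∀ k, M.dy k e = - e ^ 2 * M.dy k E := fun k => deriv_inv _ h
  have hx : ∀ k, M.dx k e = - e ^ 2 * M.dx k E := fun k => deriv_inv _ h
  have h1 : ∀ k i, M.dy k (P i + H i * e) =
      M.dy k (P i) + M.dy k (H i) * e - H i * M.dy k E * e ^ 2 := fun k i => by
    simp only [map_add, Derivation.leibniz, smul_eq_mul, hy]; ring
  simp only [curv, h1]
  simp only [map_add, map_sub, Derivation.leibniz, Derivation.leibniz_pow, smul_eq_mul, hy, hx,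
    nsmul_eq_mul, polar]
  push_cast
  simp only [mul_add, add_mul, Finset.mul_sum, Finset.sum_mul]
  rw [← sub_eq_zero]
  have aux : ∀ (u₁ u₂ v₁ v₂ v₃ : A) (s₁ s₂ s₃ t₀ t₁ t₂ t₃ r₁ r₂ r₃ : Fin n → A),
      u₁ + u₂ = v₁ + v₂ + v₃ →
      (∀ j, - s₁ j + s₂ j - s₃ j = t₀ j + t₁ j + t₂ j + t₃ j - r₁ j + r₂ j - r₃ j) →
      (u₁ + u₂) - ∑ j, s₁ j + ∑ j, s₂ j - ∑ j, s₃ j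
        - (∑ j, t₀ j + ∑ j, t₁ j + (v₁ + ∑ j, t₂ j) + (v₂ + ∑ j, t₃ j)
          + (v₃ - ∑ j, r₁ j + ∑ j, r₂ j - ∑ j, r₃ j)) = 0 := by
    intro u₁ u₂ v₁ v₂ v₃ s₁ s₂ s₃ t₀ t₁ t₂ t₃ r₁ r₂ r₃ hu hs
    have := Finset.sum_congr rfl fun j (_ : j ∈ Finset.univ) => hs j
    simp only [Finset.sum_add_distrib, Finset.sum_sub_distrib, Finset.sum_neg_distrib] at this
    linear_combination hu + this
  refine aux _ _ _ _ _ _ _ _ _ _ _ _ _ _ _ ?_ fun j => ?_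
  · ring
  · ring

end MetricCalc

namespace MetricCalc

variable {n : ℕ} {A : Type*} [CommRing A] [Algebra ℝ A] {M : MetricCalc n A}
  {R : Subalgebra ℝ A}

namespace IsAdapted

theorem be (hR : M.IsAdapted R) : M.be ∈ R := sum_mem fun i _ => mul_mem (hR.b i) (hR.y i)

theorem bu (hR : M.IsAdapted R) (i : Fin n) : M.bu i ∈ R :=
  sum_mem fun j _ => mul_mem (hR.ainv i j) (hR.b j)

theorem bb (hR : M.IsAdapted R) : M.bb ∈ R := sum_mem fun i _ => mul_mem (hR.b i) (hR.bu i)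

theorem conn (hR : M.IsAdapted R) (j k : Fin n) : M.conn j k ∈ R :=
  sum_mem fun l _ => mul_mem (hR.Ga j k l) (hR.y l)

theorem spray (hR : M.IsAdapted R) (i : Fin n) : M.spray i ∈ R :=
  mul_mem (R.algebraMap_mem _) (sum_mem fun j _ => mul_mem (hR.conn i j) (hR.y j))

theorem c00 (hR : M.IsAdapted R) : M.c00 ∈ R :=
  sum_mem fun l _ => mul_mem (sum_mem fun i _ => mul_mem (hR.c i l) (hR.y i)) (hR.y l)

theorem sk (hR : M.IsAdapted R) (l : Fin n) : M.sk l ∈ R :=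
  sum_mem fun i _ => mul_mem (sub_mem (hR.c l i) (hR.c i l)) (hR.y i)

theorem sku (hR : M.IsAdapted R) (i : Fin n) : M.sku i ∈ R :=
  sum_mem fun j _ => mul_mem (hR.ainv i j) (hR.sk j)

theorem sk0 (hR : M.IsAdapted R) : M.sk0 ∈ R := sum_mem fun i _ => mul_mem (hR.bu i) (hR.sk i)

theorem den₁ (hR : M.IsAdapted R) : M.den₁ ∈ R := sub_mem hR.al hR.be

theorem den₂ (hR : M.IsAdapted R) : M.den₂ ∈ R :=
  sub_mem (mul_mem (add_mem (one_mem _) (mul_mem (ofNat_mem R 2) hR.bb)) (mul_mem hR.al hR.al))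
    (mul_mem (ofNat_mem R 3) (mul_mem hR.be hR.be))

theorem energy (hR : M.IsAdapted R) : M.energy ∈ R :=
  mul_mem (pow_mem (add_mem hR.al hR.be) 4) (pow_mem hR.ali 2)

theorem polar (hR : M.IsAdapted R) {E : A} {P H : Fin n → A} (hE : E ∈ R) (hP : ∀ i, P i ∈ R)
    (hH : ∀ i, H i ∈ R) (i k : Fin n) : M.polar E P H i k ∈ R := by
  have h2 : (2 : A) ∈ R := ofNat_mem R 2
  have h4 : (4 : A) ∈ R := ofNat_mem R 4
  refine sum_mem fun j _ => ?_
  repeat' first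
    | exact hR.y _ | exact hP _ | exact hH _ | assumption | apply hR.dx | apply hR.dy
    | apply add_mem | apply sub_mem | apply neg_mem | apply mul_mem

theorem curv (hR : M.IsAdapted R) {P : Fin n → A} (hP : ∀ i, P i ∈ R) (i k : Fin n) :
    M.curv P i k ∈ R := by
  have h2 : (2 : A) ∈ R := ofNat_mem R 2
  unfold MetricCalc.curv
  repeat' first
    | exact hR.y _ | exact hP _ | assumption | apply hR.dx | apply hR.dy
    | apply add_mem | apply sub_mem | apply neg_mem | apply mul_mem | (apply sum_mem; intro _ _)

/-- The pole expansion of the curvature of the spray `P + H e`. -/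
theorem curv_pole (hR : M.IsAdapted R) {E e : A} (h : E * e = 1) {P H : Fin n → A} (hE : E ∈ R)
    (hP : ∀ i, P i ∈ R) (hH : ∀ i, H i ∈ R) (i k : Fin n) :
    ∃ Z₂ ∈ R, ∃ Z₁ ∈ R, M.curv (fun i => P i + H i * e) i k =
      3 * (∑ j, H j * M.dy j E) * H i * M.dy k E * e ^ 4 + M.polar E P H i k * e ^ 3
        + Z₂ * e ^ 2 + Z₁ * e + M.curv P i k := by
  have h2 : (2 : A) ∈ R := ofNat_mem R 2
  refine ⟨_, ?_, _, ?_, MetricCalc.curv_pole M h P H i k⟩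
  all_goals
    repeat' first
      | exact hR.y _ | exact hP _ | exact hH _ | assumption | apply hR.dx | apply hR.dy
      | apply add_mem | apply sub_mem | apply neg_mem | apply mul_mem | (apply sum_mem; intro _ _)

/-- The pole expansion of the Ricci curvature of the spray `P + H e`. -/
theorem ricci_pole (hR : M.IsAdapted R) {E e : A} (h : E * e = 1) {P H : Fin n → A} (hE : E ∈ R)
    (hP : ∀ i, P i ∈ R) (hH : ∀ i, H i ∈ R) :
    ∃ Z₂ ∈ R, ∃ Z₁ ∈ R, ∑ i, M.curv (fun i => P i + H i * e) i i =
      3 * (∑ j, H j * M.dy j E) ^ 2 * e ^ 4 + (∑ i, M.polar E P H i i) * e ^ 3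
        + Z₂ * e ^ 2 + Z₁ * e + ∑ i, M.curv P i i := by
  choose Z₂ h₂ Z₁ h₁ hZ using fun i => hR.curv_pole h hE hP hH i i
  refine ⟨∑ i, Z₂ i, sum_mem fun i _ => h₂ i, ∑ i, Z₁ i, sum_mem fun i _ => h₁ i, ?_⟩
  simp only [hZ, Finset.sum_add_distrib, ← Finset.sum_mul]
  congr 5
  simp only [mul_assoc, ← Finset.mul_sum, sq]

theorem pole_four (hR : M.IsAdapted R) {E e : A} (h : E * e = 1) {P H : Fin n → A} (hE : E ∈ R)
    (hP : ∀ i, P i ∈ R) (hH : ∀ i, H i ∈ R)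
    (hG : ∑ i, M.curv (fun i => P i + H i * e) i i ∈ R) :
    ∃ Z ∈ R, 3 * (∑ j, H j * M.dy j E) ^ 2 = E * Z := by
  obtain ⟨Z₂, h₂, Z₁, h₁, hZ⟩ := hR.ricci_pole h hE hP hH
  have h₃ : ∑ i, M.polar E P H i i ∈ R := sum_mem fun i _ => hR.polar hE hP hH i i
  have h₀ : ∑ i, M.curv P i i ∈ R := sum_mem fun i _ => hR.curv hP i i
  generalize ∑ i, M.curv (fun i => P i + H i * e) i i = G at *
  generalize ∑ i, M.polar E P H i i = Z₃ at *
  generalize ∑ i, M.curv P i i = Z₀ at *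
  generalize ∑ j, H j * M.dy j E = X at *
  refine ⟨E ^ 3 * (G - Z₀) - Z₁ * E ^ 2 - Z₂ * E - Z₃, ?_, ?_⟩
  · exact sub_mem (sub_mem (sub_mem (mul_mem (pow_mem hE 3) (sub_mem hG h₀))
      (mul_mem h₁ (pow_mem hE 2))) (mul_mem h₂ hE)) h₃
  · have e1 : E ^ 4 * e ^ 4 = 1 := by rw [← mul_pow, h, one_pow]
    have e2 : E ^ 3 * e ^ 3 = 1 := by rw [← mul_pow, h, one_pow]
    have e3 : E ^ 2 * e ^ 2 = 1 := by rw [← mul_pow, h, one_pow]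
    linear_combination -E ^ 4 * hZ - 3 * X ^ 2 * e1 - Z₃ * E * e2 - Z₂ * E ^ 2 * e3
      - Z₁ * E ^ 3 * h

theorem pole_three (hR : M.IsAdapted R) {E e : A} (h : E * e = 1) {P H : Fin n → A} (hE : E ∈ R)
    (hP : ∀ i, P i ∈ R) (hH : ∀ i, H i ∈ R) (hHE : ∑ j, H j * M.dy j E = 0)
    (hG : ∑ i, M.curv (fun i => P i + H i * e) i i ∈ R) :
    ∃ Z ∈ R, 2 * ∑ i, ∑ j, H i * H j * M.dy i (M.dy j E) = E * Z := by
  obtain ⟨Z₂, h₂, Z₁, h₁, hZ⟩ := hR.ricci_pole h hE hP hH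
  have h₀ : ∑ i, M.curv P i i ∈ R := sum_mem fun i _ => hR.curv hP i i
  have h₃ : ∑ i, M.polar E P H i i = - (2 * ∑ i, ∑ j, H i * H j * M.dy i (M.dy j E)) := by
    have hd : ∀ i, ∑ j, M.dy i (H j) * M.dy j E = - ∑ j, H j * M.dy i (M.dy j E) := fun i => by
      have := congrArg (M.dy i) hHE
      simp only [map_sum, Derivation.leibniz, smul_eq_mul, map_zero, Finset.sum_add_distrib] at this
      rw [eq_neg_iff_add_eq_zero, ← this, add_comm]
      congr 1
      exact Finset.sum_congr rfl fun j _ => mul_comm _ _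
    have e1 : ∑ i, ∑ j, H j * M.dy j (H i) * M.dy i E =
        - ∑ i, ∑ j, H i * H j * M.dy i (M.dy j E) := by
      rw [Finset.sum_comm, ← Finset.sum_neg_distrib]
      refine Finset.sum_congr rfl fun i _ => ?_
      simp only [mul_assoc, ← Finset.mul_sum]
      rw [hd]; ring
    have e2 : ∑ i, ∑ j, H i * (M.dy i (H j) * M.dy j E) =
        - ∑ i, ∑ j, H i * H j * M.dy i (M.dy j E) := by
      rw [← Finset.sum_neg_distrib]
      refine Finset.sum_congr rfl fun i _ => ?_
      simp only [mul_assoc, ← Finset.mul_sum]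
      rw [hd]; ring
    have e3 : ∑ i, ∑ j, (H i * M.dy i E) * (-(2 * M.y j * M.dx j E) + 4 * P j * M.dy j E) = 0 := by
      rw [Finset.sum_comm]
      simp only [← Finset.sum_mul, hHE, zero_mul, Finset.sum_const_zero]
    have e4 : ∑ i, ∑ j, M.dy i (H i) * (H j * M.dy j E) = 0 := by
      simp only [← Finset.mul_sum, hHE, mul_zero, Finset.sum_const_zero]
    have e5 : ∑ i, M.polar E P H i i =
        ∑ i, ∑ j, (H i * M.dy i E) * (-(2 * M.y j * M.dx j E) + 4 * P j * M.dy j E)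
        - 2 * ∑ i, ∑ j, M.dy i (H i) * (H j * M.dy j E)
        - ∑ i, ∑ j, H j * M.dy j (H i) * M.dy i E
        - 2 * ∑ i, ∑ j, H i * H j * M.dy i (M.dy j E)
        + ∑ i, ∑ j, H i * (M.dy i (H j) * M.dy j E) := by
      simp only [Finset.mul_sum, ← Finset.sum_add_distrib, ← Finset.sum_sub_distrib,
        MetricCalc.polar]
      refine Finset.sum_congr rfl fun i _ => Finset.sum_congr rfl fun j _ => ?_
      rw [M.dy_dy j i E]; ring
    rw [e5, e1, e2, e3, e4]; ring
  rw [h₃, hHE] at hZ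
  generalize ∑ i, M.curv (fun i => P i + H i * e) i i = G at *
  generalize ∑ i, M.curv P i i = Z₀ at *
  generalize ∑ i, ∑ j, H i * H j * M.dy i (M.dy j E) = X at *
  refine ⟨-(E ^ 2 * (G - Z₀) - Z₁ * E - Z₂), ?_, ?_⟩
  · exact neg_mem (sub_mem (sub_mem (mul_mem (pow_mem hE 2) (sub_mem hG h₀)) (mul_mem h₁ hE)) h₂)
  · have e2 : E ^ 3 * e ^ 3 = 1 := by rw [← mul_pow, h, one_pow]
    have e3 : E ^ 2 * e ^ 2 = 1 := by rw [← mul_pow, h, one_pow]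
    linear_combination E ^ 3 * hZ - 2 * X * e2 + Z₂ * E * e3 + Z₁ * E ^ 2 * h

end IsAdapted

theorem dy_den₁ (k : Fin n) : M.dy k M.den₁ = M.ali * M.yl k - M.b k := by
  rw [den₁, map_sub, dy_al, dy_be]

theorem dy_den₂ (k : Fin n) :
    M.dy k M.den₂ = 2 * (1 + 2 * M.bb) * M.yl k - 6 * M.be * M.b k := by
  have h3 : M.dy k 3 = 0 := by simpa using (M.dy k).map_natCast 3
  simp only [den₂, map_sub, map_add, Derivation.leibniz, smul_eq_mul, dy_al, dy_be, dy_bb, dy_two,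
    Derivation.map_one_eq_zero, h3]
  linear_combination 2 * (1 + 2 * M.bb) * M.yl k * M.al_ali

namespace IsAdapted

/-- The numerator of `r₀₀ - 4 α² s₀ / (α - β)` is divisible by `(1 + 2b²)α² - 3β²` up to
factors coprime to it. -/
theorem den₂_dvd (hR : M.IsAdapted R) {e d : A} (he : M.den₁ * e = 1) (hd : M.den₂ * d = 1)
    (hG : ∑ i, M.curv (fun i => M.spray i + M.sprayDiff e d i) i i ∈ R) :
    ∃ Z ∈ R, 3 * (2 * (1 - M.bb) * M.al ^ 2 * M.be * M.den₁ *
      (M.c00 * M.den₁ - 2 * M.al ^ 2 * M.sk0)) ^ 2 = M.den₂ * Z := by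
  have h2 : (2 : A) ∈ R := ofNat_mem R 2
  set w := M.c00 * M.den₁ - 2 * M.al ^ 2 * M.sk0 with hw
  have hwR : w ∈ R := sub_mem (mul_mem hR.c00 hR.den₁) (mul_mem (mul_mem h2 (pow_mem hR.al 2))
    hR.sk0)
  let v : Fin n → A := fun i => (M.al - 2 * M.be) * M.y i + M.al ^ 2 * M.bu i
  have hv : ∀ i, v i ∈ R := fun i => add_mem (mul_mem (sub_mem hR.al (mul_mem h2 hR.be)) (hR.y i))
    (mul_mem (pow_mem hR.al 2) (hR.bu i))
  let H : Fin n → A := fun i => M.al ^ 2 * M.sku i * M.den₂ + w * v i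
  have hH : ∀ i, H i ∈ R := fun i => add_mem (mul_mem (mul_mem (pow_mem hR.al 2) (hR.sku i))
    hR.den₂) (mul_mem hwR (hv i))
  have hE : M.den₂ * M.den₁ ∈ R := mul_mem hR.den₂ hR.den₁
  have hinv : M.den₂ * M.den₁ * (e * d) = 1 := by linear_combination he + M.den₁ * e * hd
  have hsd : ∀ i, M.sprayDiff e d i = H i * (e * d) := fun i => by
    simp only [sprayDiff, H, v, hw]
    linear_combination -(M.al ^ 2 * e * M.sku i) * hd
      - M.c00 * d * ((M.al - 2 * M.be) * M.y i + M.al ^ 2 * M.bu i) * he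
  simp only [hsd] at hG
  obtain ⟨Z, hZ, hZE⟩ := hR.pole_four hinv hE hR.spray hH hG
  have hvE : ∑ j, v j * M.dy j M.den₁ ∈ R := sum_mem fun j _ => mul_mem (hv j) (hR.dy _ _ hR.den₁)
  have hsE : ∑ j, M.sku j * M.dy j (M.den₂ * M.den₁) ∈ R :=
    sum_mem fun j _ => mul_mem (hR.sku j) (hR.dy _ _ hE)
  have hvD : ∑ j, v j * M.dy j M.den₂ =
      2 * (M.al - 2 * M.be) * M.den₂ + 2 * (1 - M.bb) * M.al ^ 2 * M.be := by
    have h : ∑ j, v j * M.dy j M.den₂ = 2 * (1 + 2 * M.bb) * ((M.al - 2 * M.be) *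
        ∑ j, M.yl j * M.y j + M.al ^ 2 * ∑ j, M.yl j * M.bu j) - 6 * M.be *
        ((M.al - 2 * M.be) * ∑ j, M.b j * M.y j + M.al ^ 2 * ∑ j, M.b j * M.bu j) := by
      simp only [Finset.mul_sum, ← Finset.sum_add_distrib, ← Finset.sum_sub_distrib, v, dy_den₂]
      exact Finset.sum_congr rfl fun j _ => by ring
    rw [h, yl_y, yl_bu, b_y, b_bu, MetricCalc.den₂]
    ring
  set X := M.al ^ 2 * ∑ j, M.sku j * M.dy j (M.den₂ * M.den₁)
    + w * ∑ j, v j * M.dy j M.den₁ + 2 * w * M.den₁ * (M.al - 2 * M.be) with hX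
  have hXR : X ∈ R := add_mem (add_mem (mul_mem (pow_mem hR.al 2) hsE) (mul_mem hwR hvE))
    (mul_mem (mul_mem (mul_mem h2 hwR) hR.den₁) (sub_mem hR.al (mul_mem h2 hR.be)))
  set T := 2 * (1 - M.bb) * M.al ^ 2 * M.be * M.den₁ * w with hT
  have hTR : T ∈ R := mul_mem (mul_mem (mul_mem (mul_mem (mul_mem h2 (sub_mem (one_mem _) hR.bb))
    (pow_mem hR.al 2)) hR.be) hR.den₁) hwR
  have hsum : ∑ j, H j * M.dy j (M.den₂ * M.den₁) = M.den₂ * X + T := by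
    have h : ∑ j, H j * M.dy j (M.den₂ * M.den₁) =
        M.den₂ * (M.al ^ 2 * ∑ j, M.sku j * M.dy j (M.den₂ * M.den₁)
          + w * ∑ j, v j * M.dy j M.den₁) + w * M.den₁ * ∑ j, v j * M.dy j M.den₂ := by
      simp only [Finset.mul_sum, mul_add, ← Finset.sum_add_distrib, H]
      refine Finset.sum_congr rfl fun j _ => ?_
      rw [Derivation.leibniz, smul_eq_mul, smul_eq_mul]; ring
    rw [h, hvD, hX, hT]; ring
  rw [hsum] at hZE
  refine ⟨M.den₁ * Z - 3 * (M.den₂ * X ^ 2 + 2 * X * T), sub_mem (mul_mem hR.den₁ hZ)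
    (mul_mem (ofNat_mem R 3) (add_mem (mul_mem hR.den₂ (pow_mem hXR 2))
      (mul_mem (mul_mem h2 hXR) hTR))), ?_⟩
  linear_combination hZE

/-- The squared norm of the skew part of `b_{i|j}` is divisible by `α - β` up to factors
coprime to it. -/
theorem den₁_dvd (hR : M.IsAdapted R) {e d : A} (he : M.den₁ * e = 1) (hd : M.den₂ * d = 1)
    {τ : A} (hτ : τ ∈ R) (hc : M.c00 = τ * M.den₂) (hs : M.sk0 = 0)
    (hG : ∑ i, M.curv (fun i => M.spray i + M.sprayDiff e d i) i i ∈ R) :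
    ∃ Z ∈ R, 2 * (M.al ^ 4 * M.ali * ∑ i, M.sku i * M.sk i) = M.den₁ * Z := by
  have h2 : (2 : A) ∈ R := ofNat_mem R 2
  let P : Fin n → A := fun i => M.spray i + τ * ((M.al - 2 * M.be) * M.y i + M.al ^ 2 * M.bu i)
  have hP : ∀ i, P i ∈ R := fun i => add_mem (hR.spray i) (mul_mem hτ (add_mem
    (mul_mem (sub_mem hR.al (mul_mem h2 hR.be)) (hR.y i)) (mul_mem (pow_mem hR.al 2) (hR.bu i))))
  let H : Fin n → A := fun i => M.al ^ 2 * M.sku i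
  have hH : ∀ i, H i ∈ R := fun i => mul_mem (pow_mem hR.al 2) (hR.sku i)
  have hsd : ∀ i, M.spray i + M.sprayDiff e d i = P i + H i * e := fun i => by
    simp only [sprayDiff, P, H, hc, hs]
    linear_combination τ * ((M.al - 2 * M.be) * M.y i + M.al ^ 2 * M.bu i) * hd
  simp only [hsd] at hG
  have hHE : ∑ j, H j * M.dy j M.den₁ = 0 := by
    have h : ∑ j, H j * M.dy j M.den₁ = M.al ^ 2 * (M.ali * ∑ j, M.yl j * M.sku j
        - ∑ j, M.b j * M.sku j) := by
      simp only [Finset.mul_sum, ← Finset.sum_sub_distrib, H, dy_den₁]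
      exact Finset.sum_congr rfl fun j _ => by ring
    rw [h, yl_sku, b_sku, hs]; ring
  obtain ⟨Z, hZ, hZE⟩ := hR.pole_three he hR.den₁ hP hH hHE hG
  refine ⟨Z, hZ, ?_⟩
  rw [← hZE]
  have h : ∑ i, ∑ j, H i * H j * M.dy i (M.dy j M.den₁) =
      M.al ^ 4 * (M.ali * ∑ i, M.sku i * ∑ j, M.a i j * M.sku j
        - M.ali ^ 3 * ∑ i, M.yl i * M.sku i * ∑ j, M.yl j * M.sku j) := by
    simp only [Finset.mul_sum, ← Finset.sum_sub_distrib, H, dy_den₁]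
    refine Finset.sum_congr rfl fun i _ => Finset.sum_congr rfl fun j _ => ?_
    simp only [map_sub, Derivation.leibniz, smul_eq_mul, dy_ali, dy_yl, M.dy_b]
    rw [M.a_symm j i]; ring
  rw [h, yl_sku]
  simp only [a_sku, mul_zero, Finset.sum_const_zero, sub_zero]
  ring

end IsAdapted

end MetricCalc

namespace MetricCalc

variable {n : ℕ} {A : Type*} [CommRing A] [Algebra ℝ A] (M : MetricCalc n A)

/-- The horizontal covariant derivative of a vector field on the tangent bundle. -/
def covD (Q : Fin n → A) (i k : Fin n) : A := M.hor k (Q i) + ∑ j, M.Ga i k j * Q j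

theorem curv_spray_add (Q : Fin n → A) (i k : Fin n) :
    M.curv (fun i => M.spray i + Q i) i k = M.curv M.spray i k
      + 3 * M.covD Q i k - M.dy k (∑ j, M.y j * M.covD Q i j)
      + 2 * ∑ j, Q j * M.dy j (M.dy k (Q i)) - ∑ j, M.dy j (Q i) * M.dy k (Q j) := by
  have hdy : M.dy k (∑ j, M.y j * M.covD Q i j) = M.covD Q i k
      + ∑ j, M.y j * M.dx j (M.dy k (Q i)) - ∑ l, M.conn l k * M.dy l (Q i)
      - 2 * ∑ l, M.spray l * M.dy l (M.dy k (Q i)) + ∑ l, M.conn i l * M.dy k (Q l) := by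
    have e1 : ∑ l, M.conn l k * M.dy l (Q i) = ∑ j, ∑ l, M.y j * M.Ga l j k * M.dy l (Q i) := by
      rw [Finset.sum_comm]
      refine Finset.sum_congr rfl fun l _ => ?_
      rw [conn, Finset.sum_mul]
      exact Finset.sum_congr rfl fun j _ => by rw [M.Ga_symm]; ring
    have e2 : 2 * ∑ l, M.spray l * M.dy l (M.dy k (Q i)) =
        ∑ j, ∑ l, M.y j * M.conn l j * M.dy l (M.dy k (Q i)) := by
      rw [Finset.sum_comm, Finset.mul_sum]
      refine Finset.sum_congr rfl fun l _ => ?_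
      rw [← mul_assoc, two_spray, Finset.sum_mul]
      exact Finset.sum_congr rfl fun j _ => by ring
    have e3 : ∑ l, M.conn i l * M.dy k (Q l) = ∑ j, ∑ l, M.y j * M.Ga i j l * M.dy k (Q l) := by
      rw [Finset.sum_comm]
      refine Finset.sum_congr rfl fun l _ => ?_
      rw [conn, Finset.sum_mul]
      exact Finset.sum_congr rfl fun j _ => by rw [M.Ga_symm]; ring
    have e0 : M.dy k (∑ j, M.y j * M.covD Q i j) =
        M.covD Q i k + ∑ j, M.y j * M.dy k (M.covD Q i j) := by
      simp [Derivation.leibniz, M.dy_y, Finset.sum_add_distrib, add_comm]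
    rw [e0, e1, e2, e3, add_sub_assoc, add_sub_assoc, add_assoc]
    congr 1
    simp only [← Finset.sum_sub_distrib, ← Finset.sum_add_distrib]
    refine Finset.sum_congr rfl fun j _ => ?_
    simp only [covD, hor_apply, map_add, map_sub, map_sum, Derivation.leibniz, smul_eq_mul,
      M.dy_conn, M.dy_Ga, mul_zero, add_zero, M.dx_dy j k, Finset.sum_add_distrib, mul_add, mul_sub,
      Finset.mul_sum]
    simp only [M.dy_dy k, mul_assoc, mul_comm, mul_left_comm]
    ring
  rw [hdy]
  simp only [curv, covD, hor_apply, map_add, dy_spray, M.dy_conn, mul_add, add_mul,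
    Finset.sum_add_distrib]
  have e4 : ∑ j, Q j * M.Ga i k j = ∑ j, M.Ga i k j * Q j :=
    Finset.sum_congr rfl fun j _ => mul_comm _ _
  have e5 : ∑ j, M.dy j (Q i) * M.conn j k = ∑ l, M.conn l k * M.dy l (Q i) :=
    Finset.sum_congr rfl fun j _ => mul_comm _ _
  rw [e4, e5]
  ring

theorem covD_bu (i k : Fin n) : M.covD M.bu i k = ∑ m, M.ainv i m * M.c m k := by
  have h : ∀ m, ∑ j, M.a m j * M.covD M.bu j k = M.c m k := fun m => by
    have h := congrArg (M.dx k) (M.a_bu m)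
    rw [M.dx_b] at h
    simp only [map_sum, Derivation.leibniz, smul_eq_mul, M.dx_a, Finset.sum_add_distrib,
      mul_add, Finset.mul_sum] at h
    simp only [covD, hor_apply, M.dy_bu, mul_zero, Finset.sum_const_zero, sub_zero, mul_add,
      Finset.sum_add_distrib, Finset.mul_sum]
    have e1 : ∑ i, ∑ l, M.bu i * (M.a l i * M.Ga l m k) = ∑ l, M.b l * M.Ga l m k := by
      rw [Finset.sum_comm]
      refine Finset.sum_congr rfl fun l _ => ?_
      rw [← M.a_bu l, Finset.sum_mul]
      exact Finset.sum_congr rfl fun j _ => by ring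
    have e2 : ∑ i, ∑ l, M.bu i * (M.a m l * M.Ga l i k) =
        ∑ j, ∑ l, M.a m j * (M.Ga j k l * M.bu l) := by
      rw [Finset.sum_comm]
      refine Finset.sum_congr rfl fun l _ => Finset.sum_congr rfl fun j _ => ?_
      rw [M.Ga_symm]; ring
    rw [e1, e2] at h
    linear_combination h
  rw [← M.raise_a (fun j => M.covD M.bu j k) i]
  simp only [h]

variable {M} {τ : A}

theorem sk_eq_zero (hc : ∀ i j, M.c i j = τ * ((1 + 2 * M.bb) * M.a i j - 3 * M.b i * M.b j))
    (l : Fin n) : M.sk l = 0 := by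
  refine Finset.sum_eq_zero fun i _ => ?_
  rw [hc, hc, M.a_symm l i]; ring

theorem c0_eq (hc : ∀ i j, M.c i j = τ * ((1 + 2 * M.bb) * M.a i j - 3 * M.b i * M.b j))
    (l : Fin n) : M.c0 l = τ * ((1 + 2 * M.bb) * M.yl l - 3 * M.be * M.b l) := by
  have : M.c0 l = τ * ((1 + 2 * M.bb) * ∑ i, M.a l i * M.y i - 3 * (∑ i, M.b i * M.y i)
      * M.b l) := by
    simp only [c0, hc, Finset.mul_sum, Finset.sum_mul, ← Finset.sum_sub_distrib]
    exact Finset.sum_congr rfl fun i _ => by rw [M.a_symm l i]; ring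
  rw [this, a_y, b_y]

theorem c00_eq (hc : ∀ i j, M.c i j = τ * ((1 + 2 * M.bb) * M.a i j - 3 * M.b i * M.b j)) :
    M.c00 = τ * M.den₂ := by
  have : M.c00 = τ * ((1 + 2 * M.bb) * ∑ i, M.yl i * M.y i - 3 * M.be * ∑ i, M.b i * M.y i) := by
    simp only [c00, c0_eq hc, Finset.mul_sum, ← Finset.sum_sub_distrib]
    exact Finset.sum_congr rfl fun i _ => by ring
  rw [this, yl_y, b_y, den₂]; ring

theorem sprayDiff_eq (hc : ∀ i j, M.c i j = τ * ((1 + 2 * M.bb) * M.a i j - 3 * M.b i * M.b j))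
    {e d : A} (hd : M.den₂ * d = 1) (i : Fin n) :
    M.sprayDiff e d i = τ * (M.al - 2 * M.be) * M.y i + τ * M.al ^ 2 * M.bu i := by
  simp only [sprayDiff, sk0, sku, sk_eq_zero hc, mul_zero, Finset.sum_const_zero, c00_eq hc]
  linear_combination τ * ((M.al - 2 * M.be) * M.y i + M.al ^ 2 * M.bu i) * hd

theorem covD_add_smul (P R : A) (i k : Fin n) :
    M.covD (fun i => P * M.y i + R * M.bu i) i k =
      M.hor k P * M.y i + M.hor k R * M.bu i + R * M.covD M.bu i k := by
  have hy : M.hor k (M.y i) = - M.conn i k := by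
    simp [hor_apply, M.dx_y, M.dy_y]
  simp only [covD, map_add, Derivation.leibniz, smul_eq_mul, hy, mul_add, Finset.sum_add_distrib,
    conn]
  have e1 : ∑ j, M.Ga i k j * (P * M.y j) = P * ∑ j, M.Ga i k j * M.y j := by
    rw [Finset.mul_sum]; exact Finset.sum_congr rfl fun j _ => by ring
  have e2 : ∑ j, M.Ga i k j * (R * M.bu j) = R * ∑ j, M.Ga i k j * M.bu j := by
    rw [Finset.mul_sum]; exact Finset.sum_congr rfl fun j _ => by ring
  rw [e1, e2]; ring

/-- The curvature of the spray of the square metric when the covariant derivative of the one-form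
is `τ ((1 + 2b²) a - 3 b ⊗ b)`. -/
theorem curv_spray_sprayDiff
    (hc : ∀ i j, M.c i j = τ * ((1 + 2 * M.bb) * M.a i j - 3 * M.b i * M.b j))
    (hτ : ∀ k, M.dy k τ = 0) {e d : A} (hd : M.den₂ * d = 1) (i k : Fin n) :
    M.curv (fun i => M.spray i + M.sprayDiff e d i) i k = M.curv M.spray i k
      + (τ ^ 2 * ((5 + 4 * M.bb) * M.al ^ 2 - 2 * M.be ^ 2 - 2 * M.al * M.be)
          - (∑ j, M.dx j τ * M.y j) * (M.al - 2 * M.be)) * (if i = k then 1 else 0)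
      + M.y i * (2 * M.dx k τ * (M.al - 2 * M.be)
          - (∑ j, M.dx j τ * M.y j) * (M.ali * M.yl k - 2 * M.b k)
          + τ ^ 2 * (- (5 + 4 * M.bb) * M.yl k + 2 * M.be * M.b k + 4 * M.al * M.b k
            - 2 * M.be * M.ali * M.yl k))
      + M.bu i * (2 * M.dx k τ * M.al ^ 2 - 2 * (∑ j, M.dx j τ * M.y j) * M.yl k
          - 2 * τ ^ 2 * M.al ^ 2 * M.b k + 2 * τ ^ 2 * M.be * M.yl k) := by
  have h3 : ∀ k, M.dy k 3 = 0 := fun k => by simpa using (M.dy k).map_natCast 3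
  have hhτ : ∀ k, M.hor k τ = M.dx k τ := fun k => by simp [hor_apply, hτ]
  have hh2 : ∀ k, M.hor k 2 = 0 := fun k => by simpa using (M.hor k).map_natCast 2
  set t₀ := ∑ j, M.dx j τ * M.y j with ht₀
  have hdt : ∀ k, M.dy k t₀ = M.dx k τ := M.dy_linear _ fun k i => by
    rw [← M.dx_dy, hτ, map_zero]
  simp only [sprayDiff_eq hc hd]
  set P := τ * (M.al - 2 * M.be) with hP
  set S := τ * M.al ^ 2 with hS
  have hPk : ∀ k, M.dy k P = τ * (M.ali * M.yl k - 2 * M.b k) := fun k => by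
    simp only [hP, Derivation.leibniz, map_sub, smul_eq_mul, dy_al, dy_be, dy_two, hτ]; ring
  have hSk : ∀ k, M.dy k S = 2 * τ * M.yl k := fun k => by
    simp only [hS, Derivation.leibniz, Derivation.leibniz_pow, smul_eq_mul, nsmul_eq_mul, dy_al, hτ]
    push_cast
    linear_combination 2 * τ * M.yl k * M.al_ali
  have hPjk : ∀ j k, M.dy j (M.dy k P) =
      τ * (M.ali * M.a j k - M.ali ^ 3 * M.yl j * M.yl k) := fun j k => by
    simp only [hPk, Derivation.leibniz, map_sub, smul_eq_mul, dy_ali, dy_yl, dy_two, hτ, M.dy_b,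
      M.a_symm k j]
    ring
  have hSjk : ∀ j k, M.dy j (M.dy k S) = 2 * τ * M.a j k := fun j k => by
    simp only [hSk, Derivation.leibniz, smul_eq_mul, dy_yl, dy_two, hτ, M.a_symm k j]; ring
  have hhP : ∀ k, M.hor k P = M.dx k τ * (M.al - 2 * M.be)
      - 2 * τ ^ 2 * ((1 + 2 * M.bb) * M.yl k - 3 * M.be * M.b k) := fun k => by
    simp only [hP, Derivation.leibniz, map_sub, smul_eq_mul, hor_al, hor_be, hhτ, hh2, c0_eq hc]
    ring
  have hhS : ∀ k, M.hor k S = M.dx k τ * M.al ^ 2 := fun k => by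
    simp only [hS, Derivation.leibniz, Derivation.leibniz_pow, smul_eq_mul, nsmul_eq_mul, hor_al,
      hhτ]
    ring
  have hcb : ∀ i k, M.covD M.bu i k =
      τ * ((1 + 2 * M.bb) * (if i = k then 1 else 0) - 3 * M.bu i * M.b k) := fun i k => by
    have : M.covD M.bu i k = τ * ((1 + 2 * M.bb) * ∑ m, M.ainv i m * M.a m k
        - 3 * (∑ m, M.ainv i m * M.b m) * M.b k) := by
      simp only [covD_bu, hc, Finset.mul_sum, Finset.sum_mul, ← Finset.sum_sub_distrib]
      exact Finset.sum_congr rfl fun i _ => by ring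
    rw [this, M.ainv_a]; rfl
  set Q : Fin n → A := fun i => P * M.y i + S * M.bu i with hQ
  have hQk : ∀ i k, M.covD Q i k = M.hor k P * M.y i + M.hor k S * M.bu i
      + S * (τ * ((1 + 2 * M.bb) * (if i = k then 1 else 0) - 3 * M.bu i * M.b k)) := fun i k => by
    rw [hQ, covD_add_smul, hcb]
  have hQ0 : ∑ j, M.y j * M.covD Q i j =
      (t₀ * (M.al - 2 * M.be) - 2 * τ ^ 2 * ((1 + 2 * M.bb) * (M.al * M.al) - 3 * M.be * M.be))
        * M.y i + t₀ * M.al ^ 2 * M.bu i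
      + S * (τ * ((1 + 2 * M.bb) * M.y i - 3 * M.bu i * M.be)) := by
    have h0 : ∑ j, M.y j * (if i = j then (1 : A) else 0) = M.y i := by simp
    have : ∑ j, M.y j * M.covD Q i j =
      (t₀ * (M.al - 2 * M.be) - 2 * τ ^ 2 * ((1 + 2 * M.bb) * (∑ j, M.yl j * M.y j)
        - 3 * M.be * ∑ j, M.b j * M.y j)) * M.y i + t₀ * M.al ^ 2 * M.bu i
      + S * (τ * ((1 + 2 * M.bb) * (∑ j, M.y j * (if i = j then (1 : A) else 0))
        - 3 * M.bu i * ∑ j, M.b j * M.y j)) := by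
      simp only [hQk, hhP, hhS, ht₀, Finset.mul_sum, Finset.sum_mul, ← Finset.sum_sub_distrib,
        ← Finset.sum_add_distrib]
      exact Finset.sum_congr rfl fun j _ => by ring
    rw [this, yl_y, b_y, h0]
  have hdQ : ∀ k i, M.dy k (Q i) = M.dy k P * M.y i + P * (if i = k then 1 else 0)
      + M.dy k S * M.bu i := fun k i => by
    simp only [hQ, map_add, Derivation.leibniz, smul_eq_mul, M.dy_y, M.dy_bu]
    ring
  have hite : ∀ j i k : Fin n, M.dy j (if i = k then (1 : A) else 0) = 0 := fun j i k => by
    split_ifs <;> simp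
  have hddQ : ∀ j k i, M.dy j (M.dy k (Q i)) = M.dy j (M.dy k P) * M.y i
      + M.dy k P * (if i = j then 1 else 0) + M.dy j P * (if i = k then 1 else 0)
      + M.dy j (M.dy k S) * M.bu i := fun j k i => by
    simp only [hdQ, map_add, Derivation.leibniz, smul_eq_mul, M.dy_y, M.dy_bu, hite]
    ring
  have hQyl : ∑ j, Q j * M.yl j = P * (M.al * M.al) + S * M.be := by
    rw [← yl_y, ← yl_bu]
    simp only [hQ, Finset.mul_sum, ← Finset.sum_add_distrib]
    exact Finset.sum_congr rfl fun j _ => by ring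
  have hQb : ∑ j, Q j * M.b j = P * M.be + S * M.bb := by
    rw [← b_y, ← b_bu]
    simp only [hQ, Finset.mul_sum, ← Finset.sum_add_distrib]
    exact Finset.sum_congr rfl fun j _ => by ring
  have hQa : ∑ j, Q j * M.a j k = P * M.yl k + S * M.b k := by
    rw [← a_y, ← a_bu]
    simp only [hQ, Finset.mul_sum, ← Finset.sum_add_distrib]
    exact Finset.sum_congr rfl fun j _ => by rw [M.a_symm k j]; ring
  have hQi : ∑ j, Q j * (if i = j then (1 : A) else 0) = Q i := by simp
  have h1 : ∑ j, Q j * M.dy j (M.dy k (Q i)) =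
      τ * (M.ali * (P * M.yl k + S * M.b k)
        - M.ali ^ 3 * (P * (M.al * M.al) + S * M.be) * M.yl k) * M.y i
      + M.dy k P * Q i + τ * (M.ali * (P * (M.al * M.al) + S * M.be)
        - 2 * (P * M.be + S * M.bb)) * (if i = k then 1 else 0)
      + 2 * τ * (P * M.yl k + S * M.b k) * M.bu i := by
    have : ∑ j, Q j * M.dy j (M.dy k (Q i)) =
      τ * (M.ali * (∑ j, Q j * M.a j k) - M.ali ^ 3 * (∑ j, Q j * M.yl j) * M.yl k) * M.y i
      + M.dy k P * (∑ j, Q j * (if i = j then (1 : A) else 0)) + τ * (M.ali * (∑ j, Q j * M.yl j)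
        - 2 * (∑ j, Q j * M.b j)) * (if i = k then 1 else 0)
      + 2 * τ * (∑ j, Q j * M.a j k) * M.bu i := by
      simp only [hddQ, hPjk, hSjk, Finset.mul_sum, Finset.sum_mul, ← Finset.sum_sub_distrib,
        ← Finset.sum_add_distrib]
      refine Finset.sum_congr rfl fun j _ => ?_
      rw [hPk j]; ring
    rw [this, hQyl, hQb, hQa, hQi]
  have hPy : ∑ j, M.dy j P * M.y j = τ * (M.ali * (M.al * M.al) - 2 * M.be) := by
    rw [← yl_y, ← b_y]
    simp only [hPk, Finset.mul_sum, ← Finset.sum_sub_distrib]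
    exact Finset.sum_congr rfl fun j _ => by ring
  have hPb : ∑ j, M.dy j P * M.bu j = τ * (M.ali * M.be - 2 * M.bb) := by
    rw [← yl_bu, ← b_bu]
    simp only [hPk, Finset.mul_sum, ← Finset.sum_sub_distrib]
    exact Finset.sum_congr rfl fun j _ => by ring
  have hSy : ∑ j, M.dy j S * M.y j = 2 * τ * (M.al * M.al) := by
    rw [← yl_y]
    simp only [hSk, Finset.mul_sum]
    exact Finset.sum_congr rfl fun j _ => by ring
  have hSb : ∑ j, M.dy j S * M.bu j = 2 * τ * M.be := by
    rw [← yl_bu]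
    simp only [hSk, Finset.mul_sum]
    exact Finset.sum_congr rfl fun j _ => by ring
  have h2 : ∑ j, M.dy j (Q i) * M.dy k (Q j) =
      M.y i * (M.dy k P * (τ * (M.ali * (M.al * M.al) - 2 * M.be)) + P * M.dy k P
        + M.dy k S * (τ * (M.ali * M.be - 2 * M.bb)))
      + P * (M.dy k P * M.y i + P * (if i = k then 1 else 0) + M.dy k S * M.bu i)
      + M.bu i * (M.dy k P * (2 * τ * (M.al * M.al)) + P * M.dy k S
        + M.dy k S * (2 * τ * M.be)) := by
    have hi : ∑ j, (if i = j then (1 : A) else 0) * M.dy k (Q j) = M.dy k (Q i) := by simp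
    have hk : ∀ f : Fin n → A, ∑ j, f j * (if j = k then (1 : A) else 0) = f k := fun f => by simp
    have : ∑ j, M.dy j (Q i) * M.dy k (Q j) =
      M.y i * (M.dy k P * (∑ j, M.dy j P * M.y j)
        + P * (∑ j, M.dy j P * (if j = k then (1 : A) else 0))
        + M.dy k S * (∑ j, M.dy j P * M.bu j))
      + P * (∑ j, (if i = j then (1 : A) else 0) * M.dy k (Q j))
      + M.bu i * (M.dy k P * (∑ j, M.dy j S * M.y j)
        + P * (∑ j, M.dy j S * (if j = k then (1 : A) else 0))
        + M.dy k S * (∑ j, M.dy j S * M.bu j)) := by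
      simp only [Finset.mul_sum, ← Finset.sum_add_distrib]
      refine Finset.sum_congr rfl fun j _ => ?_
      rw [hdQ j i, hdQ k j]; ring
    rw [this, hPy, hPb, hSy, hSb, hk, hk, hi, hdQ]
  have h0 : M.dy k (∑ j, M.y j * M.covD Q i j) =
      (M.dx k τ * (M.al - 2 * M.be) + t₀ * (M.ali * M.yl k - 2 * M.b k)
        - 2 * τ ^ 2 * ((1 + 2 * M.bb) * (2 * M.yl k) - 6 * M.be * M.b k)) * M.y i
      + (t₀ * (M.al - 2 * M.be)
        - 2 * τ ^ 2 * ((1 + 2 * M.bb) * (M.al * M.al) - 3 * M.be * M.be)) * (if i = k then 1 else 0)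
      + (M.dx k τ * M.al ^ 2 + t₀ * (2 * M.yl k)) * M.bu i
      + 2 * τ * M.yl k * (τ * ((1 + 2 * M.bb) * M.y i - 3 * M.bu i * M.be))
      + S * (τ * ((1 + 2 * M.bb) * (if i = k then 1 else 0) - 3 * M.bu i * M.b k)) := by
    rw [hQ0]
    simp only [map_add, map_sub, Derivation.leibniz, Derivation.leibniz_pow, smul_eq_mul,
      nsmul_eq_mul, hdt, hSk, dy_al, dy_be, dy_bb, dy_two, h3, hτ, M.dy_y, M.dy_bu,
      Derivation.map_one_eq_zero]
    push_cast
    linear_combination (2 * t₀ * M.yl k * M.bu i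
      - 4 * τ ^ 2 * (1 + 2 * M.bb) * M.yl k * M.y i) * M.al_ali
  rw [curv_spray_add, h0, h1, h2, hQk, hPk, hSk, hhP, hhS]
  simp only [hQ, hP, hS]
  generalize (if i = k then (1 : A) else 0) = δ
  have ha2 : M.al ^ 2 * M.ali = M.al := by linear_combination M.al * M.al_ali
  have ha3 : M.al ^ 2 * M.ali ^ 2 = 1 := by linear_combination (M.al * M.ali + 1) * M.al_ali
  have ha4 : M.al ^ 3 * M.ali ^ 3 = 1 := by
    linear_combination (M.al ^ 2 * M.ali ^ 2 + M.al * M.ali + 1) * M.al_ali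
  have ha5 : M.al ^ 2 * M.ali ^ 3 = M.ali := by
    linear_combination M.ali * (M.al * M.ali + 1) * M.al_ali
  have ha6 : M.al ^ 3 * M.ali = M.al ^ 2 := by linear_combination M.al ^ 2 * M.al_ali
  linear_combination τ ^ 2 * M.yl k * M.y i * (2 * M.al_ali - ha3 - 2 * ha4 + 2 * M.be * ha5)
    + τ ^ 2 * δ * (2 * ha6 - 2 * M.be * ha2) + 4 * τ ^ 2 * M.b k * M.y i * ha2

end MetricCalc

section Smoothness

variable {n : ℕ} {E : Type*} [NormedAddCommGroup E] [NormedSpace ℝ E] {s : Set E}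

theorem ContDiffOn.matrix_det {m : E → Matrix (Fin n) (Fin n) ℝ}
    (hm : ∀ i j, ContDiffOn ℝ (⊤ : ℕ∞) (fun x => m x i j) s) :
    ContDiffOn ℝ (⊤ : ℕ∞) (fun x => (m x).det) s := by
  simp only [Matrix.det_apply']
  exact ContDiffOn.sum fun σ _ => contDiffOn_const.mul (contDiffOn_prod fun i _ => hm _ _)

theorem ContDiffOn.matrix_inv {m : E → Matrix (Fin n) (Fin n) ℝ}
    (hm : ∀ i j, ContDiffOn ℝ (⊤ : ℕ∞) (fun x => m x i j) s)
    (h0 : ∀ x ∈ s, (m x).det ≠ 0) (i j : Fin n) :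
    ContDiffOn ℝ (⊤ : ℕ∞) (fun x => (m x)⁻¹ i j) s := by
  simp only [Matrix.inv_def, Matrix.smul_apply, smul_eq_mul, Ring.inverse_eq_inv',
    Matrix.adjugate_apply]
  refine ((ContDiffOn.matrix_det hm).inv h0).mul (ContDiffOn.matrix_det fun k l => ?_)
  by_cases hk : k = j
  · subst hk; simpa using contDiffOn_const
  · simpa [Matrix.updateRow_ne hk] using hm k l

end Smoothness

theorem ContDiffOn.pd {n : ℕ} {U : Set (Vec n)} (hU : IsOpen U) {f : Vec n → ℝ}
    (hf : ContDiffOn ℝ (⊤ : ℕ∞) f U) (k : Fin n) : ContDiffOn ℝ (⊤ : ℕ∞) (pd f k) U :=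
  (hf.fderiv_of_isOpen hU (by simp)).clm_apply contDiffOn_const

theorem pd_congr {n : ℕ} {U : Set (Vec n)} (hU : IsOpen U) {f g : Vec n → ℝ}
    (h : ∀ x ∈ U, f x = g x) {x : Vec n} (hx : x ∈ U) (k : Fin n) : pd f k x = pd g k x := by
  have : f =ᶠ[nhds x] g := by filter_upwards [hU.mem_nhds hx] using h
  rw [pd, pd, this.fderiv_eq]

/-- A Riemannian metric `a` and a one-form `b` of length strictly between zero and one. -/
structure IsSquareDatum {n : ℕ} (U : Set (Vec n)) (a : Vec n → Matrix (Fin n) (Fin n) ℝ)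
    (b : Vec n → Vec n) : Prop where
  isOpen : IsOpen U
  smooth_a : ∀ i j, ContDiffOn ℝ (⊤ : ℕ∞) (fun x => a x i j) U
  symm : ∀ x ∈ U, (a x).IsSymm
  posDef : ∀ x ∈ U, (a x).PosDef
  smooth_b : ∀ i, ContDiffOn ℝ (⊤ : ℕ∞) (fun x => b x i) U
  bsq_pos : ∀ x ∈ U, 0 < bsq a b x
  bsq_lt_one : ∀ x ∈ U, bsq a b x < 1

namespace IsSquareDatum

variable {n : ℕ} {U : Set (Vec n)} {a : Vec n → Matrix (Fin n) (Fin n) ℝ} {b : Vec n → Vec n}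

theorem a_comm (h : IsSquareDatum U a b) {x : Vec n} (hx : x ∈ U) (i j : Fin n) :
    a x i j = a x j i := (h.symm x hx).apply j i

theorem det_ne_zero (h : IsSquareDatum U a b) {x : Vec n} (hx : x ∈ U) : (a x).det ≠ 0 :=
  (h.posDef x hx).det_pos.ne'

theorem inv_comm (h : IsSquareDatum U a b) {x : Vec n} (hx : x ∈ U) (i j : Fin n) :
    (a x)⁻¹ i j = (a x)⁻¹ j i := by
  have : Matrix.transpose (a x)⁻¹ = (a x)⁻¹ := by rw [Matrix.transpose_nonsing_inv, (h.symm x hx)]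
  conv_lhs => rw [← this]
  rfl

theorem inv_mul (h : IsSquareDatum U a b) {x : Vec n} (hx : x ∈ U) (i k : Fin n) :
    ∑ j, (a x)⁻¹ i j * a x j k = if i = k then 1 else 0 := by
  rw [← Matrix.mul_apply, Matrix.nonsing_inv_mul _ (h.det_ne_zero hx).isUnit, Matrix.one_apply]

theorem mul_inv (h : IsSquareDatum U a b) {x : Vec n} (hx : x ∈ U) (i k : Fin n) :
    ∑ j, a x i j * (a x)⁻¹ j k = if i = k then 1 else 0 := by
  rw [← Matrix.mul_apply, Matrix.mul_nonsing_inv _ (h.det_ne_zero hx).isUnit, Matrix.one_apply]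

theorem quad_pos (h : IsSquareDatum U a b) {x : Vec n} (hx : x ∈ U) {v : Vec n} (hv : v ≠ 0) :
    0 < ∑ i, ∑ j, a x i j * v i * v j := by
  have := (h.posDef x hx).dotProduct_mulVec_pos hv
  simp only [dotProduct, Matrix.mulVec, Finset.mul_sum, star_trivial] at this
  exact this.trans_eq
    (Finset.sum_congr rfl fun i _ => Finset.sum_congr rfl fun j _ => by ring)

theorem quad_nonneg (h : IsSquareDatum U a b) {x : Vec n} (hx : x ∈ U) (v : Vec n) :
    0 ≤ ∑ i, ∑ j, a x i j * v i * v j := by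
  by_cases hv : v = 0
  · simp [hv]
  · exact (h.quad_pos hx hv).le

theorem smooth_inv (h : IsSquareDatum U a b) (i j : Fin n) :
    ContDiffOn ℝ (⊤ : ℕ∞) (fun x => (a x)⁻¹ i j) U :=
  ContDiffOn.matrix_inv h.smooth_a (fun _ hx => h.det_ne_zero hx) i j

theorem smooth_christoffel (h : IsSquareDatum U a b) (k i j : Fin n) :
    ContDiffOn ℝ (⊤ : ℕ∞) (christoffel a k i j) U :=
  contDiffOn_const.mul (ContDiffOn.sum fun l _ => (h.smooth_inv k l).mul
    ((((h.smooth_a l i).pd h.isOpen j).add ((h.smooth_a l j).pd h.isOpen i)).sub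
      ((h.smooth_a i j).pd h.isOpen l)))

theorem smooth_covDeriv (h : IsSquareDatum U a b) (i j : Fin n) :
    ContDiffOn ℝ (⊤ : ℕ∞) (covDeriv a b i j) U :=
  ((h.smooth_b i).pd h.isOpen j).sub
    (ContDiffOn.sum fun k _ => (h.smooth_b k).mul (h.smooth_christoffel k i j))

theorem smooth_bsq (h : IsSquareDatum U a b) : ContDiffOn ℝ (⊤ : ℕ∞) (bsq a b) U :=
  ContDiffOn.sum fun i _ => ContDiffOn.sum fun j _ =>
    ((h.smooth_inv i j).mul (h.smooth_b i)).mul (h.smooth_b j)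

theorem pd_a_comm (h : IsSquareDatum U a b) {x : Vec n} (hx : x ∈ U) (i j k : Fin n) :
    pd (fun x => a x i j) k x = pd (fun x => a x j i) k x :=
  pd_congr h.isOpen (fun _ hx => h.a_comm hx i j) hx k

theorem christoffel_comm (h : IsSquareDatum U a b) {x : Vec n} (hx : x ∈ U) (l i j : Fin n) :
    christoffel a l i j x = christoffel a l j i x := by
  simp only [christoffel]
  congr 1
  refine Finset.sum_congr rfl fun m _ => ?_
  rw [h.pd_a_comm hx i j]; ring

theorem lower_christoffel (h : IsSquareDatum U a b) {x : Vec n} (hx : x ∈ U) (m i j : Fin n) :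
    ∑ l, a x m l * christoffel a l i j x = 1 / 2 * (pd (fun x => a x m i) j x
      + pd (fun x => a x m j) i x - pd (fun x => a x i j) m x) := by
  simp only [christoffel, Finset.mul_sum]
  rw [Finset.sum_comm]
  have : ∀ l r, a x m r * (1 / 2 * ((a x)⁻¹ r l * (pd (fun x => a x l i) j x
      + pd (fun x => a x l j) i x - pd (fun x => a x i j) l x))) = (a x m r * (a x)⁻¹ r l) *
      (1 / 2 * (pd (fun x => a x l i) j x + pd (fun x => a x l j) i x
        - pd (fun x => a x i j) l x)) := fun l r => by ring
  simp only [this, ← Finset.sum_mul, h.mul_inv hx]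
  simp

theorem pd_a (h : IsSquareDatum U a b) {x : Vec n} (hx : x ∈ U) (k i j : Fin n) :
    pd (fun x => a x i j) k x =
      ∑ l, (a x l j * christoffel a l i k x + a x i l * christoffel a l j k x) := by
  rw [Finset.sum_add_distrib, h.lower_christoffel hx,
    Finset.sum_congr rfl fun l _ => by rw [h.a_comm hx l j], h.lower_christoffel hx,
    h.pd_a_comm hx j i k, h.pd_a_comm hx j k i, h.pd_a_comm hx k j i, h.pd_a_comm hx i k j]
  ring

/-- The value of the quadratic form on `s b^♯ + t y`. -/
theorem quad_comb (h : IsSquareDatum U a b) {x : Vec n} (hx : x ∈ U) (y : Vec n) (s t : ℝ) :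
    ∑ i, ∑ j, a x i j * (s * (∑ k, (a x)⁻¹ i k * b x k) + t * y i)
        * (s * (∑ k, (a x)⁻¹ j k * b x k) + t * y j) =
      s ^ 2 * bsq a b x + 2 * s * t * betaOf b x y
        + t ^ 2 * ∑ i, ∑ j, a x i j * y i * y j := by
  set u : Vec n := fun i => ∑ k, (a x)⁻¹ i k * b x k with hu
  have e1 : ∀ i, ∑ j, a x i j * u j = b x i := fun i => by
    simp only [hu, Finset.mul_sum, ← mul_assoc]
    rw [Finset.sum_comm]
    simp [← Finset.sum_mul, h.mul_inv hx]
  have e2 : ∑ i, b x i * u i = bsq a b x := by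
    simp only [hu, bsq, Finset.mul_sum]
    exact Finset.sum_congr rfl fun i _ => Finset.sum_congr rfl fun j _ => by ring
  have e3 : ∀ v : Vec n, ∑ i, ∑ j, a x i j * v i * u j = ∑ i, b x i * v i := fun v => by
    simp only [← e1, Finset.sum_mul]
    exact Finset.sum_congr rfl fun i _ => Finset.sum_congr rfl fun j _ => by ring
  have e4 : ∑ i, ∑ j, a x i j * u i * y j = ∑ i, ∑ j, a x i j * y i * u j := by
    rw [Finset.sum_comm]
    exact Finset.sum_congr rfl fun i _ => Finset.sum_congr rfl fun j _ => by
      rw [h.a_comm hx]; ring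
  have : ∑ i, ∑ j, a x i j * (s * u i + t * y i) * (s * u j + t * y j) =
      s ^ 2 * (∑ i, ∑ j, a x i j * u i * u j) + s * t * (∑ i, ∑ j, a x i j * u i * y j)
      + s * t * (∑ i, ∑ j, a x i j * y i * u j) + t ^ 2 * ∑ i, ∑ j, a x i j * y i * y j := by
    simp only [Finset.mul_sum, ← Finset.sum_add_distrib]
    exact Finset.sum_congr rfl fun i _ => Finset.sum_congr rfl fun j _ => by ring
  rw [this, e4, e3, e3, e2, betaOf]
  ring

theorem alphaOf_pos (h : IsSquareDatum U a b) {x : Vec n} (hx : x ∈ U) {y : Vec n} (hy : y ≠ 0) :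
    0 < alphaOf a x y := Real.sqrt_pos.2 (h.quad_pos hx hy)

theorem alphaOf_sq (h : IsSquareDatum U a b) {x : Vec n} (hx : x ∈ U) (y : Vec n) :
    alphaOf a x y ^ 2 = ∑ i, ∑ j, a x i j * y i * y j := Real.sq_sqrt (h.quad_nonneg hx y)

theorem betaOf_sq_le (h : IsSquareDatum U a b) {x : Vec n} (hx : x ∈ U) (y : Vec n) :
    betaOf b x y ^ 2 ≤ bsq a b x * alphaOf a x y ^ 2 := by
  have h1 := h.quad_nonneg hx
    fun i => betaOf b x y * (∑ k, (a x)⁻¹ i k * b x k) + -bsq a b x * y i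
  rw [h.quad_comb hx y (betaOf b x y) (-bsq a b x), ← h.alphaOf_sq hx] at h1
  have hp := h.bsq_pos x hx
  by_contra hlt
  rw [not_le] at hlt
  nlinarith

theorem abs_betaOf_lt (h : IsSquareDatum U a b) {x : Vec n} (hx : x ∈ U) {y : Vec n}
    (hy : y ≠ 0) : |betaOf b x y| < alphaOf a x y := by
  have h1 := h.betaOf_sq_le hx y
  have h2 := h.alphaOf_pos hx hy
  refine abs_lt_of_sq_lt_sq (lt_of_le_of_lt h1 ?_) h2.le
  nlinarith [h.bsq_lt_one x hx, pow_pos h2 2]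

end IsSquareDatum

section

variable {n : ℕ} {U : Set (Vec n)}

/-- The complement of the zero section over `U`. -/
def slit (U : Set (Vec n)) : Set (Vec n × Vec n) := U ×ˢ {0}ᶜ

theorem isOpen_slit (hU : IsOpen U) : IsOpen (slit U) := hU.prod isOpen_compl_singleton

/-- The function `f` of two variables represents the smooth function `φ`. -/
def Represents (φ : smoothAlgebra (slit U)) (f : Vec n → Vec n → ℝ) : Prop :=
  ∀ p : slit U, smoothAlgebra.eval p φ = f p.1.1 p.1.2

namespace smoothAlgebra

/-- The pullback of a smooth function on the base. -/
def base (f : Vec n → ℝ) (hf : ContDiffOn ℝ (⊤ : ℕ∞) f U) : smoothAlgebra (slit U) :=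
  mk (fun p => f p.1) (hf.comp contDiff_fst.contDiffOn fun _ hp => hp.1)

theorem eval_base (f : Vec n → ℝ) (hf : ContDiffOn ℝ (⊤ : ℕ∞) f U) (p : slit U) :
    eval p (base f hf) = f p.1.1 := rfl

/-- The base coordinate derivation. -/
def dx (hU : IsOpen U) (k : Fin n) :
    Derivation ℝ (smoothAlgebra (slit U)) (smoothAlgebra (slit U)) :=
  dirDeriv (isOpen_slit hU) (Pi.single k 1, 0)

/-- The fibre coordinate derivation. -/
def dy (hU : IsOpen U) (k : Fin n) :
    Derivation ℝ (smoothAlgebra (slit U)) (smoothAlgebra (slit U)) :=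
  dirDeriv (isOpen_slit hU) (0, Pi.single k 1)

theorem dirDeriv_base (hU : IsOpen U) {f : Vec n → ℝ} (hf : ContDiffOn ℝ (⊤ : ℕ∞) f U)
    (v : Vec n × Vec n) (p : slit U) :
    eval p (dirDeriv (isOpen_slit hU) v (base f hf)) = fderiv ℝ f p.1.1 v.1 := by
  have hd : DifferentiableAt ℝ f p.1.1 :=
    (hf.contDiffAt (hU.mem_nhds p.2.1)).differentiableAt (by simp)
  rw [eval_dirDeriv _ v (g := fun p => f p.1) (fun q => rfl)]
  have h := hd.hasFDerivAt.comp (p : Vec n × Vec n) hasFDerivAt_fst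
  rw [show (fun p : Vec n × Vec n => f p.1) = f ∘ Prod.fst from rfl, h.fderiv]
  rfl

theorem eval_dx_base (hU : IsOpen U) {f : Vec n → ℝ} (hf : ContDiffOn ℝ (⊤ : ℕ∞) f U) (k : Fin n)
    (p : slit U) : eval p (dx hU k (base f hf)) = pd f k p.1.1 :=
  dirDeriv_base hU hf _ p

theorem dy_base (hU : IsOpen U) {f : Vec n → ℝ} (hf : ContDiffOn ℝ (⊤ : ℕ∞) f U) (k : Fin n) :
    dy hU k (base f hf) = 0 :=
  ext_eval fun p => by rw [dy, dirDeriv_base hU, map_zero, map_zero]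

end smoothAlgebra

open smoothAlgebra

theorem Represents.hasFDerivAt (hU : IsOpen U) {φ : smoothAlgebra (slit U)}
    {f : Vec n → Vec n → ℝ} (h : Represents φ f) (p : slit U) :
    HasFDerivAt (fun q : Vec n × Vec n => f q.1 q.2)
      (fderiv ℝ (zeroExtend (slit U) φ.1) p) (p : Vec n × Vec n) :=
  (differentiableAt (isOpen_slit hU) φ p).hasFDerivAt.congr_of_eventuallyEq
    (zeroExtend_eventuallyEq (isOpen_slit hU) (g := fun q => f q.1 q.2) h p).symm

theorem Represents.dx (hU : IsOpen U) {φ : smoothAlgebra (slit U)} {f : Vec n → Vec n → ℝ}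
    (h : Represents φ f) (k : Fin n) :
    Represents (smoothAlgebra.dx hU k φ) (fun x y => pdx f k x y) := fun p => by
  have := HasFDerivAt.comp (f := fun x' => (x', p.1.2)) p.1.1 (h.hasFDerivAt hU p)
    (hasFDerivAt_prodMk_left (𝕜 := ℝ) p.1.1 p.1.2)
  exact (congrArg (fun L => L (Pi.single k 1)) this.fderiv).symm

theorem Represents.dy (hU : IsOpen U) {φ : smoothAlgebra (slit U)} {f : Vec n → Vec n → ℝ}
    (h : Represents φ f) (k : Fin n) :
    Represents (smoothAlgebra.dy hU k φ) (fun x y => pdy f k x y) := fun p => by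
  have := HasFDerivAt.comp (f := fun y' => (p.1.1, y')) p.1.2 (h.hasFDerivAt hU p)
    (hasFDerivAt_prodMk_right (𝕜 := ℝ) p.1.1 p.1.2)
  exact (congrArg (fun L => L (Pi.single k 1)) this.fderiv).symm

theorem hasFDerivAt_snd_apply (i : Fin n) (p : Vec n × Vec n) :
    HasFDerivAt (fun p : Vec n × Vec n => p.2 i)
      ((ContinuousLinearMap.proj i).comp (ContinuousLinearMap.snd ℝ (Vec n) (Vec n))) p :=
  ((ContinuousLinearMap.proj (R := ℝ) (φ := fun _ : Fin n => ℝ) i).comp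
    (ContinuousLinearMap.snd ℝ (Vec n) (Vec n))).hasFDerivAt

namespace IsSquareDatum

variable {a : Vec n → Matrix (Fin n) (Fin n) ℝ} {b : Vec n → Vec n}

theorem smooth_alphaOf (h : IsSquareDatum U a b) :
    ContDiffOn ℝ (⊤ : ℕ∞) (fun p : Vec n × Vec n => alphaOf a p.1 p.2) (slit U) := by
  have ha : ∀ i j, ContDiffOn ℝ (⊤ : ℕ∞) (fun p : Vec n × Vec n => a p.1 i j) (slit U) :=
    fun i j => (h.smooth_a i j).comp contDiff_fst.contDiffOn fun _ hp => hp.1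
  have hy : ∀ i, ContDiffOn ℝ (⊤ : ℕ∞) (fun p : Vec n × Vec n => p.2 i) (slit U) :=
    fun i => ContDiff.contDiffOn (by fun_prop)
  exact ContDiffOn.sqrt (ContDiffOn.sum fun i _ => ContDiffOn.sum fun j _ =>
    ((ha i j).mul (hy i)).mul (hy j)) fun p hp => (h.quad_pos hp.1 hp.2).ne'

/-- The calculus on the slit tangent bundle attached to a metric and a one-form. -/
def metricCalc (h : IsSquareDatum U a b) : MetricCalc n (smoothAlgebra (slit U)) where
  dx := smoothAlgebra.dx h.isOpen
  dy := smoothAlgebra.dy h.isOpen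
  y k := smoothAlgebra.mk (fun p => p.2 k) (ContDiff.contDiffOn (by fun_prop))
  a i j := base (fun x => a x i j) (h.smooth_a i j)
  ainv i j := base (fun x => (a x)⁻¹ i j) (h.smooth_inv i j)
  Ga l i j := base (christoffel a l i j) (h.smooth_christoffel l i j)
  b i := base (fun x => b x i) (h.smooth_b i)
  c i j := base (covDeriv a b i j) (h.smooth_covDeriv i j)
  al := smoothAlgebra.mk (fun p => alphaOf a p.1 p.2) h.smooth_alphaOf
  ali := smoothAlgebra.mk (fun p => (alphaOf a p.1 p.2)⁻¹)
    (h.smooth_alphaOf.inv fun _ hp => (h.alphaOf_pos hp.1 hp.2).ne')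
  separated f g hfg := ext_eval fun p => hfg (eval p)
  dx_dy j k f := dirDeriv_comm _ _ _ _
  dy_dy j k f := dirDeriv_comm _ _ _ _
  dy_y k i := ext_eval fun p => by
    rw [smoothAlgebra.dy, eval_dirDeriv _ _ (g := fun p => p.2 i) (fun q => rfl)]
    rw [(hasFDerivAt_snd_apply i p).fderiv]
    by_cases hik : i = k <;> simp [hik]
  dx_y k i := ext_eval fun p => by
    rw [smoothAlgebra.dx, eval_dirDeriv _ _ (g := fun p => p.2 i) (fun q => rfl)]
    rw [(hasFDerivAt_snd_apply i p).fderiv]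
    simp
  dy_a k i j := dy_base _ _ k
  dy_ainv k i j := dy_base _ _ k
  dy_Ga k l i j := dy_base _ _ k
  dy_b k i := dy_base _ _ k
  dy_c k i j := dy_base _ _ k
  a_symm i j := ext_eval fun p => h.a_comm p.2.1 i j
  ainv_symm i j := ext_eval fun p => h.inv_comm p.2.1 i j
  Ga_symm l i j := ext_eval fun p => h.christoffel_comm p.2.1 l i j
  dx_a k i j := ext_eval fun p => by
    rw [eval_dx_base, h.pd_a p.2.1]
    simp only [map_sum, map_add, map_mul, eval_base]
  dx_b k i := ext_eval fun p => by
    rw [eval_dx_base]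
    simp only [map_sum, map_add, map_mul, eval_base, covDeriv, sub_add_cancel]
  ainv_a i k := ext_eval fun p => by
    simp only [map_sum, map_mul, eval_base, h.inv_mul p.2.1]
    split_ifs <;> simp
  al_sq := ext_eval fun p => by
    simp only [map_sum, map_mul, eval_base, smoothAlgebra.eval_mk, ← h.alphaOf_sq p.2.1]
    ring
  al_ali := ext_eval fun p => by
    simp only [map_mul, smoothAlgebra.eval_mk, map_one]
    exact mul_inv_cancel₀ (h.alphaOf_pos p.2.1 p.2.2).ne'

variable (h : IsSquareDatum U a b) (p : slit U)

theorem eval_y (k : Fin n) : eval p (h.metricCalc.y k) = p.1.2 k := rfl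
theorem eval_a (i j : Fin n) : eval p (h.metricCalc.a i j) = a p.1.1 i j := rfl
theorem eval_ainv (i j : Fin n) : eval p (h.metricCalc.ainv i j) = (a p.1.1)⁻¹ i j := rfl
theorem eval_Ga (l i j : Fin n) : eval p (h.metricCalc.Ga l i j) = christoffel a l i j p.1.1 := rfl
theorem eval_b (i : Fin n) : eval p (h.metricCalc.b i) = b p.1.1 i := rfl
theorem eval_c (i j : Fin n) : eval p (h.metricCalc.c i j) = covDeriv a b i j p.1.1 := rfl
theorem eval_al : eval p h.metricCalc.al = alphaOf a p.1.1 p.1.2 := rfl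
theorem eval_ali : eval p h.metricCalc.ali = (alphaOf a p.1.1 p.1.2)⁻¹ := rfl

theorem eval_be : eval p h.metricCalc.be = betaOf b p.1.1 p.1.2 := by
  simp only [MetricCalc.be, betaOf, map_sum, map_mul, eval_b, eval_y]

theorem eval_bu (i : Fin n) : eval p (h.metricCalc.bu i) = ∑ j, (a p.1.1)⁻¹ i j * b p.1.1 j := by
  simp only [MetricCalc.bu, map_sum, map_mul, eval_b, eval_ainv]

theorem eval_bb : eval p h.metricCalc.bb = bsq a b p.1.1 := by
  simp only [MetricCalc.bb, bsq, map_sum, map_mul, eval_b, eval_bu, Finset.mul_sum]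
  exact Finset.sum_congr rfl fun i _ => Finset.sum_congr rfl fun j _ => by ring

theorem eval_yl (k : Fin n) : eval p (h.metricCalc.yl k) = ∑ j, a p.1.1 k j * p.1.2 j := by
  simp only [MetricCalc.yl, map_sum, map_mul, eval_a, eval_y]

theorem eval_energy : eval p h.metricCalc.energy = sqMetric a b p.1.1 p.1.2 ^ 2 := by
  simp only [MetricCalc.energy, map_mul, map_pow, map_add, eval_al, eval_be, eval_ali, sqMetric,
    div_eq_mul_inv]
  ring

theorem represents_spray (i : Fin n) : Represents (h.metricCalc.spray i) (sprayOf a i) := fun p => by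
  simp only [MetricCalc.spray, MetricCalc.conn, sprayOf, map_sum, map_mul, eval_Ga, eval_y,
    AlgHom.commutes, Finset.sum_mul, Algebra.algebraMap_self, RingHom.id_apply]
  congr 1
  exact Finset.sum_congr rfl fun j _ => Finset.sum_congr rfl fun k _ => by ring

theorem represents_energy :
    Represents h.metricCalc.energy (fun x y => sqMetric a b x y ^ 2) := fun p => h.eval_energy p

theorem represents_dy_energy (j : Fin n) : Represents (h.metricCalc.dy j h.metricCalc.energy)
    (fun x y => pdy (fun x y => sqMetric a b x y ^ 2) j x y) :=
  h.represents_energy.dy h.isOpen j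

theorem eval_dy_dy_energy (i j : Fin n) :
    eval p (h.metricCalc.dy i (h.metricCalc.dy j h.metricCalc.energy)) =
      2 * fundTensor (sqMetric a b) p.1.1 p.1.2 i j := by
  refine ((h.represents_dy_energy j).dy h.isOpen i p).trans ?_
  simp [fundTensor]

theorem represents_curv {G : Fin n → smoothAlgebra (slit U)} {g : Fin n → Vec n → Vec n → ℝ}
    (hG : ∀ i, Represents (G i) (g i)) (i k : Fin n) :
    Represents (h.metricCalc.curv G i k) (curvOfSpray g i k) := fun p => by
  have e1 : eval p (h.metricCalc.dx k (G i)) = _ := (hG i).dx h.isOpen k p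
  have e2 : ∀ j, eval p (h.metricCalc.dx j (h.metricCalc.dy k (G i))) = _ := fun j =>
    ((hG i).dy h.isOpen k).dx h.isOpen j p
  have e3 : ∀ j, eval p (h.metricCalc.dy j (h.metricCalc.dy k (G i))) = _ := fun j =>
    ((hG i).dy h.isOpen k).dy h.isOpen j p
  have e4 : ∀ j i, eval p (h.metricCalc.dy j (G i)) = _ := fun j i => (hG i).dy h.isOpen j p
  simp only [MetricCalc.curv, curvOfSpray, map_sub, map_add, map_mul, map_sum, map_ofNat,
    e1, e2, e3, e4, eval_y, hG _ p]

end IsSquareDatum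

end

namespace smoothAlgebra

variable {E : Type*} [NormedAddCommGroup E] [NormedSpace ℝ E] {W : Set E}

theorem exists_mul_eq_one (f : smoothAlgebra W) (hf : ∀ p, eval p f ≠ 0) :
    ∃ g : smoothAlgebra W, f * g = 1 := by
  refine ⟨⟨fun p => (eval p f)⁻¹, (ContDiffOn.inv f.2 fun p hp => ?_).congr fun p hp => ?_⟩,
    ext_eval fun p => ?_⟩
  · rw [zeroExtend_apply _ hp]
    exact hf ⟨p, hp⟩
  · rw [zeroExtend_apply _ hp, Pi.inv_apply, zeroExtend_apply _ hp]
    rfl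
  · rw [map_mul, map_one]
    exact mul_inv_cancel₀ (hf p)

end smoothAlgebra

theorem Derivation.apply_mem_adjoin {A : Type*} [CommRing A] [Algebra ℝ A] (D : Derivation ℝ A A)
    {S : Set A} (hS : ∀ f ∈ S, D f ∈ Algebra.adjoin ℝ S) {f : A} (hf : f ∈ Algebra.adjoin ℝ S) :
    D f ∈ Algebra.adjoin ℝ S := by
  induction hf using Algebra.adjoin_induction with
  | mem f hf => exact hS f hf
  | algebraMap r => simp
  | add f g _ _ hf hg => rw [map_add]; exact add_mem hf hg
  | mul f g hf' hg' hf hg =>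
    rw [D.leibniz, smul_eq_mul, smul_eq_mul]
    exact add_mem (mul_mem hf' hg) (mul_mem hg' hf)

/-- The quadratic form of the fundamental tensor of the square metric is definite. -/
theorem square_form_definite {α β Q p q : ℝ} (hβ : |β| < α) (hQ : p ^ 2 ≤ α ^ 2 * Q)
    (h : (4 * (α + β) ^ 3 * α⁻¹ ^ 3 - 2 * (α + β) ^ 4 * α⁻¹ ^ 4) * Q
      + ((12 * (α + β) ^ 2 * α⁻¹ ^ 4 - 20 * (α + β) ^ 3 * α⁻¹ ^ 5
            + 8 * (α + β) ^ 4 * α⁻¹ ^ 6) * p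
          + (12 * (α + β) ^ 2 * α⁻¹ ^ 3 - 8 * (α + β) ^ 3 * α⁻¹ ^ 4) * q) * p
      + ((12 * (α + β) ^ 2 * α⁻¹ ^ 3 - 8 * (α + β) ^ 3 * α⁻¹ ^ 4) * p
          + 12 * (α + β) ^ 2 * α⁻¹ ^ 2 * q) * q = 0) : Q ≤ 0 := by
  obtain ⟨h1, h2⟩ := abs_lt.1 hβ
  have hα : 0 < α := by linarith
  have hs : 0 < α + β := by linarith
  have hd : 0 < α - β := by linarith
  field_simp at h
  have key : 2 * (α + β) * (α - β) * (α ^ 2 * Q - p ^ 2)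
      + 12 * (α ^ 2 * q + (α - 2 * (α + β) / 3) * p) ^ 2 + 2 / 3 * (α + β) ^ 2 * p ^ 2 = 0 := by
    have : (α + β) ^ 2 ≠ 0 := by positivity
    refine mul_left_cancel₀ this ?_
    linear_combination h
  have hm : 0 ≤ 2 * (α + β) * (α - β) * (α ^ 2 * Q - p ^ 2) :=
    mul_nonneg (by positivity) (by linarith)
  have hp : 0 < 2 / 3 * (α + β) ^ 2 := by positivity
  have hp0 : p ^ 2 = 0 := by
    have : 2 / 3 * (α + β) ^ 2 * p ^ 2 ≤ 0 := by
      nlinarith [sq_nonneg (α ^ 2 * q + (α - 2 * (α + β) / 3) * p)]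
    nlinarith [sq_nonneg p]
  have hsd : 0 < 2 * (α + β) * (α - β) := by positivity
  have : 2 * (α + β) * (α - β) * (α ^ 2 * Q) ≤ 0 := by
    nlinarith [sq_nonneg (α ^ 2 * q + (α - 2 * (α + β) / 3) * p)]
  have h3 : α ^ 2 * Q ≤ 0 := by
    by_contra hlt
    rw [not_le] at hlt
    linarith [mul_pos hsd hlt]
  by_contra hlt
  rw [not_le] at hlt
  linarith [mul_pos (pow_pos hα 2) hlt]

namespace IsSquareDatum

open smoothAlgebra

variable {n : ℕ} {U : Set (Vec n)} {a : Vec n → Matrix (Fin n) (Fin n) ℝ} {b : Vec n → Vec n}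

/-- The Cauchy-Schwarz inequality for the metric. -/
theorem pair_sq_le (h : IsSquareDatum U a b) {x : Vec n} (hx : x ∈ U) (y w : Vec n) :
    (∑ i, (∑ j, a x i j * y j) * w i) ^ 2 ≤
      (∑ i, ∑ j, a x i j * y i * y j) * ∑ i, ∑ j, a x i j * w i * w j := by
  set p := ∑ i, (∑ j, a x i j * y j) * w i with hp
  have e : ∀ s t : ℝ, ∑ i, ∑ j, a x i j * (s * y i + t * w i) * (s * y j + t * w j) =
      s ^ 2 * (∑ i, ∑ j, a x i j * y i * y j) + 2 * s * t * p
        + t ^ 2 * ∑ i, ∑ j, a x i j * w i * w j := fun s t => by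
    have e1 : p = ∑ i, ∑ j, a x i j * w i * y j := by
      simp only [hp, Finset.sum_mul]
      exact Finset.sum_congr rfl fun i _ => Finset.sum_congr rfl fun j _ => by ring
    have e2 : p = ∑ i, ∑ j, a x i j * y i * w j := by
      rw [e1, Finset.sum_comm]
      exact Finset.sum_congr rfl fun i _ => Finset.sum_congr rfl fun j _ => by
        rw [h.a_comm hx]; ring
    have e3 : 2 * s * t * p = s * t * p + s * t * p := by ring
    rw [e3]
    nth_rewrite 1 [e1]
    rw [e2]
    simp only [Finset.mul_sum, ← Finset.sum_add_distrib]
    exact Finset.sum_congr rfl fun i _ => Finset.sum_congr rfl fun j _ => by ring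
  by_cases hy : y = 0
  · simp [hp, hy]
  · have hq := h.quad_pos hx hy
    have h1 := h.quad_nonneg hx fun i => p * y i + -(∑ i, ∑ j, a x i j * y i * y j) * w i
    rw [e] at h1
    by_contra hlt
    rw [not_le] at hlt
    nlinarith

variable (h : IsSquareDatum U a b) (p : slit U)

theorem eval_den₁_pos : 0 < eval p h.metricCalc.den₁ := by
  rw [MetricCalc.den₁, map_sub, eval_al, eval_be, sub_pos]
  exact (le_abs_self _).trans_lt (h.abs_betaOf_lt p.2.1 p.2.2)

theorem eval_den₂_pos : 0 < eval p h.metricCalc.den₂ := by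
  simp only [MetricCalc.den₂, map_sub, map_add, map_mul, map_one, map_ofNat, eval_al, eval_be,
    eval_bb]
  nlinarith [h.betaOf_sq_le p.2.1 p.1.2, mul_pos (sub_pos.2 (h.bsq_lt_one _ p.2.1))
    (pow_pos (h.alphaOf_pos p.2.1 p.2.2) 2)]

theorem det_fundTensor_ne_zero (h : IsSquareDatum U a b) (p : slit U) :
    (fundTensor (sqMetric a b) p.1.1 p.1.2).det ≠ 0 := by
  intro hdet
  obtain ⟨w, hw0, hw⟩ := Matrix.exists_mulVec_eq_zero_iff.2 hdet
  have h1 : ∀ l, eval p (∑ j, h.metricCalc.dy l (h.metricCalc.dy j h.metricCalc.energy) *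
      algebraMap ℝ _ (w j)) = 0 := fun l => by
    have := congrFun hw l
    simp only [Matrix.mulVec, dotProduct, Pi.zero_apply] at this
    simp only [map_sum, map_mul, h.eval_dy_dy_energy, AlgHom.commutes, Algebra.algebraMap_self,
      RingHom.id_apply, mul_assoc, ← Finset.mul_sum, this, mul_zero]
  simp only [MetricCalc.dy_dy_energy_contract, map_sum, map_mul, map_add, map_sub, map_pow,
    map_ofNat, eval_al, eval_ali, eval_be, eval_yl, eval_b, eval_a, AlgHom.commutes,
    Algebra.algebraMap_self, RingHom.id_apply] at h1
  have h2 := Finset.sum_eq_zero fun l (_ : l ∈ Finset.univ) =>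
    (congrArg (· * w l) (h1 l)).trans (zero_mul _)
  set α := alphaOf a p.1.1 p.1.2
  set β := betaOf b p.1.1 p.1.2
  have hCS := h.pair_sq_le p.2.1 p.1.2 w
  rw [← h.alphaOf_sq p.2.1] at hCS
  refine (h.quad_pos p.2.1 hw0).not_ge
    (square_form_definite (q := ∑ j, b p.1.1 j * w j) (h.abs_betaOf_lt p.2.1 p.2.2) hCS ?_)
  have e : ∑ i, ∑ j, a p.1.1 i j * w i * w j = ∑ i, (∑ j, a p.1.1 i j * w j) * w i := by
    simp only [Finset.sum_mul]
    exact Finset.sum_congr rfl fun i _ => Finset.sum_congr rfl fun j _ => by ring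
  have lin : ∀ (c₀ c₁ c₂ c₃ P R : ℝ) (X Y Z : Fin n → ℝ),
      c₀ * ∑ i, X i * w i + (c₁ * ∑ i, Y i * w i + c₂ * ∑ i, Z i * w i) * P
        + (c₂ * ∑ i, Y i * w i + c₃ * ∑ i, Z i * w i) * R =
      ∑ i, (c₀ * X i + (c₁ * Y i + c₂ * Z i) * P + (c₂ * Y i + c₃ * Z i) * R) * w i := by
    intro c₀ c₁ c₂ c₃ P R X Y Z
    simp only [Finset.mul_sum, Finset.sum_mul, ← Finset.sum_add_distrib, add_mul]
    exact Finset.sum_congr rfl fun i _ => by ring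
  rw [← h2, e, ← lin]

end IsSquareDatum

namespace IsSquareDatum

open smoothAlgebra

variable {n : ℕ} {U : Set (Vec n)} {a : Vec n → Matrix (Fin n) (Fin n) ℝ} {b : Vec n → Vec n}

theorem represents_geoCoeff (h : IsSquareDatum U a b) {e d : smoothAlgebra (slit U)}
    (he : h.metricCalc.den₁ * e = 1) (hd : h.metricCalc.den₂ * d = 1) (i : Fin n) :
    Represents (h.metricCalc.spray i + h.metricCalc.sprayDiff e d i)
      (geoCoeff (sqMetric a b) i) := fun p => by
  have key : ∀ l, (∑ k, p.1.2 k * pdx (fun x y => pdy (fun x y => sqMetric a b x y ^ 2) l x y) k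
      p.1.1 p.1.2) - pdx (fun x y => sqMetric a b x y ^ 2) l p.1.1 p.1.2 =
      4 * ∑ j, fundTensor (sqMetric a b) p.1.1 p.1.2 l j *
        eval p (h.metricCalc.spray j + h.metricCalc.sprayDiff e d j) := fun l => by
    have h1 := congrArg (eval p) (h.metricCalc.euler_lagrange_spray he hd l)
    have h2 : ∀ k, eval p (h.metricCalc.dx k (h.metricCalc.dy l h.metricCalc.energy)) = _ :=
      fun k => (h.represents_dy_energy l).dx h.isOpen k p
    have h3 : eval p (h.metricCalc.dx l h.metricCalc.energy) = _ :=
      h.represents_energy.dx h.isOpen l p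
    simp only [map_sub, map_sum, map_mul, h2, h3, eval_y, map_ofNat, eval_dy_dy_energy,
      mul_assoc, ← Finset.mul_sum] at h1
    linear_combination h1
  rw [geoCoeff, Finset.sum_congr rfl fun l _ => by rw [key l]]
  have hdet := h.det_fundTensor_ne_zero p
  have hinv : ∀ j, ∑ l, (fundTensor (sqMetric a b) p.1.1 p.1.2)⁻¹ i l *
      fundTensor (sqMetric a b) p.1.1 p.1.2 l j = if i = j then 1 else 0 := fun j => by
    rw [← Matrix.mul_apply, Matrix.nonsing_inv_mul _ hdet.isUnit, Matrix.one_apply]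
  generalize hG : (fun j => eval p (h.metricCalc.spray j + h.metricCalc.sprayDiff e d j)) = G
  have hG' : ∀ j, eval p (h.metricCalc.spray j + h.metricCalc.sprayDiff e d j) = G j :=
    fun j => congrFun hG j
  simp only [hG']
  have : ∑ l, (fundTensor (sqMetric a b) p.1.1 p.1.2)⁻¹ i l *
      (4 * ∑ j, fundTensor (sqMetric a b) p.1.1 p.1.2 l j * G j) =
      4 * ∑ j, (∑ l, (fundTensor (sqMetric a b) p.1.1 p.1.2)⁻¹ i l *
        fundTensor (sqMetric a b) p.1.1 p.1.2 l j) * G j := by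
    simp only [Finset.mul_sum, Finset.sum_mul]
    rw [Finset.sum_comm]
    exact Finset.sum_congr rfl fun l _ => Finset.sum_congr rfl fun j _ => by ring
  rw [this]
  simp [hinv]

/-- Constant flag curvature as an identity between smooth functions. -/
theorem isConstFlag_iff (h : IsSquareDatum U a b) {e d : smoothAlgebra (slit U)}
    (he : h.metricCalc.den₁ * e = 1) (hd : h.metricCalc.den₂ * d = 1) (K : ℝ) :
    IsConstFlag U (sqMetric a b) K ↔ ∀ i k,
      h.metricCalc.curv (fun i => h.metricCalc.spray i + h.metricCalc.sprayDiff e d i) i k =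
        algebraMap ℝ _ K * (h.metricCalc.energy * (if i = k then 1 else 0)
          - algebraMap ℝ _ (1 / 2) * (h.metricCalc.y i *
            h.metricCalc.dy k h.metricCalc.energy)) := by
  have hL : ∀ (p : slit U) i k, eval p
      (h.metricCalc.curv (fun i => h.metricCalc.spray i + h.metricCalc.sprayDiff e d i) i k) =
      curvOfSpray (geoCoeff (sqMetric a b)) i k p.1.1 p.1.2 := fun p i k =>
    h.represents_curv (h.represents_geoCoeff he hd) i k p
  have hR : ∀ (p : slit U) i k, eval p
      (algebraMap ℝ _ K * (h.metricCalc.energy * (if i = k then 1 else 0)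
          - algebraMap ℝ _ (1 / 2) * (h.metricCalc.y i *
            h.metricCalc.dy k h.metricCalc.energy))) =
      K * (sqMetric a b p.1.1 p.1.2 ^ 2 * (if i = k then (1 : ℝ) else 0)
        - p.1.2 i * ∑ j, fundTensor (sqMetric a b) p.1.1 p.1.2 k j * p.1.2 j) := fun p i k => by
    have h1 := congrArg (eval p) (h.metricCalc.dy_dy_energy_y k)
    simp only [map_sum, map_mul, eval_dy_dy_energy, eval_y, mul_assoc, ← Finset.mul_sum] at h1
    simp only [map_mul, map_sub, AlgHom.commutes, Algebra.algebraMap_self, RingHom.id_apply,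
      eval_energy, eval_y, ← h1]
    have h2 : eval p (if i = k then 1 else 0) = if i = k then 1 else 0 := by
      split_ifs <;> simp
    rw [h2]
    ring
  constructor
  · intro hK i k
    exact ext_eval fun p => by rw [hL, hR]; exact hK p.1.1 p.2.1 p.1.2 p.2.2 i k
  · intro hK x hx y hy i k
    have := congrArg (eval (⟨(x, y), hx, hy⟩ : slit U)) (hK i k)
    rwa [hL, hR] at this

/-- The subalgebra generated by functions on the base, the fibre coordinates, the norm and its
inverse. -/
def fibreAlgebra (h : IsSquareDatum U a b) : Subalgebra ℝ (smoothAlgebra (slit U)) :=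
  Algebra.adjoin ℝ ({f | ∃ g hg, f = base g hg} ∪ Set.range h.metricCalc.y
    ∪ {h.metricCalc.al, h.metricCalc.ali})

theorem base_mem (h : IsSquareDatum U a b) (g : Vec n → ℝ) (hg : ContDiffOn ℝ (⊤ : ℕ∞) g U) :
    base g hg ∈ h.fibreAlgebra :=
  Algebra.subset_adjoin (Or.inl (Or.inl ⟨g, hg, rfl⟩))

theorem y_mem (h : IsSquareDatum U a b) (i : Fin n) : h.metricCalc.y i ∈ h.fibreAlgebra :=
  Algebra.subset_adjoin (Or.inl (Or.inr ⟨i, rfl⟩))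

theorem al_mem (h : IsSquareDatum U a b) : h.metricCalc.al ∈ h.fibreAlgebra :=
  Algebra.subset_adjoin (Or.inr (Or.inl rfl))

theorem ali_mem (h : IsSquareDatum U a b) : h.metricCalc.ali ∈ h.fibreAlgebra :=
  Algebra.subset_adjoin (Or.inr (Or.inr rfl))

theorem isAdapted_fibreAlgebra (h : IsSquareDatum U a b) :
    h.metricCalc.IsAdapted h.fibreAlgebra := by
  have hyl : ∀ k, h.metricCalc.yl k ∈ h.fibreAlgebra := fun k =>
    sum_mem fun j _ => mul_mem (h.base_mem _ (h.smooth_a k j)) (h.y_mem j)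
  have hdal : ∀ k, h.metricCalc.dy k h.metricCalc.al ∈ h.fibreAlgebra := fun k => by
    rw [MetricCalc.dy_al]; exact mul_mem h.ali_mem (hyl k)
  have hconn : ∀ j k, h.metricCalc.conn j k ∈ h.fibreAlgebra := fun j k =>
    sum_mem fun l _ => mul_mem (h.base_mem _ (h.smooth_christoffel j k l)) (h.y_mem l)
  have hxal : ∀ k, h.metricCalc.dx k h.metricCalc.al ∈ h.fibreAlgebra := fun k => by
    rw [MetricCalc.dx_al]; exact sum_mem fun j _ => mul_mem (hconn j k) (hdal j)
  have hinv : ∀ D : Derivation ℝ (smoothAlgebra (slit U)) (smoothAlgebra (slit U)),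
      D h.metricCalc.al ∈ h.fibreAlgebra → D h.metricCalc.ali ∈ h.fibreAlgebra := fun D hD => by
    rw [MetricCalc.deriv_inv D h.metricCalc.al_ali]
    exact mul_mem (neg_mem (pow_mem h.ali_mem 2)) hD
  refine
    { dx := fun k f hf => Derivation.apply_mem_adjoin _ ?_ hf
      dy := fun k f hf => Derivation.apply_mem_adjoin _ ?_ hf
      y := h.y_mem
      al := h.al_mem
      ali := h.ali_mem
      ainv := fun i j => h.base_mem _ (h.smooth_inv i j)
      Ga := fun l i j => h.base_mem _ (h.smooth_christoffel l i j)
      b := fun i => h.base_mem _ (h.smooth_b i)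
      c := fun i j => h.base_mem _ (h.smooth_covDeriv i j) }
  · rintro f ((⟨g, hg, rfl⟩ | ⟨i, rfl⟩) | rfl | rfl)
    · have : h.metricCalc.dx k (base g hg) = base (pd g k) (hg.pd h.isOpen k) :=
        ext_eval fun p => eval_dx_base h.isOpen hg k p
      rw [this]
      exact h.base_mem _ _
    · rw [h.metricCalc.dx_y]
      exact zero_mem _
    · exact hxal k
    · exact hinv _ (hxal k)
  · rintro f ((⟨g, hg, rfl⟩ | ⟨i, rfl⟩) | rfl | rfl)
    · have : h.metricCalc.dy k (base g hg) = 0 := dy_base h.isOpen hg k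
      rw [this]
      exact zero_mem _
    · rw [h.metricCalc.dy_y]
      split_ifs
      exacts [one_mem _, zero_mem _]
    · exact hdal k
    · exact hinv _ (hdal k)

/-- For constant flag curvature the Ricci curvature is regular at the zeros of the denominators. -/
theorem ricci_mem (h : IsSquareDatum U a b) {e d : smoothAlgebra (slit U)}
    (he : h.metricCalc.den₁ * e = 1) (hd : h.metricCalc.den₂ * d = 1) {K : ℝ}
    (hK : IsConstFlag U (sqMetric a b) K) :
    ∑ i, h.metricCalc.curv (fun i => h.metricCalc.spray i + h.metricCalc.sprayDiff e d i) i i ∈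
      h.fibreAlgebra := by
  have hR := h.isAdapted_fibreAlgebra
  refine sum_mem fun i _ => ?_
  rw [(h.isConstFlag_iff he hd K).1 hK i i, if_pos rfl]
  exact mul_mem (algebraMap_mem _ _) (sub_mem (mul_mem hR.energy (one_mem _))
    (mul_mem (algebraMap_mem _ _) (mul_mem (h.y_mem i) (hR.dy _ _ hR.energy))))

theorem exists_inv_den₁ (h : IsSquareDatum U a b) : ∃ e, h.metricCalc.den₁ * e = 1 :=
  exists_mul_eq_one _ fun p => (h.eval_den₁_pos p).ne'

theorem exists_inv_den₂ (h : IsSquareDatum U a b) : ∃ d, h.metricCalc.den₂ * d = 1 :=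
  exists_mul_eq_one _ fun p => (h.eval_den₂_pos p).ne'

end IsSquareDatum

section Entire

theorem eq_of_eq_ofReal {f g : ℂ → ℂ} (hf : Differentiable ℂ f) (hg : Differentiable ℂ g)
    (h : ∀ t : ℝ, f t = g t) : f = g := by
  refine AnalyticOnNhd.eq_of_frequently_eq (z₀ := 0) (fun z _ => hf.analyticAt z)
    (fun z _ => hg.analyticAt z) ?_
  have h1 : Filter.Tendsto (fun t : ℝ => (t : ℂ)) (nhdsWithin 0 {0}ᶜ) (nhdsWithin 0 {0}ᶜ) := by
    refine tendsto_nhdsWithin_iff.2 ⟨?_, ?_⟩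
    · exact (Complex.continuous_ofReal.tendsto' 0 0 Complex.ofReal_zero).mono_left
        nhdsWithin_le_nhds
    · filter_upwards [self_mem_nhdsWithin] with t ht
      simpa using ht
  exact h1.frequently (Filter.Frequently.of_forall h)

/-- A real function that is the restriction of an entire function. -/
def IsEntireRestriction (Z : ℝ → ℝ) : Prop :=
  ∃ g : ℂ → ℂ, Differentiable ℂ g ∧ ∀ t : ℝ, g t = Z t

/-- A function of the form considered here can only be divisible by
`(1 + 2B²) - 3B² cos²` if it vanishes at the complex zeros of the latter. -/
theorem eq_zero_of_dvd_quadratic {B r₁ r₂ q κ : ℝ} (hB : 0 < B) (hB1 : B < 1) {Z : ℝ → ℝ}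
    (hZ : IsEntireRestriction Z)
    (h : ∀ t : ℝ, 3 * (2 * (1 - B ^ 2) * (B * Real.cos t) * (1 - B * Real.cos t) *
      ((r₁ * Real.cos t ^ 2 + q * (Real.cos t * Real.sin t) + r₂ * Real.sin t ^ 2)
        * (1 - B * Real.cos t) - 2 * (κ * Real.sin t))) ^ 2 =
      ((1 + 2 * B ^ 2) - 3 * (B * Real.cos t) ^ 2) * Z t) :
    r₁ * (1 + 2 * B ^ 2) = r₂ * (1 - B ^ 2) ∧ q = 0 ∧ κ = 0 := by
  obtain ⟨g, hg, hgZ⟩ := hZ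
  have hfun := eq_of_eq_ofReal (f := fun z => 3 * (2 * (1 - (B : ℂ) ^ 2) * (B * Complex.cos z) *
      (1 - B * Complex.cos z) *
      ((r₁ * Complex.cos z ^ 2 + q * (Complex.cos z * Complex.sin z) + r₂ * Complex.sin z ^ 2)
        * (1 - B * Complex.cos z) - 2 * (κ * Complex.sin z))) ^ 2)
    (g := fun z => ((1 + 2 * (B : ℂ) ^ 2) - 3 * (B * Complex.cos z) ^ 2) * g z)
    (by fun_prop) (by fun_prop) fun t => by
      have := congrArg (fun r : ℝ => (r : ℂ)) (h t)
      simp only [hgZ]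
      push_cast at this
      exact this
  have hB2 : 0 < 1 - B ^ 2 := by nlinarith
  have hBC : (B : ℂ) ≠ 0 := by exact_mod_cast hB.ne'
  have hB2C : (1 - (B : ℂ) ^ 2) ≠ 0 := by exact_mod_cast hB2.ne'
  obtain ⟨z, hz⟩ := Complex.cos_surjective ((Real.sqrt ((1 + 2 * B ^ 2) / 3) / B : ℝ) : ℂ)
  set c : ℂ := Complex.cos z with hc
  set s : ℂ := Complex.sin z with hs
  have hBc : ((B : ℂ) * c) ^ 2 = (1 + 2 * (B : ℂ) ^ 2) / 3 := by
    rw [hz]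
    have : (B * (Real.sqrt ((1 + 2 * B ^ 2) / 3) / B)) ^ 2 = (1 + 2 * B ^ 2) / 3 := by
      rw [mul_div_cancel₀ _ hB.ne', Real.sq_sqrt (by positivity)]
    exact_mod_cast this
  have hcs : s ^ 2 = 1 - c ^ 2 := by linear_combination Complex.sin_sq_add_cos_sq z
  have h2B : (1 + 2 * (B : ℂ) ^ 2) ≠ 0 := by
    have : (1 + 2 * B ^ 2) ≠ 0 := by positivity
    exact_mod_cast this
  have hBc0 : (B : ℂ) * c ≠ 0 := fun h0 => h2B (by linear_combination 3 * h0 * (B * c) - 3 * hBc)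
  have hc0 : c ≠ 0 := right_ne_zero_of_mul hBc0
  have hprod : (1 - (B : ℂ) * c) * (1 + B * c) ≠ 0 := fun h0 =>
    hB2C (by linear_combination 3 / 2 * h0 + 3 / 2 * hBc)
  have hs0 : s ≠ 0 := fun h0 => hB2C (by
    linear_combination -3 * (B : ℂ) ^ 2 * s * h0 + 3 * (B : ℂ) ^ 2 * hcs - 3 * hBc)
  have key : ∀ w : ℂ, Complex.cos w ^ 2 = c ^ 2 → 1 - (B : ℂ) * Complex.cos w ≠ 0 →
      (r₁ * Complex.cos w ^ 2 + q * (Complex.cos w * Complex.sin w) + r₂ * Complex.sin w ^ 2)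
        * (1 - B * Complex.cos w) - 2 * (κ * Complex.sin w) = 0 := fun w hw hw1 => by
    have h1 := congrFun hfun w
    have h2 : (1 + 2 * (B : ℂ) ^ 2) - 3 * (B * Complex.cos w) ^ 2 = 0 := by
      rw [mul_pow, hw, ← mul_pow, hBc]; ring
    have h3 : Complex.cos w ≠ 0 := fun h0 => hc0 (pow_eq_zero_iff two_ne_zero |>.1 (by
      rw [← hw, h0]; ring))
    simp only [h2, zero_mul] at h1
    simpa [hB2C, hBC, h3, hw1] using h1
  have k1 := key z rfl (left_ne_zero_of_mul hprod)
  have k2 := key (-z) (by rw [Complex.cos_neg]) (by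
    rw [Complex.cos_neg]; exact left_ne_zero_of_mul hprod)
  have k3 := key (Real.pi - z) (by rw [Complex.cos_pi_sub]; ring) (by
    rw [Complex.cos_pi_sub, mul_neg, sub_neg_eq_add]; exact right_ne_zero_of_mul hprod)
  rw [Complex.cos_neg, Complex.sin_neg] at k2
  rw [Complex.cos_pi_sub, Complex.sin_pi_sub] at k3
  simp only [← hc, ← hs] at k1 k2 k3
  have hP : (r₁ : ℂ) * c ^ 2 + r₂ * s ^ 2 = 0 := by
    refine mul_left_cancel₀ (left_ne_zero_of_mul hprod) ?_
    linear_combination (k1 + k2) / 2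
  have hQ : (q : ℂ) * c * (1 - B * c) - 2 * κ = 0 := by
    refine mul_left_cancel₀ hs0 ?_
    linear_combination k1 - (1 - B * c) * hP
  have hQ' : -(q : ℂ) * c * (1 + B * c) - 2 * κ = 0 := by
    refine mul_left_cancel₀ hs0 ?_
    linear_combination k3 - (1 + B * c) * hP
  have hq : (q : ℂ) = 0 := by
    refine mul_left_cancel₀ hc0 ?_
    linear_combination (hQ - hQ') / 2
  have hκ : (κ : ℂ) = 0 := by linear_combination -hQ / 2 + c * (1 - B * c) / 2 * hq
  have hr : (r₁ : ℂ) * (1 + 2 * B ^ 2) = r₂ * (1 - B ^ 2) := by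
    linear_combination 3 * (B : ℂ) ^ 2 * hP - 3 * (B : ℂ) ^ 2 * r₂ * hcs - 3 * (r₁ - r₂) * hBc
  exact ⟨by exact_mod_cast hr, by exact_mod_cast hq, by exact_mod_cast hκ⟩

theorem eq_zero_of_dvd_linear {B S : ℝ} (hB : 0 < B) (hB1 : B < 1) {Z : ℝ → ℝ}
    (hZ : IsEntireRestriction Z)
    (h : ∀ t : ℝ, S * Real.sin t ^ 2 = (1 - B * Real.cos t) * Z t) : S = 0 := by
  obtain ⟨g, hg, hgZ⟩ := hZ
  have hfun := eq_of_eq_ofReal (f := fun z => (S : ℂ) * Complex.sin z ^ 2)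
    (g := fun z => (1 - B * Complex.cos z) * g z)
    (by fun_prop) (by fun_prop) fun t => by
      have := congrArg (fun r : ℝ => (r : ℂ)) (h t)
      simp only [hgZ]
      push_cast at this
      exact this
  obtain ⟨z, hz⟩ := Complex.cos_surjective ((B⁻¹ : ℝ) : ℂ)
  have hBC : (B : ℂ) ≠ 0 := by exact_mod_cast hB.ne'
  have h1 : (S : ℂ) * Complex.sin z ^ 2 = (1 - B * Complex.cos z) * g z := congrFun hfun z
  have h2 : 1 - (B : ℂ) * Complex.cos z = 0 := by
    rw [hz]; push_cast; rw [mul_inv_cancel₀ hBC, sub_self]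
  rw [h2, zero_mul, Complex.sin_sq, hz] at h1
  have h3 : S * (1 - B⁻¹ ^ 2) = 0 := by exact_mod_cast h1
  refine (mul_eq_zero.1 h3).resolve_right fun h4 => ?_
  have : 1 < B⁻¹ := (one_lt_inv₀ hB).2 hB1
  nlinarith

end Entire

namespace IsSquareDatum

open smoothAlgebra

variable {n : ℕ} {U : Set (Vec n)} {a : Vec n → Matrix (Fin n) (Fin n) ℝ} {b : Vec n → Vec n}

/-- Elements of the fibre algebra restrict to entire functions on circles of the fibres. -/
theorem isEntireRestriction (h : IsSquareDatum U a b) {f : smoothAlgebra (slit U)}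
    (hf : f ∈ h.fibreAlgebra) {x u v : Vec n}
    (hy : ∀ t : ℝ, (x, Real.cos t • u + Real.sin t • v) ∈ slit U)
    (hal : ∀ t : ℝ, alphaOf a x (Real.cos t • u + Real.sin t • v) = 1) :
    IsEntireRestriction fun t => eval ⟨_, hy t⟩ f := by
  induction hf using Algebra.adjoin_induction with
  | mem f hf =>
    rcases hf with (⟨g, hg, rfl⟩ | ⟨i, rfl⟩) | rfl | rfl
    · exact ⟨fun _ => g x, by fun_prop, fun t => rfl⟩
    · exact ⟨fun z => Complex.cos z * u i + Complex.sin z * v i, by fun_prop, fun t => by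
        simp [eval_y]⟩
    · exact ⟨fun _ => 1, by fun_prop, fun t => by simp [eval_al, hal]⟩
    · exact ⟨fun _ => 1, by fun_prop, fun t => by simp [eval_ali, hal]⟩
  | algebraMap r => exact ⟨fun _ => r, by fun_prop, fun t => by simp⟩
  | add f₁ f₂ _ _ h₁ h₂ =>
    obtain ⟨g₁, hg₁, e₁⟩ := h₁
    obtain ⟨g₂, hg₂, e₂⟩ := h₂
    exact ⟨fun z => g₁ z + g₂ z, by fun_prop, fun t => by simp [e₁, e₂]⟩
  | mul f₁ f₂ _ _ h₁ h₂ =>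
    obtain ⟨g₁, hg₁, e₁⟩ := h₁
    obtain ⟨g₂, hg₂, e₂⟩ := h₂
    exact ⟨fun z => g₁ z * g₂ z, by fun_prop, fun t => by simp [e₁, e₂]⟩

end IsSquareDatum

namespace IsSquareDatum

open smoothAlgebra Matrix

variable {n : ℕ} {U : Set (Vec n)} {a : Vec n → Matrix (Fin n) (Fin n) ℝ} {b : Vec n → Vec n}

theorem quad_eq (a : Vec n → Matrix (Fin n) (Fin n) ℝ) (x y : Vec n) :
    ∑ i, ∑ j, a x i j * y i * y j = y ⬝ᵥ a x *ᵥ y := by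
  simp only [dotProduct, mulVec, Finset.mul_sum]
  exact Finset.sum_congr rfl fun i _ => Finset.sum_congr rfl fun j _ => by ring

theorem alphaOf_sq' (h : IsSquareDatum U a b) {x : Vec n} (hx : x ∈ U) (y : Vec n) :
    alphaOf a x y ^ 2 = y ⬝ᵥ a x *ᵥ y := by rw [h.alphaOf_sq hx, quad_eq]

theorem betaOf_eq (b : Vec n → Vec n) (x y : Vec n) : betaOf b x y = b x ⬝ᵥ y := rfl

/-- The vector dual to the one-form. -/
def dual (a : Vec n → Matrix (Fin n) (Fin n) ℝ) (b : Vec n → Vec n) (x : Vec n) : Vec n :=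
  (a x)⁻¹ *ᵥ b x

/-- The covariant derivative of the one-form as a matrix. -/
def covMatrix (a : Vec n → Matrix (Fin n) (Fin n) ℝ) (b : Vec n → Vec n) (x : Vec n) :
    Matrix (Fin n) (Fin n) ℝ := Matrix.of fun i j => covDeriv a b i j x

theorem mulVec_dual (h : IsSquareDatum U a b) {x : Vec n} (hx : x ∈ U) :
    a x *ᵥ dual a b x = b x := by
  rw [dual, mulVec_mulVec, mul_nonsing_inv _ (h.det_ne_zero hx).isUnit, one_mulVec]

theorem dotProduct_dual (a : Vec n → Matrix (Fin n) (Fin n) ℝ) (b : Vec n → Vec n) (x : Vec n) :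
    b x ⬝ᵥ dual a b x = bsq a b x := by
  simp only [dual, dotProduct, mulVec, bsq, Finset.mul_sum]
  exact Finset.sum_congr rfl fun i _ => Finset.sum_congr rfl fun j _ => by ring

theorem dual_mulVec (h : IsSquareDatum U a b) {x : Vec n} (hx : x ∈ U) (y : Vec n) :
    dual a b x ⬝ᵥ a x *ᵥ y = b x ⬝ᵥ y := by
  rw [dotProduct_mulVec, ← mulVec_transpose, (h.symm x hx).eq, h.mulVec_dual hx]

variable (h : IsSquareDatum U a b) (p : slit U)

theorem eval_bu' (i : Fin n) : eval p (h.metricCalc.bu i) = dual a b p.1.1 i := h.eval_bu p i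

theorem eval_c00 : eval p h.metricCalc.c00 = p.1.2 ⬝ᵥ covMatrix a b p.1.1 *ᵥ p.1.2 := by
  simp only [MetricCalc.c00, MetricCalc.c0, map_sum, map_mul, eval_c, eval_y, dotProduct, mulVec,
    covMatrix, Matrix.of_apply, Finset.mul_sum, Finset.sum_mul]
  rw [Finset.sum_comm]
  exact Finset.sum_congr rfl fun i _ => Finset.sum_congr rfl fun j _ => by ring

theorem eval_sk (l : Fin n) : eval p (h.metricCalc.sk l) =
    ((covMatrix a b p.1.1 - (covMatrix a b p.1.1)ᵀ) *ᵥ p.1.2) l := by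
  simp only [MetricCalc.sk, map_sum, map_mul, map_sub, eval_c, eval_y, dotProduct, mulVec,
    covMatrix, Matrix.of_apply, Matrix.sub_apply, Matrix.transpose_apply]

theorem eval_sk0 : eval p h.metricCalc.sk0 =
    dual a b p.1.1 ⬝ᵥ (covMatrix a b p.1.1 - (covMatrix a b p.1.1)ᵀ) *ᵥ p.1.2 := by
  simp only [MetricCalc.sk0, map_sum, map_mul, eval_bu', eval_sk]
  rfl

/-- The conformal factor of the one-form. -/
def factor (a : Vec n → Matrix (Fin n) (Fin n) ℝ) (b : Vec n → Vec n) (x : Vec n) : ℝ :=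
  dual a b x ⬝ᵥ covMatrix a b x *ᵥ dual a b x / (bsq a b x * (1 - bsq a b x))

theorem smooth_factor (h : IsSquareDatum U a b) : ContDiffOn ℝ (⊤ : ℕ∞) (factor a b) U := by
  have hd : ∀ i, ContDiffOn ℝ (⊤ : ℕ∞) (fun x => dual a b x i) U := fun i => by
    simp only [dual, mulVec, dotProduct]
    exact ContDiffOn.sum fun j _ => (h.smooth_inv i j).mul (h.smooth_b j)
  have hn : ContDiffOn ℝ (⊤ : ℕ∞)
      (fun x => dual a b x ⬝ᵥ covMatrix a b x *ᵥ dual a b x) U := by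
    simp only [mulVec, dotProduct, covMatrix, Matrix.of_apply]
    exact ContDiffOn.sum fun i _ => (hd i).mul (ContDiffOn.sum fun j _ =>
      (h.smooth_covDeriv i j).mul (hd j))
  exact hn.div (h.smooth_bsq.mul (contDiffOn_const.sub h.smooth_bsq))
    fun x hx => (mul_pos (h.bsq_pos x hx) (sub_pos.2 (h.bsq_lt_one x hx))).ne'

/-- Unit circles orthogonal to the one-form. -/
theorem circle (h : IsSquareDatum U a b) {x v : Vec n} (hx : x ∈ U) (hv : b x ⬝ᵥ v = 0)
    (hv1 : v ⬝ᵥ a x *ᵥ v = 1) (t : ℝ) :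
    (x, Real.cos t • ((Real.sqrt (bsq a b x))⁻¹ • dual a b x) + Real.sin t • v) ∈ slit U ∧
    alphaOf a x (Real.cos t • ((Real.sqrt (bsq a b x))⁻¹ • dual a b x) + Real.sin t • v) = 1 ∧
    betaOf b x (Real.cos t • ((Real.sqrt (bsq a b x))⁻¹ • dual a b x) + Real.sin t • v) =
      Real.sqrt (bsq a b x) * Real.cos t := by
  have hb := h.bsq_pos x hx
  set B := Real.sqrt (bsq a b x) with hB
  have hB2 : bsq a b x = B ^ 2 := (Real.sq_sqrt hb.le).symm
  have hB0 : B ≠ 0 := (Real.sqrt_pos.2 hb).ne'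
  have hq : alphaOf a x (Real.cos t • (B⁻¹ • dual a b x) + Real.sin t • v) ^ 2 = 1 := by
    have h1 : v ⬝ᵥ a x *ᵥ dual a b x = 0 := by rw [h.mulVec_dual hx, dotProduct_comm, hv]
    have h2 : dual a b x ⬝ᵥ a x *ᵥ dual a b x = B ^ 2 := by
      rw [h.dual_mulVec hx, dotProduct_dual, hB2]
    rw [h.alphaOf_sq' hx]
    simp only [mulVec_add, mulVec_smul, dotProduct_add, add_dotProduct, dotProduct_smul,
      smul_dotProduct, smul_eq_mul, h1, h2, hv1, h.dual_mulVec hx, hv]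
    field_simp
    linear_combination B * Real.cos_sq_add_sin_sq t
  have h1 : alphaOf a x (Real.cos t • (B⁻¹ • dual a b x) + Real.sin t • v) = 1 :=
    (pow_eq_one_iff_of_nonneg (Real.sqrt_nonneg _) two_ne_zero).1 hq
  refine ⟨⟨hx, fun h0 => ?_⟩, h1, ?_⟩
  · have h2 : alphaOf a x 0 = 0 := by simp [alphaOf]
    exact zero_ne_one (h2.symm.trans ((congrArg (alphaOf a x) h0).symm.trans h1))
  · simp only [betaOf_eq, dotProduct_add, dotProduct_smul, smul_eq_mul, dotProduct_dual, hv, hB2]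
    field_simp
    ring

theorem exists_normalize (h : IsSquareDatum U a b) {x v : Vec n} (hx : x ∈ U) (hv : v ≠ 0) :
    ∃ c : ℝ, c ≠ 0 ∧ (c • v) ⬝ᵥ a x *ᵥ (c • v) = 1 := by
  have hq : 0 < v ⬝ᵥ a x *ᵥ v := by rw [← quad_eq]; exact h.quad_pos hx hv
  have hc := (Real.sqrt_pos.2 hq).ne'
  refine ⟨(Real.sqrt (v ⬝ᵥ a x *ᵥ v))⁻¹, inv_ne_zero hc, ?_⟩
  simp only [mulVec_smul, dotProduct_smul, smul_dotProduct, smul_eq_mul]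
  field_simp
  exact (Real.sq_sqrt hq.le).symm

theorem dual_sub_transpose (a : Vec n → Matrix (Fin n) (Fin n) ℝ) (b : Vec n → Vec n)
    (x w : Vec n) : dual a b x ⬝ᵥ (covMatrix a b x - (covMatrix a b x)ᵀ) *ᵥ w =
      dual a b x ⬝ᵥ covMatrix a b x *ᵥ w - w ⬝ᵥ covMatrix a b x *ᵥ dual a b x := by
  rw [sub_mulVec, dotProduct_sub, mulVec_transpose, dotProduct_comm _ (w ᵥ* _),
    ← dotProduct_mulVec]

theorem covMatrix_orthogonal (h : IsSquareDatum U a b) {K : ℝ}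
    (hK : IsConstFlag U (sqMetric a b) K) {x v : Vec n} (hx : x ∈ U) (hv : b x ⬝ᵥ v = 0) :
    v ⬝ᵥ covMatrix a b x *ᵥ v = factor a b x * (1 + 2 * bsq a b x) * (v ⬝ᵥ a x *ᵥ v) ∧
    dual a b x ⬝ᵥ covMatrix a b x *ᵥ v = 0 ∧ v ⬝ᵥ covMatrix a b x *ᵥ dual a b x = 0 := by
  by_cases hv0 : v = 0
  · simp [hv0]
  wlog hv1 : v ⬝ᵥ a x *ᵥ v = 1 generalizing v
  · obtain ⟨c, hc0, hc1⟩ := h.exists_normalize hx hv0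
    have := this (v := c • v) (by rw [dotProduct_smul, hv, smul_zero]) (smul_ne_zero hc0 hv0) hc1
    simpa [mulVec_smul, dotProduct_smul, smul_dotProduct, mul_left_comm (factor a b x *
      (1 + 2 * bsq a b x)), hc0] using this
  obtain ⟨e, he⟩ := h.exists_inv_den₁
  obtain ⟨d, hd⟩ := h.exists_inv_den₂
  obtain ⟨Z, hZ, hdvd⟩ := h.isAdapted_fibreAlgebra.den₂_dvd he hd (h.ricci_mem he hd hK)
  have hb := h.bsq_pos x hx
  have hb1 := h.bsq_lt_one x hx
  have hcirc := h.circle hx hv hv1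
  set B := Real.sqrt (bsq a b x) with hB
  have hB2 : bsq a b x = B ^ 2 := (Real.sq_sqrt hb.le).symm
  have hB0 : 0 < B := Real.sqrt_pos.2 hb
  have hB1 : B < 1 := by
    rw [hB2] at hb1; exact (sq_lt_one_iff₀ hB0.le).1 hb1
  obtain ⟨hr, hq, hκ⟩ := eq_zero_of_dvd_quadratic
    (r₁ := (B ^ 2)⁻¹ * (dual a b x ⬝ᵥ covMatrix a b x *ᵥ dual a b x))
    (q := B⁻¹ * (dual a b x ⬝ᵥ covMatrix a b x *ᵥ v + v ⬝ᵥ covMatrix a b x *ᵥ dual a b x))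
    (r₂ := v ⬝ᵥ covMatrix a b x *ᵥ v)
    (κ := dual a b x ⬝ᵥ covMatrix a b x *ᵥ v - v ⬝ᵥ covMatrix a b x *ᵥ dual a b x) hB0 hB1
    (h.isEntireRestriction hZ (fun t => (hcirc t).1) fun t => (hcirc t).2.1) fun t => by
      have h1 := congrArg (eval ⟨_, (hcirc t).1⟩) hdvd
      simp only [map_mul, map_pow, map_sub, map_add, map_one, map_ofNat, MetricCalc.den₁,
        MetricCalc.den₂, eval_al, eval_be, eval_bb, eval_c00, eval_sk0, (hcirc t).2.1,
        (hcirc t).2.2, hB2, mulVec_add, mulVec_smul, dotProduct_add, add_dotProduct,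
        dotProduct_smul, smul_dotProduct, smul_eq_mul, dual_sub_transpose, sub_self, mul_zero, zero_add] at h1
      linear_combination h1
  have h1 : dual a b x ⬝ᵥ covMatrix a b x *ᵥ v + v ⬝ᵥ covMatrix a b x *ᵥ dual a b x = 0 :=
    (mul_eq_zero.1 hq).resolve_left (inv_ne_zero hB0.ne')
  refine ⟨?_, by linear_combination (h1 + hκ) / 2, by linear_combination (h1 - hκ) / 2⟩
  have hB3 : 1 - B ^ 2 ≠ 0 := by nlinarith
  rw [factor, hB2, hv1]
  field_simp at hr ⊢
  linear_combination -hr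

end IsSquareDatum

open Matrix in
theorem Matrix.eq_zero_of_quadratic_eq_zero {n : ℕ} {M : Matrix (Fin n) (Fin n) ℝ}
    (hM : Mᵀ = M) (h : ∀ y, y ⬝ᵥ M *ᵥ y = 0) : M = 0 := by
  ext i j
  have h1 := h (Pi.single i 1 + Pi.single j 1)
  have h2 := h (Pi.single i 1)
  have h3 := h (Pi.single j 1)
  have h4 : M j i = M i j := congrFun (congrFun hM i) j
  simp only [mulVec_add, dotProduct_add, add_dotProduct, mulVec_single_one, single_one_dotProduct,
    col_apply] at h1 h2 h3
  rw [zero_apply]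
  linarith

namespace IsSquareDatum

open smoothAlgebra Matrix

variable {n : ℕ} {U : Set (Vec n)} {a : Vec n → Matrix (Fin n) (Fin n) ℝ} {b : Vec n → Vec n}

theorem exists_decomp (h : IsSquareDatum U a b) {x : Vec n} (hx : x ∈ U) (y : Vec n) :
    ∃ (s : ℝ) (v : Vec n), b x ⬝ᵥ v = 0 ∧ y = s • dual a b x + v := by
  refine ⟨b x ⬝ᵥ y / bsq a b x, y - (b x ⬝ᵥ y / bsq a b x) • dual a b x, ?_, by abel⟩
  rw [dotProduct_sub, dotProduct_smul, dotProduct_dual, smul_eq_mul,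
    div_mul_cancel₀ _ (h.bsq_pos x hx).ne', sub_self]

theorem dual_covMatrix_dual (h : IsSquareDatum U a b) {x : Vec n} (hx : x ∈ U) :
    dual a b x ⬝ᵥ covMatrix a b x *ᵥ dual a b x =
      factor a b x * (bsq a b x * (1 - bsq a b x)) := by
  rw [factor, div_mul_cancel₀ _ (mul_pos (h.bsq_pos x hx) (sub_pos.2 (h.bsq_lt_one x hx))).ne']

theorem quad_decomp (h : IsSquareDatum U a b) {x v : Vec n} (hx : x ∈ U) (hv : b x ⬝ᵥ v = 0)
    (s : ℝ) : (s • dual a b x + v) ⬝ᵥ a x *ᵥ (s • dual a b x + v) =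
      s ^ 2 * bsq a b x + v ⬝ᵥ a x *ᵥ v := by
  simp only [mulVec_add, mulVec_smul, dotProduct_add, add_dotProduct, dotProduct_smul,
    smul_dotProduct, smul_eq_mul, h.dual_mulVec hx, h.mulVec_dual hx, hv, dotProduct_comm v (b x),
    dotProduct_dual, dotProduct_comm (dual a b x) (b x)]
  ring

theorem form_decomp (a : Vec n → Matrix (Fin n) (Fin n) ℝ) (b : Vec n → Vec n) {x v : Vec n}
    (hv : b x ⬝ᵥ v = 0) (s : ℝ) : b x ⬝ᵥ (s • dual a b x + v) = s * bsq a b x := by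
  rw [dotProduct_add, dotProduct_smul, hv, dotProduct_dual, smul_eq_mul, add_zero]

theorem covMatrix_quadratic (h : IsSquareDatum U a b) {K : ℝ}
    (hK : IsConstFlag U (sqMetric a b) K) {x : Vec n} (hx : x ∈ U) (y : Vec n) :
    y ⬝ᵥ covMatrix a b x *ᵥ y = factor a b x *
      ((1 + 2 * bsq a b x) * (y ⬝ᵥ a x *ᵥ y) - 3 * (b x ⬝ᵥ y) ^ 2) := by
  obtain ⟨s, v, hv, rfl⟩ := h.exists_decomp hx y
  obtain ⟨h1, h2, h3⟩ := h.covMatrix_orthogonal hK hx hv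
  rw [h.quad_decomp hx hv, form_decomp a b hv]
  simp only [mulVec_add, mulVec_smul, dotProduct_add, add_dotProduct, dotProduct_smul,
    smul_dotProduct, smul_eq_mul, h1, h2, h3, h.dual_covMatrix_dual hx]
  ring

theorem dual_covMatrix_comm (h : IsSquareDatum U a b) {K : ℝ}
    (hK : IsConstFlag U (sqMetric a b) K) {x : Vec n} (hx : x ∈ U) (y : Vec n) :
    dual a b x ⬝ᵥ (covMatrix a b x - (covMatrix a b x)ᵀ) *ᵥ y = 0 := by
  obtain ⟨s, v, hv, rfl⟩ := h.exists_decomp hx y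
  obtain ⟨-, h2, h3⟩ := h.covMatrix_orthogonal hK hx hv
  rw [dual_sub_transpose]
  simp only [mulVec_add, mulVec_smul, dotProduct_add, add_dotProduct, dotProduct_smul,
    smul_dotProduct, smul_eq_mul, h2, h3, sub_self]

theorem covMatrix_sub_mulVec_dual (h : IsSquareDatum U a b) {K : ℝ}
    (hK : IsConstFlag U (sqMetric a b) K) {x : Vec n} (hx : x ∈ U) :
    (covMatrix a b x - (covMatrix a b x)ᵀ) *ᵥ dual a b x = 0 := by
  refine dotProduct_eq_zero _ fun w => ?_
  have := h.dual_covMatrix_comm hK hx w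
  rw [dotProduct_mulVec, ← mulVec_transpose, transpose_sub, transpose_transpose, ← neg_sub,
    neg_mulVec, neg_dotProduct, neg_eq_zero] at this
  exact this

theorem covMatrix_sub_mulVec (h : IsSquareDatum U a b) {K : ℝ}
    (hK : IsConstFlag U (sqMetric a b) K) {x v : Vec n} (hx : x ∈ U) (hv : b x ⬝ᵥ v = 0) :
    (covMatrix a b x - (covMatrix a b x)ᵀ) *ᵥ v = 0 := by
  by_cases hv0 : v = 0
  · simp [hv0]
  wlog hv1 : v ⬝ᵥ a x *ᵥ v = 1 generalizing v
  · obtain ⟨c, hc0, hc1⟩ := h.exists_normalize hx hv0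
    have := this (v := c • v) (by rw [dotProduct_smul, hv, smul_zero]) (smul_ne_zero hc0 hv0) hc1
    rwa [mulVec_smul, smul_eq_zero_iff_right hc0] at this
  obtain ⟨e, he⟩ := h.exists_inv_den₁
  obtain ⟨d, hd⟩ := h.exists_inv_den₂
  have hc00 : h.metricCalc.c00 = base (factor a b) h.smooth_factor * h.metricCalc.den₂ :=
    ext_eval fun p => by
      simp only [map_mul, map_sub, map_add, map_one, map_ofNat, MetricCalc.den₂, eval_al, eval_be,
        eval_bb, eval_c00, eval_base, h.covMatrix_quadratic hK p.2.1, ← h.alphaOf_sq' p.2.1,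
        betaOf_eq]
      ring
  have hsk0 : h.metricCalc.sk0 = 0 := ext_eval fun p => by
    rw [eval_sk0, h.dual_covMatrix_comm hK p.2.1, map_zero]
  obtain ⟨Z, hZ, hdvd⟩ := h.isAdapted_fibreAlgebra.den₁_dvd he hd
    (h.base_mem _ h.smooth_factor) hc00 hsk0 (h.ricci_mem he hd hK)
  set w := (covMatrix a b x - (covMatrix a b x)ᵀ) *ᵥ v with hw
  have hcirc := h.circle hx hv hv1
  have hB0 : 0 < Real.sqrt (bsq a b x) := Real.sqrt_pos.2 (h.bsq_pos x hx)
  have hB1 : Real.sqrt (bsq a b x) < 1 := (Real.sqrt_lt' one_pos).2 (by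
    rw [one_pow]; exact h.bsq_lt_one x hx)
  have hS := eq_zero_of_dvd_linear (S := 2 * ((a x)⁻¹ *ᵥ w ⬝ᵥ w)) hB0 hB1
    (h.isEntireRestriction hZ (fun t => (hcirc t).1) fun t => (hcirc t).2.1) fun t => by
      have h1 := congrArg (eval ⟨_, (hcirc t).1⟩) hdvd
      have h2 : ∀ l, eval ⟨_, (hcirc t).1⟩ (h.metricCalc.sk l) = Real.sin t * w l := fun l => by
        rw [eval_sk, mulVec_add, mulVec_smul, mulVec_smul, mulVec_smul,
          h.covMatrix_sub_mulVec_dual hK hx, smul_zero, smul_zero, zero_add]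
        rfl
      have h3 : ∀ l, eval ⟨_, (hcirc t).1⟩ (h.metricCalc.sku l) =
          Real.sin t * ((a x)⁻¹ *ᵥ w) l := fun l => by
        simp only [MetricCalc.sku, map_sum, map_mul, h2, eval_ainv, mulVec, dotProduct,
          Finset.mul_sum]
        exact Finset.sum_congr rfl fun j _ => by ring
      simp only [map_mul, map_sum, map_pow, map_sub, map_ofNat, MetricCalc.den₁, eval_al, eval_ali,
        eval_be, (hcirc t).2.1, (hcirc t).2.2, h2, h3] at h1
      rw [← h1, dotProduct, Finset.mul_sum, Finset.sum_mul, Finset.mul_sum, Finset.mul_sum]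
      exact Finset.sum_congr rfl fun j _ => by ring
  have hAw : a x *ᵥ (a x)⁻¹ *ᵥ w = w := by
    rw [mulVec_mulVec, mul_nonsing_inv _ (h.det_ne_zero hx).isUnit, one_mulVec]
  by_contra hw0
  have := h.quad_pos hx (v := (a x)⁻¹ *ᵥ w) fun h0 => hw0 (by rw [← hAw, h0, mulVec_zero])
  rw [quad_eq, hAw] at this
  linarith

/-- The covariant derivative of the one-form of a square metric of constant flag curvature. -/
theorem covDeriv_eq (h : IsSquareDatum U a b) {K : ℝ}
    (hK : IsConstFlag U (sqMetric a b) K) {x : Vec n} (hx : x ∈ U) (i j : Fin n) :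
    covDeriv a b i j x =
      factor a b x * ((1 + 2 * bsq a b x) * a x i j - 3 * b x i * b x j) := by
  have hsymm : (covMatrix a b x)ᵀ = covMatrix a b x := by
    refine (sub_eq_zero.1 (Matrix.ext_of_mulVec_single fun i => ?_)).symm
    obtain ⟨s, v, hv, hy⟩ := h.exists_decomp hx (Pi.single i 1)
    rw [hy, mulVec_add, mulVec_smul, h.covMatrix_sub_mulVec_dual hK hx,
      h.covMatrix_sub_mulVec hK hx hv, smul_zero, add_zero, zero_mulVec]
  have := eq_zero_of_quadratic_eq_zero (M := covMatrix a b x -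
    factor a b x • ((1 + 2 * bsq a b x) • a x - (3 : ℝ) • vecMulVec (b x) (b x)))
    (by rw [transpose_sub, transpose_smul, transpose_sub, transpose_smul, transpose_smul,
      (h.symm x hx).eq, hsymm, transpose_vecMulVec]) fun y => by
      simp only [sub_mulVec, smul_mulVec, dotProduct_sub, dotProduct_smul, smul_eq_mul,
        h.covMatrix_quadratic hK hx, vecMulVec_mulVec, op_smul_eq_smul, dotProduct_comm y (b x)]
      ring
  have h1 := congrFun (congrFun this i) j
  simp only [Matrix.sub_apply, Matrix.smul_apply, vecMulVec_apply, covMatrix, of_apply,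
    smul_eq_mul, Matrix.zero_apply] at h1
  linear_combination h1

end IsSquareDatum

namespace MetricCalc

variable {n : ℕ} {A : Type*} [CommRing A] [Algebra ℝ A] (M : MetricCalc n A) {τ : A}

/-- The Ricci curvature of the spray of the square metric when the covariant derivative of the
one-form is `τ ((1 + 2b²) a - 3 b ⊗ b)`. -/
theorem ricci_spray_sprayDiff
    (hc : ∀ i j, M.c i j = τ * ((1 + 2 * M.bb) * M.a i j - 3 * M.b i * M.b j))
    (hτ : ∀ k, M.dy k τ = 0) {e d : A} (hd : M.den₂ * d = 1) :
    ∑ i, M.curv (fun i => M.spray i + M.sprayDiff e d i) i i = ∑ i, M.curv M.spray i i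
      + (n - 1) * (τ ^ 2 * ((5 + 4 * M.bb) * M.al ^ 2 - 2 * M.be ^ 2 - 2 * M.al * M.be)
          - (∑ j, M.dx j τ * M.y j) * (M.al - 2 * M.be))
      + (2 * (∑ j, M.dx j τ * M.bu j) * M.al ^ 2 - 2 * (∑ j, M.dx j τ * M.y j) * M.be
          - 2 * τ ^ 2 * M.al ^ 2 * M.bb + 2 * τ ^ 2 * M.be ^ 2) := by
  simp only [M.curv_spray_sprayDiff hc hτ hd, if_true, mul_one, Finset.sum_add_distrib,
    Finset.sum_const, Finset.card_univ, Fintype.card_fin, nsmul_eq_mul]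
  generalize ht : ∑ j, M.dx j τ * M.y j = t₀
  have h1 : ∑ x, M.y x * (2 * M.dx x τ * (M.al - 2 * M.be) - t₀ * (M.ali * M.yl x - 2 * M.b x)
      + τ ^ 2 * (-(5 + 4 * M.bb) * M.yl x + 2 * M.be * M.b x + 4 * M.al * M.b x
        - 2 * M.be * M.ali * M.yl x)) =
      2 * (M.al - 2 * M.be) * ∑ j, M.dx j τ * M.y j
      + (-t₀ * M.ali + τ ^ 2 * (-(5 + 4 * M.bb) - 2 * M.be * M.ali)) * ∑ j, M.yl j * M.y j
      + (2 * t₀ + τ ^ 2 * (2 * M.be + 4 * M.al)) * ∑ j, M.b j * M.y j := by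
    simp only [Finset.mul_sum, ← Finset.sum_add_distrib]
    exact Finset.sum_congr rfl fun j _ => by ring
  have h2 : ∑ x, M.bu x * (2 * M.dx x τ * M.al ^ 2 - 2 * t₀ * M.yl x
      - 2 * τ ^ 2 * M.al ^ 2 * M.b x + 2 * τ ^ 2 * M.be * M.yl x) =
      2 * (∑ j, M.dx j τ * M.bu j) * M.al ^ 2
      + (-2 * t₀ + 2 * τ ^ 2 * M.be) * ∑ j, M.yl j * M.bu j
      - 2 * τ ^ 2 * M.al ^ 2 * ∑ j, M.b j * M.bu j := by
    simp only [Finset.mul_sum, Finset.sum_mul, ← Finset.sum_add_distrib, ← Finset.sum_sub_distrib]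
    exact Finset.sum_congr rfl fun j _ => by ring
  rw [h1, h2, ht, yl_y, b_y, yl_bu, b_bu]
  linear_combination (-t₀ * M.al - 2 * τ ^ 2 * M.be * M.al) * M.al_ali

/-- The curvature of the spray of the square metric when the covariant derivative of the one-form
is `τ ((1 + 2b²) a - 3 b ⊗ b)` and the derivative of `τ` is `-2 τ² b`. -/
theorem curv_spray_sprayDiff_of_dx
    (hc : ∀ i j, M.c i j = τ * ((1 + 2 * M.bb) * M.a i j - 3 * M.b i * M.b j))
    (hτ : ∀ k, M.dy k τ = 0) (hdx : ∀ k, M.dx k τ = -2 * τ ^ 2 * M.b k) {e d : A}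
    (hd : M.den₂ * d = 1) (i k : Fin n) :
    M.curv (fun i => M.spray i + M.sprayDiff e d i) i k = M.curv M.spray i k
      - (-(5 + 4 * M.bb) * τ ^ 2 * (M.al ^ 2 * (if i = k then 1 else 0) - M.y i * M.yl k)
        + 6 * τ ^ 2 * (M.be ^ 2 * (if i = k then 1 else 0) + M.al ^ 2 * M.bu i * M.b k
          - M.be * M.bu i * M.yl k - M.be * M.b k * M.y i)) := by
  have ht : ∑ j, M.dx j τ * M.y j = -2 * τ ^ 2 * M.be := by
    simp only [hdx, mul_assoc, ← Finset.mul_sum, b_y]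
  rw [M.curv_spray_sprayDiff hc hτ hd, ht, hdx]
  ring

theorem sum_flag (K : A) : ∑ i, K * (M.energy * (if i = i then 1 else 0)
      - algebraMap ℝ A (1 / 2) * (M.y i * M.dy i M.energy)) = (n - 1) * (K * M.energy) := by
  have h : ∑ i, M.y i * M.dy i M.energy = 2 * M.energy := by
    rw [← M.dy_energy_y]; exact Finset.sum_congr rfl fun i _ => mul_comm _ _
  simp only [if_true, mul_one, ← Finset.mul_sum, Finset.sum_sub_distrib, h, Finset.sum_const,
    Finset.card_univ, Fintype.card_fin, nsmul_eq_mul]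
  linear_combination - K * M.energy * half_mul_two (A := A)

end MetricCalc

section Parity

variable {n : ℕ} {f : Vec n → Vec n → ℝ}

theorem pdy_neg (hf : ∀ x y, f x (-y) = f x y) (k : Fin n) (x y : Vec n) :
    pdy f k x (-y) = - pdy f k x y := by
  have h := fderiv_comp_smul (f := fun y => f x y) (x := y) (-1 : ℝ)
  simp only [neg_one_smul, hf] at h
  rw [pdy, pdy, h, neg_apply, neg_neg]

theorem pdy_neg_of_odd (hf : ∀ x y, f x (-y) = - f x y) (k : Fin n) (x y : Vec n) :
    pdy f k x (-y) = pdy f k x y := by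
  have h := fderiv_comp_smul (f := fun y => f x y) (x := y) (-1 : ℝ)
  simp only [neg_one_smul, hf, fderiv_fun_neg, neg_inj] at h
  rw [pdy, pdy, h]

variable {G : Fin n → Vec n → Vec n → ℝ}

theorem curvOfSpray_neg (hG : ∀ i x y, G i x (-y) = G i x y) (i k : Fin n) (x y : Vec n) :
    curvOfSpray G i k x (-y) = curvOfSpray G i k x y := by
  have h1 : ∀ i k x y, pdy (G i) k x (-y) = - pdy (G i) k x y := fun i => pdy_neg (hG i)
  have h2 : ∀ i k j, pdy (fun x y => pdy (G i) k x y) j x (-y) =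
    pdy (fun x y => pdy (G i) k x y) j x y := fun i k j => pdy_neg_of_odd (h1 i k) j x y
  have h3 : ∀ i k j, pdx (fun x y => pdy (G i) k x y) j x (-y) =
      - pdx (fun x y => pdy (G i) k x y) j x y := fun i k j => by
    simp only [pdx, h1, fderiv_fun_neg, neg_apply]
  have h4 : pdx (G i) k x (-y) = pdx (G i) k x y := by simp only [pdx, hG]
  simp only [curvOfSpray, h1, h2, h3, h4, hG, Pi.neg_apply, neg_mul_neg]

theorem curvOfSpray_zero (hG : ∀ i x y, G i x (-y) = G i x y) (h0 : ∀ i x, G i x 0 = 0)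
    (i k : Fin n) (x : Vec n) : curvOfSpray G i k x 0 = 0 := by
  have h1 : ∀ i k, pdy (G i) k x 0 = 0 := fun i k => by
    have := pdy_neg (hG i) k x 0
    rw [neg_zero] at this
    linarith
  have h2 : pdx (G i) k x 0 = 0 := by simp [pdx, h0]
  simp [curvOfSpray, h1, h2, h0]

theorem sprayOf_neg (g : Vec n → Matrix (Fin n) (Fin n) ℝ) (i : Fin n) (x y : Vec n) :
    sprayOf g i x (-y) = sprayOf g i x y := by
  simp only [sprayOf, Pi.neg_apply, mul_neg, neg_mul, neg_neg]

theorem sprayOf_zero (g : Vec n → Matrix (Fin n) (Fin n) ℝ) (i : Fin n) (x : Vec n) :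
    sprayOf g i x 0 = 0 := by
  simp [sprayOf]

end Parity

namespace IsSquareDatum

open smoothAlgebra Matrix

variable {n : ℕ} {U : Set (Vec n)} {a : Vec n → Matrix (Fin n) (Fin n) ℝ} {b : Vec n → Vec n}

section Base

variable (h : IsSquareDatum U a b) {τ : Vec n → ℝ} (hτ : ContDiffOn ℝ (⊤ : ℕ∞) τ U)

theorem dy_base_metricCalc (k : Fin n) : h.metricCalc.dy k (base τ hτ) = 0 :=
  dy_base h.isOpen hτ k

theorem eval_dx_base_metricCalc (p : slit U) (k : Fin n) :
    eval p (h.metricCalc.dx k (base τ hτ)) = pd τ k p.1.1 := eval_dx_base h.isOpen hτ k p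

theorem metricCalc_c (hE : ∀ x ∈ U, ∀ i j, covDeriv a b i j x =
      τ x * ((1 + 2 * bsq a b x) * a x i j - 3 * b x i * b x j)) (i j : Fin n) :
    h.metricCalc.c i j = base τ hτ * ((1 + 2 * h.metricCalc.bb) * h.metricCalc.a i j
      - 3 * h.metricCalc.b i * h.metricCalc.b j) := ext_eval fun p => by
  simp only [map_mul, map_sub, map_add, map_one, map_ofNat, eval_c, eval_base, eval_bb, eval_a,
    eval_b, hE _ p.2.1]

end Base

/-- The odd part of the Ricci curvature of a square metric of constant flag curvature. -/
theorem odd_ricci (h : IsSquareDatum U a b) (hn : n ≠ 1) {K : ℝ}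
    (hK : IsConstFlag U (sqMetric a b) K) {x : Vec n} (hx : x ∈ U) {y : Vec n} (hy : y ≠ 0) :
    (y ⬝ᵥ a x *ᵥ y) * ((fun k => pd (factor a b) k x) ⬝ᵥ y + 2 * factor a b x ^ 2 * (b x ⬝ᵥ y))
      + 4 * K * (b x ⬝ᵥ y) * (y ⬝ᵥ a x *ᵥ y + (b x ⬝ᵥ y) ^ 2) = 0 := by
  obtain ⟨e, he⟩ := h.exists_inv_den₁
  obtain ⟨d, hd⟩ := h.exists_inv_den₂
  have hric := h.metricCalc.ricci_spray_sprayDiff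
    (h.metricCalc_c h.smooth_factor fun x hx => h.covDeriv_eq hK hx)
    (h.dy_base_metricCalc h.smooth_factor) (e := e) hd
  rw [Finset.sum_congr rfl fun i _ => (h.isConstFlag_iff he hd K).1 hK i i,
    MetricCalc.sum_flag] at hric
  have hR : ∀ p : slit U, ∀ i, eval p (h.metricCalc.curv h.metricCalc.spray i i) =
      curvOfSpray (sprayOf a) i i p.1.1 p.1.2 := fun p i =>
    h.represents_curv (fun i => h.represents_spray i) i i p
  have key : ∀ z, z ≠ 0 → z ⬝ᵥ a x *ᵥ z = y ⬝ᵥ a x *ᵥ y →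
    (∀ i, curvOfSpray (sprayOf a) i i x z = curvOfSpray (sprayOf a) i i x y) →
    ((n : ℝ) - 1) * (K * ((alphaOf a x y + b x ⬝ᵥ z) ^ 4 * (alphaOf a x y)⁻¹ ^ 2)) =
      ∑ i, curvOfSpray (sprayOf a) i i x y + (n - 1) * (factor a b x ^ 2 *
        ((5 + 4 * bsq a b x) * alphaOf a x y ^ 2 - 2 * (b x ⬝ᵥ z) ^ 2
          - 2 * alphaOf a x y * (b x ⬝ᵥ z))
        - ((fun k => pd (factor a b) k x) ⬝ᵥ z) * (alphaOf a x y - 2 * (b x ⬝ᵥ z)))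
      + (2 * ((fun k => pd (factor a b) k x) ⬝ᵥ dual a b x) * alphaOf a x y ^ 2
        - 2 * ((fun k => pd (factor a b) k x) ⬝ᵥ z) * (b x ⬝ᵥ z)
        - 2 * factor a b x ^ 2 * alphaOf a x y ^ 2 * bsq a b x
        + 2 * factor a b x ^ 2 * (b x ⬝ᵥ z) ^ 2) := fun z hz hq hc => by
    have hal : alphaOf a x z = alphaOf a x y := by
      rw [alphaOf, alphaOf, quad_eq, quad_eq, hq]
    have h1 := congrArg (eval (⟨(x, z), hx, hz⟩ : slit U)) hric
    simp only [map_mul, map_sub, map_add, map_pow, map_sum, map_one, map_ofNat, map_natCast,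
      AlgHom.commutes, MetricCalc.energy, eval_al, eval_ali, eval_be, eval_bb, eval_base, hR, hc,
      eval_dx_base_metricCalc, eval_y, eval_bu', hal, betaOf_eq, Algebra.algebraMap_self,
      RingHom.id_apply] at h1
    exact h1
  have k1 := key y hy rfl fun i => rfl
  have k2 := key (-y) (neg_ne_zero.2 hy) (by rw [mulVec_neg, neg_dotProduct_neg]) fun i =>
    curvOfSpray_neg (sprayOf_neg a) i i x y
  simp only [dotProduct_neg] at k2
  have hn1 : (n : ℝ) - 1 ≠ 0 := sub_ne_zero.2 (by exact_mod_cast hn)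
  have hal : alphaOf a x y ^ 2 * (alphaOf a x y)⁻¹ ^ 2 = 1 := by
    rw [← mul_pow, mul_inv_cancel₀ (h.alphaOf_pos hx hy).ne', one_pow]
  rw [← h.alphaOf_sq' hx]
  refine mul_left_cancel₀ hn1 ?_
  linear_combination (alphaOf a x y / 2) * (k1 - k2) -
    4 * (n - 1) * K * (b x ⬝ᵥ y) * (alphaOf a x y ^ 2 + (b x ⬝ᵥ y) ^ 2) * hal

theorem exists_orthogonal (hn : 1 < n) (w : Vec n) : ∃ v : Vec n, v ≠ 0 ∧ w ⬝ᵥ v = 0 := by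
  have h1 : LinearMap.ker (dotProductBilin ℝ ℝ w) ≠ ⊥ :=
    LinearMap.ker_ne_bot_of_finrank_lt (by simpa using hn)
  obtain ⟨v, hv, hv0⟩ := (Submodule.ne_bot_iff _).1 h1
  exact ⟨v, hv0, hv⟩

/-- A square metric of constant flag curvature is flat. -/
theorem flagCurvature_eq_zero (h : IsSquareDatum U a b) (hn : 1 < n) {K : ℝ}
    (hK : IsConstFlag U (sqMetric a b) K) {x : Vec n} (hx : x ∈ U) : K = 0 := by
  obtain ⟨v, hv0, hv⟩ := exists_orthogonal hn (b x)
  have hb := h.bsq_pos x hx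
  have hq : 0 < v ⬝ᵥ a x *ᵥ v := by rw [← quad_eq]; exact h.quad_pos hx hv0
  have key : ∀ s : ℝ, (bsq a b x + s ^ 2 * (v ⬝ᵥ a x *ᵥ v)) *
      ((fun k => pd (factor a b) k x) ⬝ᵥ dual a b x + s * ((fun k => pd (factor a b) k x) ⬝ᵥ v)
        + 2 * factor a b x ^ 2 * bsq a b x)
      + 4 * K * bsq a b x * (bsq a b x + s ^ 2 * (v ⬝ᵥ a x *ᵥ v) + bsq a b x ^ 2) = 0 :=
    fun s => by
    have hsv : b x ⬝ᵥ (s • v) = 0 := by rw [dotProduct_smul, hv, smul_zero]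
    have h1 := form_decomp a b hsv 1
    have h2 := h.quad_decomp hx hsv 1
    rw [one_smul, one_mul] at h1
    rw [one_smul, one_pow, one_mul, mulVec_smul, dotProduct_smul, smul_dotProduct] at h2
    have h3 := h.odd_ricci hn.ne' hK hx (y := dual a b x + s • v) fun h0 => by
      rw [h0, dotProduct_zero] at h1
      exact hb.ne h1
    rw [h1, h2, dotProduct_add, dotProduct_smul] at h3
    simp only [smul_eq_mul] at h3
    linear_combination h3
  have h0 := key 0
  have h1 := key 1
  have h2 := key (-1)
  have : K * (bsq a b x ^ 3 * (v ⬝ᵥ a x *ᵥ v)) = 0 := by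
    linear_combination (bsq a b x + v ⬝ᵥ a x *ᵥ v) / 4 * h0 - bsq a b x / 8 * (h1 + h2)
  exact (mul_eq_zero.1 this).resolve_right (by positivity)

theorem pd_factor (h : IsSquareDatum U a b) (hn : 1 < n) {K : ℝ}
    (hK : IsConstFlag U (sqMetric a b) K) {x : Vec n} (hx : x ∈ U) (i : Fin n) :
    pd (factor a b) i x = -2 * factor a b x ^ 2 * b x i := by
  have hy : (Pi.single i 1 : Vec n) ≠ 0 := by simp
  have h1 := h.odd_ricci hn.ne' hK hx hy
  rw [h.flagCurvature_eq_zero hn hK hx, dotProduct_single_one, dotProduct_single_one] at h1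
  have hq : 0 < (Pi.single i 1 : Vec n) ⬝ᵥ a x *ᵥ (Pi.single i 1 : Vec n) := by
    rw [← quad_eq]; exact h.quad_pos hx hy
  refine mul_left_cancel₀ hq.ne' ?_
  linear_combination h1

/-- Characterization of flatness in terms of the curvature of the Riemannian metric. -/
theorem isConstFlag_zero_iff (h : IsSquareDatum U a b) {τ : Vec n → ℝ}
    (hτ : ContDiffOn ℝ (⊤ : ℕ∞) τ U)
    (hE : ∀ x ∈ U, ∀ i j, covDeriv a b i j x =
      τ x * ((1 + 2 * bsq a b x) * a x i j - 3 * b x i * b x j))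
    (hd : ∀ x ∈ U, ∀ i, pd τ i x = -2 * τ x ^ 2 * b x i) :
    IsConstFlag U (sqMetric a b) 0 ↔ ∀ x ∈ U, ∀ y : Vec n, y ≠ 0 → ∀ i k,
      curvOfSpray (sprayOf a) i k x y =
        -(5 + 4 * bsq a b x) * τ x ^ 2 * (alphaOf a x y ^ 2 * (if i = k then 1 else 0)
          - y i * ∑ j, a x k j * y j)
        + 6 * τ x ^ 2 * (betaOf b x y ^ 2 * (if i = k then 1 else 0)
          + alphaOf a x y ^ 2 * (∑ j, (a x)⁻¹ i j * b x j) * b x k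
          - betaOf b x y * (∑ j, (a x)⁻¹ i j * b x j) * (∑ j, a x k j * y j)
          - betaOf b x y * b x k * y i) := by
  obtain ⟨e, he⟩ := h.exists_inv_den₁
  obtain ⟨d, hd'⟩ := h.exists_inv_den₂
  have hdx : ∀ k, h.metricCalc.dx k (base τ hτ) = -2 * base τ hτ ^ 2 * h.metricCalc.b k :=
    fun k => ext_eval fun p => by
      rw [eval_dx_base_metricCalc, hd _ p.2.1]
      simp only [map_mul, map_neg, map_pow, map_ofNat, eval_base, eval_b]
  rw [h.isConstFlag_iff he hd' 0]
  simp only [h.metricCalc.curv_spray_sprayDiff_of_dx (h.metricCalc_c hτ hE)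
    (h.dy_base_metricCalc hτ) hdx hd', map_zero, zero_mul, sub_eq_zero]
  have hR : ∀ (p : slit U) i k, eval p (h.metricCalc.curv h.metricCalc.spray i k) =
      curvOfSpray (sprayOf a) i k p.1.1 p.1.2 := fun p i k =>
    h.represents_curv (fun i => h.represents_spray i) i k p
  have hS : ∀ (p : slit U) i k, eval p (-(5 + 4 * h.metricCalc.bb) * base τ hτ ^ 2 *
        (h.metricCalc.al ^ 2 * (if i = k then 1 else 0) - h.metricCalc.y i * h.metricCalc.yl k)
      + 6 * base τ hτ ^ 2 * (h.metricCalc.be ^ 2 * (if i = k then 1 else 0)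
        + h.metricCalc.al ^ 2 * h.metricCalc.bu i * h.metricCalc.b k
        - h.metricCalc.be * h.metricCalc.bu i * h.metricCalc.yl k
        - h.metricCalc.be * h.metricCalc.b k * h.metricCalc.y i)) = _ := fun p i k => by
    simp only [map_mul, map_sub, map_add, map_neg, map_pow, map_ofNat, apply_ite, map_one,
      map_zero, eval_bb, eval_base, eval_al, eval_y, eval_yl, eval_be, eval_bu, eval_b]
    rfl
  refine ⟨fun hc x hx y hy i k => ?_, fun hc i k => ext_eval fun p => ?_⟩
  · rw [← hR ⟨(x, y), hx, hy⟩, hc, hS]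
    simp
  · rw [hR, hc _ p.2.1 _ p.2.2, hS]
    simp

end IsSquareDatum

/-- Corollary 5.1: a (non-Riemannian, `0 < b² < 1`) square metric in dimension
`n ≥ 3` is of constant flag curvature if and only if (E1)–(E3) hold together with
`λ = −(5+4b²)τ²`; in this case the constant flag curvature is `K = 0`. -/
theorem stmt_10 {n : ℕ} (hn : 3 ≤ n) (U : Set (Vec n))
    (hU : IsOpen U) (hconn : IsConnected U)
    (a : Vec n → Matrix (Fin n) (Fin n) ℝ) (b : Vec n → Vec n)
    (ha : ∀ i j, ContDiffOn ℝ (⊤ : ℕ∞) (fun x => a x i j) U)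
    (hsym : ∀ x ∈ U, (a x).IsSymm)
    (hpos : ∀ x ∈ U, (a x).PosDef)
    (hb : ∀ i, ContDiffOn ℝ (⊤ : ℕ∞) (fun x => b x i) U)
    (hb2 : ∀ x ∈ U, 0 < bsq a b x ∧ bsq a b x < 1) :
    ((∃ K : ℝ, IsConstFlag U (sqMetric a b) K) ↔
      (∃ τ lam : Vec n → ℝ, ContDiffOn ℝ (⊤ : ℕ∞) τ U ∧ ContDiffOn ℝ (⊤ : ℕ∞) lam U ∧
        E123 U a b τ lam ∧
        ∀ x ∈ U, lam x = -(5 + 4 * bsq a b x) * (τ x)^2)) ∧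
    (∀ K : ℝ, IsConstFlag U (sqMetric a b) K → K = 0) := by
  have h : IsSquareDatum U a b :=
    ⟨hU, ha, hsym, hpos, hb, fun x hx => (hb2 x hx).1, fun x hx => (hb2 x hx).2⟩
  obtain ⟨x₀, hx₀⟩ := hconn.nonempty
  have hn1 : 1 < n := by lia
  have hzero : ∀ K : ℝ, IsConstFlag U (sqMetric a b) K → K = 0 := fun K hK =>
    h.flagCurvature_eq_zero hn1 hK hx₀
  refine ⟨⟨?_, ?_⟩, hzero⟩
  · rintro ⟨K, hK⟩
    have hE := fun x (hx : x ∈ U) => h.covDeriv_eq hK hx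
    have hd := fun x (hx : x ∈ U) => h.pd_factor hn1 hK hx
    have hflat := (h.isConstFlag_zero_iff h.smooth_factor hE hd).1 (hzero K hK ▸ hK)
    refine ⟨IsSquareDatum.factor a b,
      fun x => -(5 + 4 * bsq a b x) * IsSquareDatum.factor a b x ^ 2, h.smooth_factor,
      ((contDiffOn_const.add (contDiffOn_const.mul h.smooth_bsq)).neg.mul
        (h.smooth_factor.pow 2)), ⟨hE, fun x hx y i k => ?_, fun x hx i => ?_⟩, fun _ _ => rfl⟩
    · by_cases hy : y = 0
      · subst hy
        rw [curvOfSpray_zero (sprayOf_neg a) (sprayOf_zero a)]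
        simp [alphaOf, betaOf]
      · rw [hflat x hx y hy i k]
        ring
    · rw [hd x hx i]
      ring
  · rintro ⟨τ, lam, hτ, -, ⟨hE, hR, hd⟩, hlam⟩
    refine ⟨0, (h.isConstFlag_zero_iff hτ hE fun x hx i => ?_).2 fun x hx y _ i k => ?_⟩
    · rw [hd x hx, hlam x hx]
      ring
    · rw [hR x hx, hlam x hx]
      ring
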